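/- Let g ≥ 2 and let Γ_g be the fundamental group of the closed orientable surface of genus g, presented as ⟨a₁, b₁, …, a_g, b_g | [a₁,b₁][a₂,b₂]⋯[a_g,b_g]⟩. Then Γ_g admits no properly discontinuous action on ℝ³ by affine transformations. (Mess's theorem: a closed surface group cannot have a proper affine action on ℝ³.) -/

import Mathlib

open scoped commutatorElement

/-- The surface relator `[a₁,b₁][a₂,b₂]⋯[a_g,b_g]` in the free group on generators
`a₁, b₁, …, a_g, b_g` (the `a`'s indexed by `Sum.inl`, the `b`'s by `Sum.inr`). -/
def surfaceRelator (g : ℕ) : FreeGroup (Fin g ⊕ Fin g) :=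
  (List.ofFn fun i : Fin g =>
    ⁅(FreeGroup.of (Sum.inl i) : FreeGroup (Fin g ⊕ Fin g)), FreeGroup.of (Sum.inr i)⁆).prod

/-- The fundamental group of the closed orientable surface of genus `g`, presented as
`⟨a₁, b₁, …, a_g, b_g | [a₁,b₁][a₂,b₂]⋯[a_g,b_g]⟩`. -/
abbrev SurfaceGroup (g : ℕ) : Type :=
  PresentedGroup ({surfaceRelator g} : Set (FreeGroup (Fin g ⊕ Fin g)))


open scoped commutatorElement

namespace Mess

/-! ### Group-theoretic facts about surface groups -/

lemma lift_relator {g : ℕ} {G : Type*} [Group G] (f : Fin g ⊕ Fin g → G) :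
    FreeGroup.lift f (surfaceRelator g)
      = (List.ofFn fun i : Fin g => ⁅f (Sum.inl i), f (Sum.inr i)⁆).prod := by
  simp only [surfaceRelator, map_list_prod, List.map_ofFn, Function.comp_def,
    map_commutatorElement, FreeGroup.lift_apply_of]

lemma lift_relator_eq_one {g : ℕ} {G : Type*} [Group G] (f : Fin g ⊕ Fin g → G)
    (h : ∀ i, ⁅f (Sum.inl i), f (Sum.inr i)⁆ = 1) :
    FreeGroup.lift f (surfaceRelator g) = 1 := by
  rw [lift_relator]
  simp [h]

/-- Homomorphisms from the surface group. -/
def homOf {g : ℕ} {G : Type*} [Group G] (f : Fin g ⊕ Fin g → G)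
    (h : FreeGroup.lift f (surfaceRelator g) = 1) : SurfaceGroup g →* G :=
  PresentedGroup.toGroup (f := f) (by
    intro r hr
    rw [Set.mem_singleton_iff] at hr
    rw [hr]; exact h)

lemma homOf_of {g : ℕ} {G : Type*} [Group G] (f : Fin g ⊕ Fin g → G)
    (h : FreeGroup.lift f (surfaceRelator g) = 1) (s : Fin g ⊕ Fin g) :
    homOf f h (PresentedGroup.of s) = f s := by
  simp [homOf]

lemma h_one (g : ℕ) (hg : 2 ≤ g) :
    ∃ a : SurfaceGroup g →* Multiplicative ℤ, ∃ δ, a δ = Multiplicative.ofAdd 1 := by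
  refine ⟨homOf (fun _ => Multiplicative.ofAdd 1) (lift_relator_eq_one _ ?_),
    PresentedGroup.of (Sum.inl ⟨0, by omega⟩), ?_⟩
  · intro i; simp
  · rw [homOf_of]

lemma exists_hom_free (g : ℕ) (hg : 2 ≤ g) :
    ∃ a : SurfaceGroup g →* FreeGroup (Fin 2), Function.Surjective a := by
  let f : Fin g ⊕ Fin g → FreeGroup (Fin 2) := fun s => match s with
    | Sum.inl i => if i.val = 0 then FreeGroup.of 0 else if i.val = 1 then FreeGroup.of 1 else 1
    | Sum.inr _ => 1
  have hf : FreeGroup.lift f (surfaceRelator g) = 1 :=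
    lift_relator_eq_one _ (fun i => by simp [f])
  refine ⟨homOf f hf, ?_⟩
  rw [← MonoidHom.range_eq_top, eq_top_iff, ← FreeGroup.closure_range_of, Subgroup.closure_le]
  rintro _ ⟨i, rfl⟩
  fin_cases i
  · exact ⟨PresentedGroup.of (Sum.inl ⟨0, by omega⟩), by rw [homOf_of]; simp [f]⟩
  · exact ⟨PresentedGroup.of (Sum.inl ⟨1, by omega⟩), by rw [homOf_of]; simp [f]⟩

lemma free_two_not_solvable : ¬ Group.IsSolvable (FreeGroup (Fin 2)) := by
  intro h
  apply Equiv.Perm.not_isSolvable_fin_5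
  let φ : FreeGroup (Fin 2) →* Equiv.Perm (Fin 5) :=
    FreeGroup.lift ![finRotate 5, Equiv.swap 0 1]
  have hφ : Function.Surjective φ := by
    rw [← MonoidHom.range_eq_top, eq_top_iff]
    have h5 : Subgroup.closure ({finRotate 5, Equiv.swap 0 1} : Set (Equiv.Perm (Fin 5))) = ⊤ := by
      apply Equiv.Perm.closure_prime_cycle_swap
      · simp; norm_num
      · exact isCycle_finRotate
      · exact support_finRotate
      · exact ⟨0, 1, by decide, rfl⟩
    rw [← h5, Subgroup.closure_le]
    rintro x (rfl | rfl)
    · exact ⟨FreeGroup.of 0, by simp [φ]⟩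
    · exact ⟨FreeGroup.of 1, by simp [φ]⟩
  exact Group.isSolvable_of_surjective hφ

lemma finite_eq_bot {G : Type*} [Group G] [IsMulTorsionFree G] (H : Subgroup G)
    (h : (H : Set G).Finite) : H = ⊥ := by
  rw [eq_bot_iff]
  intro x hx
  rw [Subgroup.mem_bot]
  have : ¬ Function.Injective (fun n : ℕ => x ^ n) := by
    intro hi
    exact Set.infinite_range_of_injective hi (h.subset (by
      rintro _ ⟨n, rfl⟩; exact H.pow_mem hx n))
  have h2 : IsOfFinOrder x := by
    by_contra h3
    exact this (injective_pow_iff_not_isOfFinOrder.mpr h3)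
  obtain ⟨n, hn, hxn⟩ := isOfFinOrder_iff_pow_eq_one.mp h2
  exact (pow_eq_one_iff_left (by omega)).mp hxn

lemma h_two (g : ℕ) (hg : 2 ≤ g) (k : ℕ) :
    ¬ (derivedSeries (SurfaceGroup g) k : Set (SurfaceGroup g)).Finite := by
  intro hfin
  obtain ⟨a, ha⟩ := exists_hom_free g hg
  have h1 := map_derivedSeries_eq ha k
  have h2 : (derivedSeries (FreeGroup (Fin 2)) k : Set (FreeGroup (Fin 2))).Finite := by
    rw [← h1, Subgroup.coe_map]
    exact hfin.image _
  exact free_two_not_solvable ⟨k, finite_eq_bot _ h2⟩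

lemma h_three (g : ℕ) (hg : 2 ≤ g) (m : ℕ) (hm : 1 ≤ m) :
    ∃ x y : SurfaceGroup g, ∀ n : ℕ, 1 ≤ n → ⁅x ^ m, y ^ m⁆ ^ n ≠ 1 := by
  obtain ⟨a, ha⟩ := exists_hom_free g hg
  obtain ⟨x, hx⟩ := ha (FreeGroup.of 0)
  obtain ⟨y, hy⟩ := ha (FreeGroup.of 1)
  refine ⟨x, y, fun n hn h => ?_⟩
  have h1 : ⁅(FreeGroup.of 0 : FreeGroup (Fin 2)) ^ m, (FreeGroup.of 1 : FreeGroup (Fin 2)) ^ m⁆ ^ n = 1 := by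
    rw [← hx, ← hy, ← map_pow, ← map_pow, ← map_commutatorElement, ← map_pow, h, map_one]
  have h2 := (pow_eq_one_iff_left (by omega)).mp h1
  let φ : FreeGroup (Fin 2) →* Equiv.Perm ℚ :=
    FreeGroup.lift ![Equiv.addRight 1, Equiv.mulRight₀ 2 (by norm_num)]
  have h3 := congrArg φ h2
  rw [map_one, map_commutatorElement, commutatorElement_eq_one_iff_mul_comm] at h3
  have h4 := congrArg (fun e : Equiv.Perm ℚ => e 0) h3
  have hx1 : ∀ t : ℚ, ((Equiv.addRight 1 : Equiv.Perm ℚ) ^ m) t = t + m := by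
    intro t
    clear hm h h1 h2 h3 h4
    induction m with
    | zero => simp
    | succ k ih => rw [pow_succ', Equiv.Perm.mul_apply, ih]; simp; ring
  have hy1 : ∀ t : ℚ, ((Equiv.mulRight₀ 2 (by norm_num) : Equiv.Perm ℚ) ^ m) t = t * 2 ^ m := by
    intro t
    clear hx1 hm h h1 h2 h3 h4
    induction m with
    | zero => simp
    | succ k ih => rw [pow_succ', Equiv.Perm.mul_apply, ih]; simp [pow_succ]; ring
  simp only [φ, map_pow, FreeGroup.lift_apply_of, Equiv.Perm.mul_apply, Matrix.cons_val_zero,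
    Matrix.cons_val_one, hx1, hy1] at h4
  have hm0 : (0 : ℚ) < m := by exact_mod_cast hm
  have h2m : (1 : ℚ) < 2 ^ m := one_lt_pow₀ (by norm_num) (by omega)
  nlinarith

lemma h_four (g : ℕ) : ∃ S : Finset (SurfaceGroup g),
    Subgroup.closure (S : Set (SurfaceGroup g)) = ⊤ := by
  classical
  refine ⟨Finset.univ.image PresentedGroup.of, ?_⟩
  rw [Finset.coe_image, Finset.coe_univ, Set.image_univ]
  exact PresentedGroup.closure_range_of _

end Mess

open scoped commutatorElement

namespace Mess

/-! ### One-endedness of surface groups -/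

/-- Partial products. -/
def pp {G : Type*} [Group G] (f : ℕ → G) : ℕ → G
  | 0 => 1
  | k + 1 => pp f k * f k

lemma ofFn_prod {G : Type*} [Group G] (f : ℕ → G) (g : ℕ) :
    (List.ofFn fun i : Fin g => f i).prod = pp f g := by
  induction g with
  | zero => simp [pp]
  | succ k ih =>
    rw [List.ofFn_succ', List.concat_eq_append, List.prod_append]
    simp only [Fin.val_castSucc, Fin.val_last, List.prod_singleton, pp, ih]

/-- The affine permutation of `Z` with linear part `σ γ` and translation part `z`. -/
def affPerm {Γ Z : Type*} [Group Γ] [AddCommGroup Z] (σ : Γ → Z →+ Z)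
    (h1 : ∀ z, σ 1 z = z) (hm : ∀ γ δ z, σ (γ * δ) z = σ γ (σ δ z)) (z : Z) (γ : Γ) :
    Equiv.Perm Z where
  toFun x := z + σ γ x
  invFun x := σ γ⁻¹ (x - z)
  left_inv x := by
    simp only
    rw [add_sub_cancel_left, ← hm, inv_mul_cancel, h1]
  right_inv x := by
    simp only
    rw [← hm, mul_inv_cancel, h1, add_sub_cancel]

section
variable {Γ Z : Type*} [Group Γ] [AddCommGroup Z] (σ : Γ → Z →+ Z)
    (h1 : ∀ z, σ 1 z = z) (hm : ∀ γ δ z, σ (γ * δ) z = σ γ (σ δ z))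

lemma affPerm_mul (z w : Z) (γ δ : Γ) :
    affPerm σ h1 hm z γ * affPerm σ h1 hm w δ = affPerm σ h1 hm (z + σ γ w) (γ * δ) := by
  ext x
  simp only [affPerm, Equiv.Perm.mul_apply, Equiv.coe_fn_mk, map_add, hm, add_assoc]

lemma affPerm_one : affPerm σ h1 hm 0 1 = 1 := by
  ext x
  simp only [affPerm, Equiv.coe_fn_mk, h1, zero_add, Equiv.Perm.one_apply]

lemma affPerm_inv (z : Z) (γ : Γ) :
    (affPerm σ h1 hm z γ)⁻¹ = affPerm σ h1 hm (- σ γ⁻¹ z) γ⁻¹ := by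
  rw [inv_eq_iff_mul_eq_one, affPerm_mul, map_neg, ← hm, mul_inv_cancel, h1, add_neg_cancel,
    affPerm_one]

end

/-- Generators of the surface group indexed by naturals. -/
def gA (g : ℕ) (i : ℕ) : SurfaceGroup g :=
  if h : i < g then PresentedGroup.of (Sum.inl ⟨i, h⟩) else 1
/-- Generators of the surface group indexed by naturals. -/
def gB (g : ℕ) (i : ℕ) : SurfaceGroup g :=
  if h : i < g then PresentedGroup.of (Sum.inr ⟨i, h⟩) else 1

lemma gA_fin {g : ℕ} (i : Fin g) : gA g i = PresentedGroup.of (Sum.inl i) := by simp [gA]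
lemma gB_fin {g : ℕ} (i : Fin g) : gB g i = PresentedGroup.of (Sum.inr i) := by simp [gB]

/-- Boundary partial words. -/
def gP (g : ℕ) : ℕ → SurfaceGroup g := pp fun i => ⁅gA g i, gB g i⁆

lemma gP_zero (g : ℕ) : gP g 0 = 1 := rfl
lemma gP_succ (g i : ℕ) : gP g (i + 1) = gP g i * ⁅gA g i, gB g i⁆ := rfl

lemma gP_last (g : ℕ) : gP g g = 1 := by
  rw [gP, ← ofFn_prod]
  simp only [gA_fin, gB_fin]
  rw [← lift_relator (fun s => (PresentedGroup.of s : SurfaceGroup g))]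
  have h : FreeGroup.lift (fun s => (PresentedGroup.of s : SurfaceGroup g))
      = PresentedGroup.mk ({surfaceRelator g} : Set (FreeGroup (Fin g ⊕ Fin g))) := by
    ext s
    simp [PresentedGroup.of]
  rw [h]
  exact PresentedGroup.one_of_mem (Set.mem_singleton _)

lemma exists_cocycle {g : ℕ} {Z : Type*} [AddCommGroup Z] (σ : SurfaceGroup g → Z →+ Z)
    (h1 : ∀ z, σ 1 z = z) (hm : ∀ γ δ z, σ (γ * δ) z = σ γ (σ δ z))
    (ea eb : SurfaceGroup g → ℕ → Z)
    (hea : ∀ γ δ s, σ γ (ea δ s) = ea (γ * δ) s) (heb : ∀ γ δ s, σ γ (eb δ s) = eb (γ * δ) s)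
    (hrel : ∑ i ∈ Finset.range g, (ea (gA g i)⁻¹ i - ea 1 i + (eb (gB g i)⁻¹ i - eb 1 i)) = 0) :
    ∃ D : SurfaceGroup g → Z, (∀ γ δ, D (γ * δ) = D γ + σ γ (D δ)) ∧
      ∀ i, i < g →
        D (gP g i * gA g i * (gB g i)⁻¹ * (gA g i)⁻¹ * (gP g i)⁻¹) = ea (gP g i) i ∧
        D (gP g i * gA g i * (gP g (i + 1))⁻¹) = eb (gP g i * gA g i) i := by
  let T := affPerm σ h1 hm
  let α : ℕ → SurfaceGroup g := fun i => gP g i * gA g i * (gB g i)⁻¹ * (gA g i)⁻¹ * (gP g i)⁻¹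
  let β : ℕ → SurfaceGroup g := fun i => gP g i * gA g i * (gP g (i + 1))⁻¹
  let α' : ℕ → Equiv.Perm Z := fun i => T (ea (gP g i) i) (α i)
  let β' : ℕ → Equiv.Perm Z := fun i => T (eb (gP g i * gA g i) i) (β i)
  let P' : ℕ → Equiv.Perm Z := fun k => Nat.rec 1 (fun i p => ⁅(β' i)⁻¹, α' i⁆ * p) k
  have hP0 : P' 0 = 1 := rfl
  have hPs : ∀ i, P' (i + 1) = ⁅(β' i)⁻¹, α' i⁆ * P' i := fun i => rfl
  let A' : ℕ → Equiv.Perm Z := fun i => (P' i)⁻¹ * (α' i * β' i * (α' i)⁻¹) * P' i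
  let B' : ℕ → Equiv.Perm Z := fun i =>
    (P' i)⁻¹ * ((α' i * β' i * (α' i)⁻¹)⁻¹ * (α' i)⁻¹ * (α' i * β' i * (α' i)⁻¹)) * P' i
  have hcomm : ∀ i, P' (i + 1) = P' i * ⁅A' i, B' i⁆ := by
    intro i
    rw [hPs]
    simp only [A', B', commutatorElement_def]
    group
  have hpp : ∀ k, pp (fun i => ⁅A' i, B' i⁆) k = P' k := by
    intro k
    induction k with
    | zero => rfl
    | succ k ih => rw [pp, ih, hcomm]
  -- translation part of the partial words
  have hval : ∀ k, P' k = T (σ (gP g k) (∑ i ∈ Finset.range k,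
      (ea (gA g i)⁻¹ i - ea 1 i + (eb (gB g i)⁻¹ i - eb 1 i)))) (gP g k) := by
    intro k
    induction k with
    | zero =>
      simp only [Finset.range_zero, Finset.sum_empty, map_zero, hP0, gP_zero]
      exact (affPerm_one σ h1 hm).symm
    | succ k ih =>
      rw [hPs, ih]
      simp only [α', β', T, commutatorElement_def, affPerm_mul, affPerm_inv, inv_inv, map_neg,
        hea, heb]
      have hg1 : (β k)⁻¹ * α k * β k * (α k)⁻¹ * gP g k = gP g (k + 1) := by
        simp only [α, β, gP_succ, commutatorElement_def]; group
      congr 1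
      · rw [Finset.sum_range_succ, map_add, ← hm, hg1, add_comm (σ (gP g (k + 1)) _)]
        congr 1
        simp only [map_add, map_sub, hea, heb]
        have e1 : (β k)⁻¹ * (gP g k * gA g k) = gP g (k + 1) * 1 := by
          simp only [β]; group
        have e2 : (β k)⁻¹ * gP g k = gP g (k + 1) * (gA g k)⁻¹ := by
          simp only [β]; group
        have e3 : (β k)⁻¹ * α k * (β k * ((β k)⁻¹ * (gP g k * gA g k))) = gP g (k + 1) * (gB g k)⁻¹ := by
          simp only [α, β]; group
        have e4 : (β k)⁻¹ * α k * β k * ((α k)⁻¹ * gP g k) = gP g (k + 1) * 1 := by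
          rw [← mul_assoc, hg1, mul_one]
        rw [e3, e1, e2, e4]
        abel
  have hrel' : FreeGroup.lift (Sum.elim (fun i : Fin g => A' i) (fun i : Fin g => B' i))
      (surfaceRelator g) = 1 := by
    rw [lift_relator]
    simp only [Sum.elim_inl, Sum.elim_inr]
    rw [ofFn_prod (fun i => ⁅A' i, B' i⁆), hpp, hval, hrel, map_zero, gP_last]
    exact affPerm_one σ h1 hm
  let R := homOf _ hrel'
  have hRA : ∀ i, i < g → R (gA g i) = A' i := by
    intro i hi
    simp only [gA, hi, dif_pos, R, homOf_of, Sum.elim_inl]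
  have hRB : ∀ i, i < g → R (gB g i) = B' i := by
    intro i hi
    simp only [gB, hi, dif_pos, R, homOf_of, Sum.elim_inr]
  have hRP : ∀ k, k ≤ g → R (gP g k) = P' k := by
    intro k
    induction k with
    | zero => intro _; rw [gP_zero, map_one, hP0]
    | succ k ih =>
      intro hk
      rw [gP_succ, map_mul, ih (by omega), map_commutatorElement, hRA k (by omega),
        hRB k (by omega), hcomm]
  have hRα : ∀ i, i < g → R (α i) = α' i := by
    intro i hi
    simp only [α, map_mul, map_inv, hRA i hi, hRB i hi, hRP i hi.le]
    simp only [A', B']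
    group
  have hRβ : ∀ i, i < g → R (β i) = β' i := by
    intro i hi
    simp only [β, map_mul, map_inv, hRA i hi, hRP i hi.le, hRP (i + 1) hi, hPs,
      commutatorElement_def]
    simp only [A']
    group
  have hA'f : ∀ i, A' i = T (A' i 0) (gA g i) := by
    intro i
    simp only [A', hval i, α', β', T, affPerm_mul, affPerm_inv]
    rw [show (gP g i)⁻¹ * (α i * β i * (α i)⁻¹) * gP g i = gA g i by
      simp only [α, β, gP_succ, commutatorElement_def]; group]
    congr 1
    simp [affPerm]
  have hB'f : ∀ i, B' i = T (B' i 0) (gB g i) := by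
    intro i
    simp only [B', hval i, α', β', T, affPerm_mul, affPerm_inv]
    rw [show (gP g i)⁻¹ * ((α i * β i * (α i)⁻¹)⁻¹ * (α i)⁻¹ * (α i * β i * (α i)⁻¹)) * gP g i
        = gB g i by
      simp only [α, β, gP_succ, commutatorElement_def]; group]
    congr 1
    simp [affPerm]
  -- the linear part of R is σ
  have hlin : ∀ γ, R γ = T (R γ 0) γ := by
    intro γ
    have : γ ∈ Subgroup.closure (Set.range (PresentedGroup.of :
        Fin g ⊕ Fin g → SurfaceGroup g)) := by
      rw [PresentedGroup.closure_range_of]; trivial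
    induction this using Subgroup.closure_induction with
    | mem x hx =>
      obtain ⟨s, rfl⟩ := hx
      rcases s with i | i
      · rw [← gA_fin, hRA i i.2]; exact hA'f i
      · rw [← gB_fin, hRB i i.2]; exact hB'f i
    | one => rw [map_one]; exact (affPerm_one σ h1 hm).symm
    | mul x y _ _ hx hy =>
      rw [map_mul, hx, hy]
      simp only [T, affPerm_mul]
      congr 1
      simp [affPerm]
    | inv x _ hx =>
      rw [map_inv, hx]
      simp only [T, affPerm_inv]
      congr 1
      simp [affPerm]
  refine ⟨fun γ => R γ 0, ?_, ?_⟩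
  · intro γ δ
    simp only
    rw [map_mul, hlin γ]
    simp [T, affPerm]
  · intro i hi
    constructor
    · change R (α i) 0 = _
      rw [hRα i hi]; simp [α', T, affPerm]
    · change R (β i) 0 = _
      rw [hRβ i hi]; simp [β', T, affPerm]

end Mess

open scoped commutatorElement

namespace Mess

/-- Finitely supported 1-cochains. -/
abbrev Coch (g : ℕ) := (SurfaceGroup g × (Fin g ⊕ Fin g)) →₀ ℤ

/-- The coboundary map. -/
noncomputable def cobd (g : ℕ) : (SurfaceGroup g →₀ ℤ) →+ Coch g :=
  ∑ s : Fin g ⊕ Fin g, (Finsupp.mapDomain.addMonoidHom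
      (fun γ : SurfaceGroup g => (γ * (PresentedGroup.of s)⁻¹, s))
    - Finsupp.mapDomain.addMonoidHom (fun γ : SurfaceGroup g => (γ, s)))

lemma cobd_single (g : ℕ) (γ : SurfaceGroup g) (n : ℤ) :
    cobd g (Finsupp.single γ n) = ∑ s : Fin g ⊕ Fin g,
      (Finsupp.single (γ * (PresentedGroup.of s)⁻¹, s) n - Finsupp.single (γ, s) n) := by
  simp [cobd, Finsupp.mapDomain.addMonoidHom, Finsupp.mapDomain_single]

lemma cobd_apply (g : ℕ) (h : SurfaceGroup g →₀ ℤ) (γ : SurfaceGroup g) (s : Fin g ⊕ Fin g) :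
    cobd g h (γ, s) = h (γ * PresentedGroup.of s) - h γ := by
  classical
  induction h using Finsupp.induction_linear with
  | zero => simp
  | add f k hf hk => rw [map_add, Finsupp.add_apply, hf, hk]; simp; ring
  | single a b =>
    rw [cobd_single, Finsupp.finsetSum_apply, Finset.sum_eq_single s]
    · simp only [Finsupp.sub_apply, Finsupp.single_apply, Prod.mk.injEq, and_true]
      congr 2
      rw [mul_inv_eq_iff_eq_mul]
    · intro t _ hts
      simp [hts]
    · simp

/-- Left translation on cochains. -/
noncomputable def actE (g : ℕ) (γ : SurfaceGroup g) : Coch g →+ Coch g :=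
  Finsupp.mapDomain.addMonoidHom (fun x => (γ * x.1, x.2))

lemma actE_single (g : ℕ) (γ : SurfaceGroup g) (x) (n : ℤ) :
    actE g γ (Finsupp.single x n) = Finsupp.single (γ * x.1, x.2) n := by
  simp [actE, Finsupp.mapDomain.addMonoidHom, Finsupp.mapDomain_single]

lemma actE_cobd (g : ℕ) (γ : SurfaceGroup g) :
    (cobd g).range ≤ (cobd g).range.comap (actE g γ) := by
  rintro _ ⟨h, rfl⟩
  rw [AddSubgroup.mem_comap]
  induction h using Finsupp.induction_linear with
  | zero => simp [zero_mem]
  | add f k hf hk => rw [map_add, map_add]; exact add_mem hf hk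
  | single a b =>
    refine ⟨Finsupp.single (γ * a) b, ?_⟩
    rw [cobd_single, cobd_single, map_sum]
    simp only [map_sub, actE_single, mul_assoc]

/-- The first compactly supported cohomology. -/
abbrev HZ (g : ℕ) := Coch g ⧸ (cobd g).range

/-- The action on `HZ`. -/
noncomputable def actZ (g : ℕ) (γ : SurfaceGroup g) : HZ g →+ HZ g :=
  QuotientAddGroup.map _ _ (actE g γ) (actE_cobd g γ)

/-- The basic classes. -/
noncomputable def eZ (g : ℕ) (γ : SurfaceGroup g) (s : Fin g ⊕ Fin g) : HZ g :=
  QuotientAddGroup.mk' _ (Finsupp.single (γ, s) 1)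

lemma actZ_eZ (g : ℕ) (γ δ : SurfaceGroup g) (s) :
    actZ g γ (eZ g δ s) = eZ g (γ * δ) s := by
  simp only [actZ, eZ, QuotientAddGroup.mk'_apply, QuotientAddGroup.map_mk, actE_single]

lemma actZ_one (g : ℕ) (z : HZ g) : actZ g 1 z = z := by
  have : actZ g 1 = AddMonoidHom.id _ := by
    apply QuotientAddGroup.addMonoidHom_ext
    apply Finsupp.addHom_ext
    intro x n
    simp only [AddMonoidHom.comp_apply, QuotientAddGroup.mk'_apply, actZ,
      QuotientAddGroup.map_mk, actE_single, one_mul, AddMonoidHom.id_apply]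
  rw [this]; rfl

lemma actZ_mul (g : ℕ) (γ δ : SurfaceGroup g) (z : HZ g) :
    actZ g (γ * δ) z = actZ g γ (actZ g δ z) := by
  have : actZ g (γ * δ) = (actZ g γ).comp (actZ g δ) := by
    apply QuotientAddGroup.addMonoidHom_ext
    apply Finsupp.addHom_ext
    intro x n
    simp only [AddMonoidHom.comp_apply, QuotientAddGroup.mk'_apply, actZ,
      QuotientAddGroup.map_mk, actE_single, mul_assoc]
  rw [this]; rfl

lemma finsum_shift {G Z : Type*} [Group G] [AddCommGroup Z] (w : G → ℤ)
    (hw : (Function.support w).Finite) (e D : G → Z) (p α : G)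
    (h : ∀ ε, e (ε * p) = D (ε * α) - D ε) :
    ∑ᶠ γ, w γ • e γ = ∑ᶠ ε, (w (ε * α⁻¹ * p) - w (ε * p)) • D ε := by
  have hs : ∀ q : G, (Function.support fun ε => w (ε * q)).Finite := by
    intro q
    refine (hw.preimage (f := fun ε => ε * q) (mul_left_injective q).injOn).subset ?_
    intro x hx; exact hx
  have hs2 : ∀ (q : G) (F : G → Z), (Function.support fun ε => w (ε * q) • F ε).Finite := by
    intro q F
    refine (hs q).subset ?_
    intro x hx
    rw [Function.mem_support] at *
    intro h0; apply hx; rw [h0, zero_smul]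
  calc ∑ᶠ γ, w γ • e γ = ∑ᶠ ε, w (ε * p) • e (ε * p) :=
        (finsum_comp_equiv (Equiv.mulRight p) (f := fun γ => w γ • e γ)).symm
    _ = ∑ᶠ ε, (w (ε * p) • D (ε * α) - w (ε * p) • D ε) := by
        simp only [h, smul_sub]
    _ = ∑ᶠ ε, w (ε * p) • D (ε * α) - ∑ᶠ ε, w (ε * p) • D ε :=
        finsum_sub_distrib (hs2 _ _) (hs2 _ _)
    _ = ∑ᶠ ε, w (ε * α⁻¹ * p) • D ε - ∑ᶠ ε, w (ε * p) • D ε := by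
        congr 1
        rw [← finsum_comp_equiv (Equiv.mulRight α) (f := fun ε => w (ε * α⁻¹ * p) • D ε)]
        simp
    _ = ∑ᶠ ε, (w (ε * α⁻¹ * p) - w (ε * p)) • D ε := by
        rw [← finsum_sub_distrib]
        · simp only [sub_smul]
        · have h7 := hs2 (α⁻¹ * p) D
          simp only [← mul_assoc] at h7
          exact h7
        · exact hs2 _ _

lemma h_five (g : ℕ) (f : SurfaceGroup g → ℤ)
    (hf : ∀ s, {γ | f (γ * s) ≠ f γ}.Finite) : ∃ c, {γ | f γ ≠ c}.Finite := by
  classical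
  let w : (Fin g ⊕ Fin g) → SurfaceGroup g → ℤ := fun s γ => f (γ * PresentedGroup.of s) - f γ
  have hw : ∀ s, (Function.support (w s)).Finite := by
    intro s
    refine (hf (PresentedGroup.of s)).subset ?_
    intro x hx
    simp only [w, Function.mem_support] at hx
    exact fun h => hx (by rw [h, sub_self])
  -- the class of w
  let ws : (Fin g ⊕ Fin g) → SurfaceGroup g →₀ ℤ := fun s => Finsupp.ofSupportFinite (w s) (hw s)
  let U : Coch g := ∑ s, Finsupp.mapDomain (fun γ => (γ, s)) (ws s)
  have hU : ∀ γ s, U (γ, s) = w s γ := by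
    intro γ s
    simp only [U, Finsupp.finsetSum_apply]
    rw [Finset.sum_eq_single s]
    · rw [Finsupp.mapDomain_apply]
      · rfl
      · intro a b hab; exact (Prod.mk.inj hab).1
    · intro t _ hts
      rw [Finsupp.mapDomain_of_notMem_range]
      rintro ⟨x, hx⟩
      exact hts (Prod.mk.inj hx).2
    · simp
  have hUmk : (QuotientAddGroup.mk' (cobd g).range U) = ∑ s, ∑ᶠ γ, w s γ • eZ g γ s := by
    simp only [U, map_sum]
    refine Finset.sum_congr rfl fun s _ => ?_
    have h1 : (Function.support fun γ => w s γ • eZ g γ s) ⊆ ((ws s).support : Set _) := by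
      intro x hx
      simp only [Finset.mem_coe, Finsupp.mem_support_iff]
      intro h0
      apply hx
      have : w s x = 0 := h0
      simp [this]
    rw [finsum_eq_sum_of_support_subset _ h1, Finsupp.mapDomain, Finsupp.sum, map_sum]
    refine Finset.sum_congr rfl fun γ _ => ?_
    rw [eZ, ← map_zsmul, Finsupp.smul_single, smul_eq_mul, mul_one]
    rfl
  obtain ⟨D, hD, hDg⟩ := exists_cocycle (g := g) (actZ g) (actZ_one g) (actZ_mul g)
    (fun γ i => if h : i < g then eZ g γ (Sum.inl ⟨i, h⟩) else 0)
    (fun γ i => if h : i < g then eZ g γ (Sum.inr ⟨i, h⟩) else 0)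
    (by intro γ δ s; split_ifs <;> simp [actZ_eZ]) (by intro γ δ s; split_ifs <;> simp [actZ_eZ])
    (by
      rw [← Fin.sum_univ_eq_sum_range (fun i => ((if h : i < g then eZ g (gA g i)⁻¹
        (Sum.inl ⟨i, h⟩) else 0) - (if h : i < g then eZ g 1 (Sum.inl ⟨i, h⟩) else 0)) +
        ((if h : i < g then eZ g (gB g i)⁻¹
        (Sum.inr ⟨i, h⟩) else 0) - (if h : i < g then eZ g 1 (Sum.inr ⟨i, h⟩) else 0)))]
      simp only [Fin.is_lt, dif_pos, Fin.eta, gA_fin, gB_fin]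
      rw [Finset.sum_add_distrib]
      have := cobd_single g 1 1
      rw [Fintype.sum_sum_type] at this
      have h2 := congrArg (QuotientAddGroup.mk' (cobd g).range) this
      simp only [map_add, map_sum, map_sub, one_mul] at h2
      simp only [eZ]
      rw [← h2, QuotientAddGroup.mk'_apply, QuotientAddGroup.eq_zero_iff]
      exact ⟨_, rfl⟩)
  have hsa : ∀ i : Fin g, ∑ᶠ γ, w (Sum.inl i) γ • eZ g γ (Sum.inl i)
      = ∑ᶠ ε, (w (Sum.inl i) (ε * (gP g i * gA g i * gB g i * (gA g i)⁻¹))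
        - w (Sum.inl i) (ε * gP g i)) • D ε := by
    intro i
    rw [finsum_shift (w (Sum.inl i)) (hw _) (fun γ => eZ g γ (Sum.inl i)) D (gP g i)
      (gP g i * gA g i * (gB g i)⁻¹ * (gA g i)⁻¹ * (gP g i)⁻¹)]
    · refine finsum_congr fun ε => ?_
      congr 3
      group
    · intro ε
      have := (hDg i i.2).1
      simp only [Fin.is_lt, dif_pos, Fin.eta] at this
      rw [hD, this, actZ_eZ, add_sub_cancel_left]
  have hsb : ∀ i : Fin g, ∑ᶠ γ, w (Sum.inr i) γ • eZ g γ (Sum.inr i)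
      = ∑ᶠ ε, (w (Sum.inr i) (ε * gP g (i + 1))
        - w (Sum.inr i) (ε * (gP g i * gA g i))) • D ε := by
    intro i
    rw [finsum_shift (w (Sum.inr i)) (hw _) (fun γ => eZ g γ (Sum.inr i)) D (gP g i * gA g i)
      (gP g i * gA g i * (gP g (i + 1))⁻¹)]
    · refine finsum_congr fun ε => ?_
      congr 3
      group
    · intro ε
      have := (hDg i i.2).2
      simp only [Fin.is_lt, dif_pos, Fin.eta] at this
      rw [hD, this, actZ_eZ, add_sub_cancel_left]
  have hfs : ∀ (s) (q r : SurfaceGroup g),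
      (Function.support fun ε => (w s (ε * q) - w s (ε * r)) • D ε).Finite := by
    intro s q r
    have hs : ∀ q : SurfaceGroup g, (Function.support fun ε => w s (ε * q)).Finite := by
      intro q
      refine ((hw s).preimage (f := fun ε => ε * q) (mul_left_injective q).injOn).subset ?_
      intro x hx; exact hx
    refine ((hs q).union (hs r)).subset ?_
    intro x hx
    by_contra hc
    simp only [Set.mem_union, Function.mem_support, not_or, not_not] at hc
    apply hx
    simp [hc.1, hc.2]
  have hface : ∀ (i : Fin g) (ε : SurfaceGroup g),
      (w (Sum.inl i) (ε * (gP g i * gA g i * gB g i * (gA g i)⁻¹)) - w (Sum.inl i) (ε * gP g i))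
      + (w (Sum.inr i) (ε * gP g (i + 1)) - w (Sum.inr i) (ε * (gP g i * gA g i)))
      = f (ε * gP g i) - f (ε * gP g (i + 1)) := by
    intro i ε
    simp only [w, ← gA_fin, ← gB_fin]
    have e1 : ε * (gP g i * gA g i * gB g i * (gA g i)⁻¹) * gA g i
      = ε * (gP g i * gA g i) * gB g i := by group
    have e2 : ε * gP g (i + 1) * gB g i = ε * (gP g i * gA g i * gB g i * (gA g i)⁻¹) := by
      rw [gP_succ, commutatorElement_def]; group
    have e3 : ε * gP g i * gA g i = ε * (gP g i * gA g i) := by group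
    rw [e1, e2, e3]
    ring
  have hzero : (QuotientAddGroup.mk' (cobd g).range U) = 0 := by
    rw [hUmk, Fintype.sum_sum_type, ← Finset.sum_add_distrib]
    have : ∀ i : Fin g, (∑ᶠ γ, w (Sum.inl i) γ • eZ g γ (Sum.inl i)
        + ∑ᶠ γ, w (Sum.inr i) γ • eZ g γ (Sum.inr i)) =
        ∑ᶠ ε, (f (ε * gP g i) - f (ε * gP g (i + 1))) • D ε := by
      intro i
      rw [hsa, hsb, ← finsum_add_distrib (hfs _ _ _) (hfs _ _ _)]
      refine finsum_congr fun ε => ?_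
      refine (add_zsmul _ _ _).symm.trans ?_
      rw [hface]
    simp only [this]
    rw [← finsum_sum_comm]
    · rw [← finsum_zero (M := HZ g) (α := SurfaceGroup g)]
      refine finsum_congr fun ε => ?_
      rw [← Finset.sum_smul,
        Fin.sum_univ_eq_sum_range (fun i => f (ε * gP g i) - f (ε * gP g (i + 1))),
        Finset.sum_range_sub', gP_zero, gP_last, sub_self, zero_smul]
    · intro i _
      refine ((hfs (Sum.inl i) (gP g i * gA g i * gB g i * (gA g i)⁻¹) (gP g i)).union
        (hfs (Sum.inr i) (gP g (i + 1)) (gP g i * gA g i))).subset ?_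
      intro x hx
      by_contra hc
      simp only [Set.mem_union, Function.mem_support, not_or, not_not] at hc
      apply hx
      simp only
      rw [← hface]
      refine (add_zsmul _ _ _).trans ?_
      rw [hc.1, hc.2, add_zero]
  rw [QuotientAddGroup.mk'_apply, QuotientAddGroup.eq_zero_iff] at hzero
  obtain ⟨h, hh⟩ := hzero
  have key : ∀ s γ, f (γ * PresentedGroup.of s) - h (γ * PresentedGroup.of s) = f γ - h γ := by
    intro s γ
    have h1 := hU γ s
    rw [← hh, cobd_apply] at h1
    simp only [w] at h1
    linarith
  have key2 : ∀ δ γ, f (γ * δ) - h (γ * δ) = f γ - h γ := by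
    intro δ
    have : δ ∈ Subgroup.closure (Set.range (PresentedGroup.of :
        Fin g ⊕ Fin g → SurfaceGroup g)) := by
      rw [PresentedGroup.closure_range_of]; trivial
    induction this using Subgroup.closure_induction with
    | mem x hx => obtain ⟨s, rfl⟩ := hx; exact key s
    | one => simp
    | mul x y _ _ hx hy => intro γ; rw [← mul_assoc, hy, hx]
    | inv x _ hx => intro γ; rw [← hx (γ * x⁻¹), inv_mul_cancel_right]
  refine ⟨f 1 - h 1, (h.hasFiniteSupport).subset ?_⟩
  intro γ hγ
  rw [Function.mem_support]
  intro h0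
  apply hγ
  have := key2 γ 1
  rw [one_mul, h0] at this
  linarith

end Mess

open scoped commutatorElement

namespace Mess

open scoped Matrix Matrix.Norms.Operator

/-! ### Proper affine actions -/

/-- 3-vectors -/
abbrev V3 := Fin 3 → ℝ
/-- 3 by 3 matrices -/
abbrev M3 := Matrix (Fin 3) (Fin 3) ℝ

/-- A proper affine action on `ℝ³`. -/
structure PA (Γ : Type) [Group Γ] where
  L : Γ →* M3
  u : Γ → V3
  hu : ∀ γ δ, u (γ * δ) = u γ + L γ *ᵥ u δ
  proper : ∀ R : ℝ, {γ | ∃ x : V3, ‖x‖ ≤ R ∧ ‖L γ *ᵥ x + u γ‖ ≤ R}.Finite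

namespace PA
variable {Γ : Type} [Group Γ] (p : PA Γ)

/-- The action. -/
def act (γ : Γ) (x : V3) : V3 := p.L γ *ᵥ x + p.u γ

lemma act_def (γ : Γ) (x : V3) : p.act γ x = p.L γ *ᵥ x + p.u γ := rfl

lemma act_mul (γ δ : Γ) (x : V3) : p.act (γ * δ) x = p.act γ (p.act δ x) := by
  simp only [act, p.hu, map_mul, Matrix.mulVec_add, Matrix.mulVec_mulVec]
  abel

lemma u_one : p.u 1 = 0 := by
  have h := p.hu 1 1
  simpa using h

lemma act_one (x : V3) : p.act 1 x = x := by
  simp [act, u_one]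

lemma act_add (γ : Γ) (x y : V3) : p.act γ (x + y) = p.act γ x + p.L γ *ᵥ y := by
  simp only [act, Matrix.mulVec_add]; abel

lemma L_inv_mul (γ : Γ) : p.L γ⁻¹ * p.L γ = 1 := by
  rw [← map_mul, inv_mul_cancel, map_one]

lemma L_mul_inv (γ : Γ) : p.L γ * p.L γ⁻¹ = 1 := by
  rw [← map_mul, mul_inv_cancel, map_one]

lemma act_inv_act (γ : Γ) (x : V3) : p.act γ⁻¹ (p.act γ x) = x := by
  rw [← act_mul, inv_mul_cancel, act_one]

lemma act_act_inv (γ : Γ) (x : V3) : p.act γ (p.act γ⁻¹ x) = x := by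
  rw [← act_mul, mul_inv_cancel, act_one]

lemma u_inv (γ : Γ) : p.u γ⁻¹ = - (p.L γ⁻¹ *ᵥ p.u γ) := by
  have h := p.hu γ⁻¹ γ
  rw [inv_mul_cancel, u_one] at h
  exact eq_neg_of_add_eq_zero_left h.symm

lemma finite_of_bdd (f : ℕ → Γ) (x : ℕ → V3) (R : ℝ) (h1 : ∀ n, ‖x n‖ ≤ R)
    (h2 : ∀ n, ‖p.act (f n) (x n)‖ ≤ R) : ∃ m n, m < n ∧ f m = f n := by
  have hfin := p.proper R
  have hmem : ∀ n, f n ∈ {γ | ∃ x : V3, ‖x‖ ≤ R ∧ ‖p.L γ *ᵥ x + p.u γ‖ ≤ R} :=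
    fun n => ⟨x n, h1 n, h2 n⟩
  by_contra hc
  push Not at hc
  have hinj : Function.Injective f := by
    intro a b hab
    by_contra hne
    rcases lt_or_gt_of_ne hne with h | h
    · exact hc a b h hab
    · exact hc b a h hab.symm
  exact Set.infinite_range_of_injective hinj (hfin.subset (by rintro _ ⟨n, rfl⟩; exact hmem n))

lemma act_pow_fixed (γ : Γ) (x : V3) (h : p.act γ x = x) (n : ℕ) : p.act (γ ^ n) x = x := by
  induction n with
  | zero => rw [pow_zero, act_one]
  | succ n ih => rw [pow_succ, act_mul, h, ih]

lemma finite_order_of_fixed (γ : Γ) (x : V3) (h : p.act γ x = x) :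
    ∃ n : ℕ, 1 ≤ n ∧ γ ^ n = 1 := by
  obtain ⟨m, n, hmn, hf⟩ := p.finite_of_bdd (fun n => γ ^ n) (fun _ => x) ‖x‖ (fun _ => le_rfl)
    (fun n => by rw [p.act_pow_fixed γ x h n])
  refine ⟨n - m, by omega, ?_⟩
  have : γ ^ n = γ ^ m * γ ^ (n - m) := by rw [← pow_add]; congr 1; omega
  rw [this] at hf
  exact (left_eq_mul.mp hf)

/-- Restriction to a subgroup. -/
def restrict (H : Subgroup Γ) : PA H where
  L := p.L.comp H.subtype
  u γ := p.u γ
  hu γ δ := by simp [p.hu]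
  proper R := by
    have := (p.proper R).preimage (f := (fun γ : H => (γ : Γ))) (Subtype.val_injective.injOn)
    exact this

/-- Conjugation by an invertible matrix. -/
def conj (P P' : M3) (h : P' * P = 1) (h' : P * P' = 1) : PA Γ where
  L :=
    { toFun := fun γ => P' * p.L γ * P
      map_one' := by simp [h]
      map_mul' := fun γ δ => by
        rw [map_mul]
        calc P' * (p.L γ * p.L δ) * P = P' * p.L γ * 1 * p.L δ * P := by
              simp only [Matrix.mul_assoc, Matrix.one_mul]
          _ = P' * p.L γ * P * (P' * p.L δ * P) := by
              rw [← h']; simp only [Matrix.mul_assoc] }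
  u γ := P' *ᵥ p.u γ
  hu γ δ := by
    rw [p.hu]
    simp only [MonoidHom.coe_mk, OneHom.coe_mk, Matrix.mulVec_add, Matrix.mulVec_mulVec,
      Matrix.mul_assoc, h', Matrix.mul_one]
  proper R := by
    refine (p.proper (max (‖P‖ * R) (‖P‖ * R))).subset ?_
    rintro γ ⟨x, hx1, hx2⟩
    refine ⟨P *ᵥ x, ?_, ?_⟩
    · refine le_trans (Matrix.linfty_opNorm_mulVec _ _) ?_
      rw [max_self]
      exact mul_le_mul_of_nonneg_left hx1 (norm_nonneg _)
    · have : p.L γ *ᵥ (P *ᵥ x) + p.u γ = P *ᵥ ((P' * p.L γ * P) *ᵥ x + P' *ᵥ p.u γ) := by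
        simp only [Matrix.mulVec_add, Matrix.mulVec_mulVec, ← Matrix.mul_assoc, h',
          Matrix.one_mul, Matrix.one_mulVec]
      rw [this]
      refine le_trans (Matrix.linfty_opNorm_mulVec _ _) ?_
      rw [max_self]
      exact mul_le_mul_of_nonneg_left hx2 (norm_nonneg _)

@[simp] lemma conj_L (P P' : M3) (h : P' * P = 1) (h' : P * P' = 1) (γ : Γ) :
    (p.conj P P' h h').L γ = P' * p.L γ * P := rfl

@[simp] lemma conj_u (P P' : M3) (h : P' * P = 1) (h' : P * P' = 1) (γ : Γ) :
    (p.conj P P' h h').u γ = P' *ᵥ p.u γ := rfl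

end PA

/-! ### Derived series bookkeeping -/

lemma der_kill {Δ G : Type*} [Group Δ] [Monoid G] (H : Subgroup Δ) (f : Δ → G) (h1 : f 1 = 1)
    (hm : ∀ x ∈ H, ∀ y ∈ H, f (x * y) = f x * f y)
    (hc : ∀ x ∈ H, ∀ y ∈ H, f x * f y = f y * f x) :
    ∀ z ∈ ⁅H, H⁆, f z = 1 := by
  intro z hz
  rw [Subgroup.commutator_def] at hz
  have hle : ∀ z ∈ Subgroup.closure {g | ∃ g₁ ∈ H, ∃ g₂ ∈ H, ⁅g₁, g₂⁆ = g}, z ∈ H := by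
    intro z hz
    rw [← Subgroup.commutator_def] at hz
    exact H.commutator_le_self hz
  induction hz using Subgroup.closure_induction with
  | mem x hx =>
    obtain ⟨a, ha, b, hb, rfl⟩ := hx
    rw [commutatorElement_def, hm _ (H.mul_mem (H.mul_mem ha hb) (H.inv_mem ha)) _ (H.inv_mem hb),
      hm _ (H.mul_mem ha hb) _ (H.inv_mem ha), hm _ ha _ hb, hc _ ha _ hb, mul_assoc (f b),
      ← hm _ ha _ (H.inv_mem ha), mul_inv_cancel, h1, mul_one, ← hm _ hb _ (H.inv_mem hb),
      mul_inv_cancel, h1]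
  | one => exact h1
  | mul x y hx hy hfx hfy => rw [hm _ (hle _ hx) _ (hle _ hy), hfx, hfy, one_mul]
  | inv x hx hfx =>
    have := hm _ (H.inv_mem (hle _ hx)) _ (hle _ hx)
    rw [inv_mul_cancel, h1, hfx, mul_one] at this
    exact this.symm

lemma der_kill_add {Δ : Type*} [Group Δ] (H : Subgroup Δ) (f : Δ → ℝ) (h1 : f 1 = 0)
    (hm : ∀ x ∈ H, ∀ y ∈ H, f (x * y) = f x + f y) :
    ∀ z ∈ ⁅H, H⁆, f z = 0 := by
  intro z hz
  have := der_kill H (fun γ => Multiplicative.ofAdd (f γ)) (by simp [h1])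
    (by intro x hx y hy; simp only [hm x hx y hy, ofAdd_add]) (by intro x _ y _; rw [mul_comm]) z hz
  simpa using this

lemma derived_restrict {Γ : Type*} [Group Γ] (j k : ℕ) :
    (derivedSeries (derivedSeries Γ j) k).map (derivedSeries Γ j).subtype
      = derivedSeries Γ (j + k) := by
  induction k with
  | zero =>
    rw [derivedSeries_zero, add_zero, ← MonoidHom.range_eq_map, Subgroup.range_subtype]
  | succ k ih => rw [derivedSeries_succ, Subgroup.map_commutator, ih, ← add_assoc,
      derivedSeries_succ Γ (j + k)]

namespace PA
variable {Γ : Type} [Group Γ] (p : PA Γ)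

lemma tri_finite (k : ℕ) (h10 : ∀ γ ∈ derivedSeries Γ k, p.L γ 1 0 = 0)
    (h20 : ∀ γ ∈ derivedSeries Γ k, p.L γ 2 0 = 0)
    (h21 : ∀ γ ∈ derivedSeries Γ k, p.L γ 2 1 = 0) :
    (derivedSeries Γ (k + 4) : Set Γ).Finite := by
  have hle1 : derivedSeries Γ (k + 1) ≤ derivedSeries Γ k := derivedSeries_antitone Γ (by omega)
  have hle2 : derivedSeries Γ (k + 2) ≤ derivedSeries Γ (k + 1) := derivedSeries_antitone Γ (by omega)
  have hle3 : derivedSeries Γ (k + 3) ≤ derivedSeries Γ (k + 2) := derivedSeries_antitone Γ (by omega)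
  have hle4 : derivedSeries Γ (k + 4) ≤ derivedSeries Γ (k + 3) := derivedSeries_antitone Γ (by omega)
  have hmul : ∀ (x y : Γ) (i j : Fin 3), p.L (x * y) i j
      = p.L x i 0 * p.L y 0 j + p.L x i 1 * p.L y 1 j + p.L x i 2 * p.L y 2 j := by
    intro x y i j
    rw [map_mul, Matrix.mul_apply, Fin.sum_univ_three]
  have hadd : ∀ (x y : Γ) (i : Fin 3), p.u (x * y) i
      = p.u x i + (p.L x i 0 * p.u y 0 + p.L x i 1 * p.u y 1 + p.L x i 2 * p.u y 2) := by
    intro x y i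
    rw [p.hu, Pi.add_apply, Matrix.mulVec, dotProduct, Fin.sum_univ_three]
  have d0 : ∀ γ ∈ derivedSeries Γ (k + 1), p.L γ 0 0 = 1 :=
    der_kill (derivedSeries Γ k) (fun γ => p.L γ 0 0) (by simp)
      (by intro x hx y hy; simp [hmul, h10 y hy, h20 y hy]) (by intro x hx y hy; rw [mul_comm])
  have d1 : ∀ γ ∈ derivedSeries Γ (k + 1), p.L γ 1 1 = 1 :=
    der_kill (derivedSeries Γ k) (fun γ => p.L γ 1 1) (by simp)
      (by intro x hx y hy; simp [hmul, h10 x hx, h21 y hy]) (by intro x hx y hy; rw [mul_comm])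
  have d2 : ∀ γ ∈ derivedSeries Γ (k + 1), p.L γ 2 2 = 1 :=
    der_kill (derivedSeries Γ k) (fun γ => p.L γ 2 2) (by simp)
      (by intro x hx y hy; simp [hmul, h20 x hx, h21 x hx]) (by intro x hx y hy; rw [mul_comm])
  have e01 : ∀ γ ∈ derivedSeries Γ (k + 2), p.L γ 0 1 = 0 :=
    der_kill_add (derivedSeries Γ (k + 1)) (fun γ => p.L γ 0 1) (by simp)
      (by intro x hx y hy; simp [hmul, d0 x hx, d1 y hy, h21 y (hle1 hy)]; ring)
  have e12 : ∀ γ ∈ derivedSeries Γ (k + 2), p.L γ 1 2 = 0 :=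
    der_kill_add (derivedSeries Γ (k + 1)) (fun γ => p.L γ 1 2) (by simp)
      (by intro x hx y hy; simp [hmul, d1 x hx, d2 y hy, h10 x (hle1 hx)]; ring)
  have eu2 : ∀ γ ∈ derivedSeries Γ (k + 2), p.u γ 2 = 0 :=
    der_kill_add (derivedSeries Γ (k + 1)) (fun γ => p.u γ 2) (by simp [u_one])
      (by intro x hx y hy; simp [hadd, d2 x hx, h20 x (hle1 hx), h21 x (hle1 hx)])
  have f02 : ∀ γ ∈ derivedSeries Γ (k + 3), p.L γ 0 2 = 0 :=
    der_kill_add (derivedSeries Γ (k + 2)) (fun γ => p.L γ 0 2) (by simp)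
      (by intro x hx y hy; simp [hmul, d0 x (hle2 hx), d2 y (hle2 hy), e01 x hx]; ring)
  have fu1 : ∀ γ ∈ derivedSeries Γ (k + 3), p.u γ 1 = 0 :=
    der_kill_add (derivedSeries Γ (k + 2)) (fun γ => p.u γ 1) (by simp [u_one])
      (by intro x hx y hy; simp [hadd, d1 x (hle2 hx), e12 x hx, h10 x (hle1 (hle2 hx))])
  have gu0 : ∀ γ ∈ derivedSeries Γ (k + 4), p.u γ 0 = 0 :=
    der_kill_add (derivedSeries Γ (k + 3)) (fun γ => p.u γ 0) (by simp [u_one])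
      (by intro x hx y hy; simp [hadd, d0 x (hle2 (hle3 hx)), e01 x (hle3 hx), f02 x hx])
  refine (p.proper 0).subset ?_
  intro γ hγ
  refine ⟨0, by simp, ?_⟩
  have hu0 : p.u γ = 0 := by
    ext i
    fin_cases i
    · exact gu0 γ hγ
    · exact fu1 γ (hle4 hγ)
    · exact eu2 γ (hle3 (hle4 hγ))
  simp [hu0]

end PA
end Mess

open scoped commutatorElement

namespace Mess

open scoped Matrix Matrix.Norms.Operator

/-! ### Reducible actions -/

/-- 2 by 2 matrices -/
abbrev M2 := Matrix (Fin 2) (Fin 2) ℝ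

lemma hyp_eig (A : M2) (hd : A.det = 1) (ht : 2 < |A.trace|) :
    ∃ (l : ℝ) (e : Fin 2 → ℝ), e ≠ 0 ∧ l ≠ 0 ∧ |l| < 1 ∧ A *ᵥ e = l • e := by
  obtain ⟨l, hl, hl1⟩ : ∃ l : ℝ, l ^ 2 - A.trace * l + 1 = 0 ∧ |l| < 1 := by
    have h4 : 0 < A.trace ^ 2 - 4 := by
      have := sq_abs A.trace
      nlinarith [abs_nonneg A.trace]
    have hs := Real.sq_sqrt h4.le
    have hs0 := Real.sqrt_pos.mpr h4
    set s := Real.sqrt (A.trace ^ 2 - 4)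
    rcases lt_abs.mp ht with h | h
    · refine ⟨(A.trace - s) / 2, by nlinarith, ?_⟩
      rw [abs_lt]; constructor
      · nlinarith
      · nlinarith
    · refine ⟨(A.trace + s) / 2, by nlinarith, ?_⟩
      rw [abs_lt]; constructor
      · nlinarith
      · nlinarith
  have hl0 : l ≠ 0 := by
    rintro rfl; norm_num at hl
  have hdet : (A - l • (1 : M2)).det = 0 := by
    rw [Matrix.det_fin_two] at hd ⊢
    rw [Matrix.trace_fin_two] at hl
    simp
    nlinarith
  obtain ⟨e, he, hAe⟩ := Matrix.exists_mulVec_eq_zero_iff.mpr hdet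
  refine ⟨l, e, he, hl0, hl1, ?_⟩
  rw [Matrix.sub_mulVec, sub_eq_zero] at hAe
  rw [hAe, Matrix.smul_mulVec, Matrix.one_mulVec]

lemma lemS_ell (p q r s x y z : ℝ) (h1 : p * s - q * r = 1) (h2 : (p + s) ^ 2 < 4)
    (hX : x * (p - s) + y * r + z * q = 0) (hd : 0 ≤ - x ^ 2 - y * z) :
    x = 0 ∧ y = 0 ∧ z = 0 := by
  have hqr : (p - s) ^ 2 + 4 * (q * r) < 0 := by nlinarith
  have hqr' : q * r < 0 := by nlinarith [sq_nonneg (p - s)]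
  have hx : x = 0 := by
    by_contra hx
    have hx2 : 0 < x ^ 2 := by positivity
    have e1 : x ^ 2 * (p - s) ^ 2 = (y * r + z * q) ^ 2 := by
      have : x * (p - s) = -(y * r + z * q) := by linarith
      calc x ^ 2 * (p - s) ^ 2 = (x * (p - s)) ^ 2 := by ring
        _ = _ := by rw [this]; ring
    have e2 : (y * r + z * q) ^ 2 ≥ 4 * ((y * z) * (q * r)) := by
      nlinarith [sq_nonneg (y * r - z * q)]
    have e3 : (y * z) * (q * r) ≥ - x ^ 2 * (q * r) := by
      nlinarith
    nlinarith
  subst hx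
  have hyz : y * z ≤ 0 := by nlinarith
  have h3 : y * r = - (z * q) := by linarith
  have hz : z = 0 := by
    by_contra hz
    have hz2 : 0 < z ^ 2 := by positivity
    have e1 : (y * z) * r ^ 2 = - (z ^ 2 * (q * r)) := by
      calc (y * z) * r ^ 2 = (y * r) * z * r := by ring
        _ = _ := by rw [h3]; ring
    nlinarith [mul_pos hz2 (neg_pos.mpr hqr'), sq_nonneg r]
  subst hz
  have hr : r ≠ 0 := by rintro rfl; simp at hqr'
  have : y * r = 0 := by linarith
  refine ⟨rfl, ?_, rfl⟩
  rcases mul_eq_zero.mp this with h | h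
  · exact h
  · exact absurd h hr

lemma mul_fin_two (A B : M2) (i j : Fin 2) : (A * B) i j = A i 0 * B 0 j + A i 1 * B 1 j := by
  rw [Matrix.mul_apply, Fin.sum_univ_two]

lemma comm_of_comm (g B C : M2) (hq : g 0 1 ≠ 0) (hB : g * B = B * g) (hC : g * C = C * g) :
    B * C = C * B := by
  have b1 := congrFun (congrFun hB 0) 0
  have b2 := congrFun (congrFun hB 0) 1
  have c1 := congrFun (congrFun hC 0) 0
  have c2 := congrFun (congrFun hC 0) 1
  simp only [mul_fin_two] at b1 b2 c1 c2
  have b3 : B 1 0 = B 0 1 * g 1 0 / g 0 1 := by field_simp; linarith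
  have c3 : C 1 0 = C 0 1 * g 1 0 / g 0 1 := by field_simp; linarith
  have b4 : B 1 1 = B 0 0 - B 0 1 * (g 0 0 - g 1 1) / g 0 1 := by field_simp; linarith
  have c4 : C 1 1 = C 0 0 - C 0 1 * (g 0 0 - g 1 1) / g 0 1 := by field_simp; linarith
  ext i j
  fin_cases i <;> fin_cases j <;> simp [mul_fin_two, b3, b4, c3, c4] <;> field_simp <;> ring

lemma pow_nil (g : M2) (τ : ℝ) (hτ : τ * τ = 1) (N : M2) (hg : g = τ • 1 + N) (hN : N * N = 0)
    (n : ℕ) : g ^ n = τ ^ n • (1 + (n * τ) • N) := by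
  induction n with
  | zero => simp
  | succ n ih =>
    rw [pow_succ, ih, hg]
    have h4 : (1 + (n * τ) • N) * (τ • (1 : M2) + N) = τ • (1 + ((n + 1) * τ) • N) := by
      rw [Matrix.mul_add, Matrix.add_mul, Matrix.add_mul]
      simp only [Matrix.smul_mul, hN, Matrix.one_mul, Matrix.mul_smul, Matrix.mul_one, smul_zero,
        smul_add, smul_smul, add_zero]
      rw [show τ * (((n : ℝ) + 1) * τ) = τ * (n * τ) + 1 by linear_combination hτ]
      rw [add_smul, one_smul]
      abel
    rw [Matrix.smul_mul, h4, smul_smul, pow_succ]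
    push_cast
    rfl

lemma lemS {Δ : Type} [Group Δ] (H : Subgroup Δ) (A : Δ → M2)
    (hm : ∀ x ∈ H, ∀ y ∈ H, A (x * y) = A x * A y) (h1 : A 1 = 1)
    (hd : ∀ x ∈ H, (A x).det = 1) (ht : ∀ x ∈ H, |(A x).trace| ≤ 2) :
    (∀ x ∈ H, ∀ y ∈ H, A x * A y = A y * A x) ∨
    ∃ v : Fin 2 → ℝ, v ≠ 0 ∧ ∀ x ∈ H, v 0 * (A x *ᵥ v) 1 - v 1 * (A x *ᵥ v) 0 = 0 := by
  have hinv : ∀ x ∈ H, A x * A x⁻¹ = 1 := fun x hx => by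
    rw [← hm x hx _ (H.inv_mem hx), mul_inv_cancel, h1]
  by_cases hell : ∃ g ∈ H, |(A g).trace| < 2
  · left
    obtain ⟨g, hg, hgt⟩ := hell
    have hdg := hd g hg
    rw [Matrix.det_fin_two] at hdg
    have hgt2 : (A g 0 0 + A g 1 1) ^ 2 < 4 := by
      rw [Matrix.trace_fin_two] at hgt
      have := abs_lt.mp hgt
      nlinarith
    have hcg : ∀ x ∈ H, A g * A x = A x * A g := by
      intro x hx
      have hc := ht (g * x * g⁻¹ * x⁻¹) (H.mul_mem (H.mul_mem (H.mul_mem hg hx) (H.inv_mem hg))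
        (H.inv_mem hx))
      have hix : ∀ y ∈ H, A y⁻¹ 0 0 = A y 1 1 ∧ A y⁻¹ 0 1 = - A y 0 1 ∧
          A y⁻¹ 1 0 = - A y 1 0 ∧ A y⁻¹ 1 1 = A y 0 0 := by
        intro y hy
        have hyd := hd y hy
        have : A y⁻¹ = (A y).adjugate := by
          calc A y⁻¹ = (A y).adjugate * A y * A y⁻¹ := by
                rw [Matrix.adjugate_mul, hyd, one_smul, Matrix.one_mul]
            _ = _ := by rw [Matrix.mul_assoc, hinv y hy, Matrix.mul_one]
        rw [this, Matrix.adjugate_fin_two]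
        simp
      obtain ⟨g1, g2, g3, g4⟩ := hix g hg
      obtain ⟨x1, x2, x3, x4⟩ := hix x hx
      rw [hm _ (H.mul_mem (H.mul_mem hg hx) (H.inv_mem hg)) _ (H.inv_mem hx),
        hm _ (H.mul_mem hg hx) _ (H.inv_mem hg), hm _ hg _ hx, Matrix.trace_fin_two] at hc
      have hc' := (abs_le.mp hc).2
      simp only [mul_fin_two, g1, g2, g3, g4, x1, x2, x3, x4] at hc'
      have hdx := hd x hx
      rw [Matrix.det_fin_two] at hdx
      set p := A g 0 0
      set q := A g 0 1
      set r := A g 1 0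
      set s := A g 1 1
      set a := A x 0 0
      set b := A x 0 1
      set c := A x 1 0
      set d := A x 1 1
      obtain ⟨k1, k2, k3⟩ := lemS_ell p q r s (q * c - b * r) (p * b + q * d - a * q - b * s)
        (r * a + s * c - c * p - d * r) hdg hgt2 (by ring) (by
          have : 2 * (p * s - q * r) * (a * d - b * c) = 2 := by rw [hdg, hdx]; ring
          nlinarith)
      ext i j
      fin_cases i <;> fin_cases j <;> simp [mul_fin_two] <;> linarith
    have hq : A g 0 1 ≠ 0 := by
      intro h
      rw [h] at hdg
      nlinarith [sq_nonneg (A g 0 0 - A g 1 1)]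
    intro x hx y hy
    exact comm_of_comm (A g) _ _ hq (hcg x hx) (hcg y hy)
  · push Not at hell
    by_cases hsc : ∀ g ∈ H, A g = ((A g).trace / 2) • 1
    · left
      intro x hx y hy
      rw [hsc x hx]
      simp
    · right
      push Not at hsc
      obtain ⟨g, hg, hgn⟩ := hsc
      have htr2 : |(A g).trace| = 2 := le_antisymm (ht g hg) (hell g hg)
      set τ := (A g).trace / 2 with hτdef
      have hτ : τ * τ = 1 := by
        have := sq_abs (A g).trace
        rw [htr2] at this
        rw [hτdef]; nlinarith
      set N := A g - τ • (1 : M2) with hN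
      have hgN : A g = τ • 1 + N := by rw [hN]; abel
      have hN0 : N ≠ 0 := by
        intro h; rw [h, add_zero] at hgN; exact hgn hgN
      have hdg := hd g hg
      rw [Matrix.det_fin_two] at hdg
      have htg : (A g).trace = 2 * τ := by rw [hτdef]; ring
      rw [Matrix.trace_fin_two] at htg
      have n00 : N 0 0 = A g 0 0 - τ := by simp [hN]
      have n01 : N 0 1 = A g 0 1 := by simp [hN]
      have n10 : N 1 0 = A g 1 0 := by simp [hN]
      have n11 : N 1 1 = A g 1 1 - τ := by simp [hN]
      have ntr : N 1 1 = - N 0 0 := by rw [n11, n00]; linarith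
      have ndet : N 0 0 * N 0 0 + N 0 1 * N 1 0 = 0 := by
        have e1 : A g 1 1 = 2 * τ - A g 0 0 := by linarith
        rw [n00, n01, n10]
        rw [e1] at hdg
        linear_combination hτ - hdg
      have hNN : N * N = 0 := by
        ext i j
        fin_cases i <;> fin_cases j <;> simp [mul_fin_two, ntr] <;> linarith
      have htrNB : ∀ x ∈ H, (N * A x).trace = 0 := by
        intro x hx
        have hpow : ∀ n : ℕ, g ^ n ∈ H ∧ A (g ^ n) = A g ^ n := by
          intro n
          induction n with
          | zero => simp [h1, H.one_mem]
          | succ n ih =>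
            refine ⟨H.pow_mem hg _, ?_⟩
            rw [pow_succ, hm _ ih.1 _ hg, ih.2, pow_succ]
        have hb : ∀ n : ℕ, |(A x).trace + (n * τ) * (N * A x).trace| ≤ 2 := by
          intro n
          have h3 := ht (g ^ n * x) (H.mul_mem (hpow n).1 hx)
          rw [hm _ (hpow n).1 _ hx, (hpow n).2, pow_nil _ τ hτ N hgN hNN n, Matrix.smul_mul,
            Matrix.trace_smul, Matrix.add_mul, Matrix.trace_add, Matrix.one_mul, Matrix.smul_mul,
            Matrix.trace_smul, smul_eq_mul, smul_eq_mul, abs_mul, abs_pow] at h3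
          have hτ1 : |τ| = 1 := by
            rw [hτdef, abs_div, htr2]; norm_num
          rwa [hτ1, one_pow, one_mul] at h3
        by_contra hne
        have hτ0 : τ ≠ 0 := by rintro h; rw [h] at hτ; norm_num at hτ
        have hpos : 0 < |τ * (N * A x).trace| := abs_pos.mpr (mul_ne_zero hτ0 hne)
        obtain ⟨n, hn⟩ := exists_nat_gt (4 / |τ * (N * A x).trace|)
        rw [div_lt_iff₀ hpos] at hn
        have h5 := hb n
        have h6 := ht x hx
        have h7 : |(n : ℝ) * (τ * (N * A x).trace)| ≤ 4 := by
          have : (n : ℝ) * (τ * (N * A x).trace)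
            = ((A x).trace + (n * τ) * (N * A x).trace) - (A x).trace := by ring
          rw [this]
          exact (abs_sub _ _).trans (by linarith)
        rw [abs_mul, Nat.abs_cast] at h7
        linarith
      by_cases hcol : N 0 0 = 0 ∧ N 1 0 = 0
      · refine ⟨![N 0 1, - N 0 0], ?_, ?_⟩
        · intro h0
          apply hN0
          have e1 := congrFun h0 0
          simp at e1
          ext i j
          fin_cases i <;> fin_cases j <;> simp [hcol.1, hcol.2, ntr, e1]
        · intro x hx
          have h8 := htrNB x hx
          rw [Matrix.trace_fin_two, mul_fin_two, mul_fin_two] at h8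
          simp [Matrix.mulVec, dotProduct, Fin.sum_univ_two]
          rw [ntr] at h8
          linear_combination (N 0 1) * h8 - (A x 0 1) * ndet
      · refine ⟨![N 0 0, N 1 0], ?_, ?_⟩
        · intro h0
          apply hcol
          exact ⟨by simpa using congrFun h0 0, by simpa using congrFun h0 1⟩
        · intro x hx
          have h8 := htrNB x hx
          rw [Matrix.trace_fin_two, mul_fin_two, mul_fin_two] at h8
          simp [Matrix.mulVec, dotProduct, Fin.sum_univ_two]
          rw [ntr] at h8
          linear_combination - (N 1 0) * h8 + (A x 1 0) * ndet

end Mess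

open scoped commutatorElement

namespace Mess

open scoped Matrix Matrix.Norms.Operator

lemma mul_fin_three (A B : M3) (i j : Fin 3) :
    (A * B) i j = A i 0 * B 0 j + A i 1 * B 1 j + A i 2 * B 2 j := by
  rw [Matrix.mul_apply, Fin.sum_univ_three]

lemma mulVec_fin_three (A : M3) (v : V3) (i : Fin 3) :
    (A *ᵥ v) i = A i 0 * v 0 + A i 1 * v 1 + A i 2 * v 2 := by
  rw [Matrix.mulVec, dotProduct, Fin.sum_univ_three]

lemma mulVec_fin_two (A : M2) (v : Fin 2 → ℝ) (i : Fin 2) :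
    (A *ᵥ v) i = A i 0 * v 0 + A i 1 * v 1 := by
  rw [Matrix.mulVec, dotProduct, Fin.sum_univ_two]

lemma pow_mulVec_eig {n : ℕ} (A : Matrix (Fin n) (Fin n) ℝ) (e : Fin n → ℝ) (l : ℝ)
    (h : A *ᵥ e = l • e) (k : ℕ) : (A ^ k) *ᵥ e = l ^ k • e := by
  induction k with
  | zero => simp
  | succ k ih => rw [pow_succ, ← Matrix.mulVec_mulVec, h, Matrix.mulVec_smul, ih, smul_smul,
      pow_succ, mul_comm]

lemma pow_abs_lt_one {l : ℝ} (hl : |l| < 1) {k : ℕ} (hk : 1 ≤ k) : l ^ k ≠ 1 := by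
  intro h
  have h1 : |l| ^ k = 1 := by rw [← abs_pow, h, abs_one]
  have h2 : |l| ^ k < 1 := pow_lt_one₀ (abs_nonneg _) hl (by omega)
  linarith

namespace PA
variable {Γ : Type} [Group Γ] (p : PA Γ)

lemma det_one (γ : Γ) (hγ : γ ∈ derivedSeries Γ 1) : (p.L γ).det = 1 := by
  have := der_kill (derivedSeries Γ 0) (fun γ => (p.L γ).det) (by simp)
    (by intro x _ y _; simp [Matrix.det_mul]) (by intro x _ y _; rw [mul_comm]) γ
  exact this hγ

/-- upper left block -/
def blkA (γ : Γ) : M2 := !![p.L γ 0 0, p.L γ 0 1; p.L γ 1 0, p.L γ 1 1]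
/-- lower right block -/
def blkB (γ : Γ) : M2 := !![p.L γ 1 1, p.L γ 1 2; p.L γ 2 1, p.L γ 2 2]

lemma red_plane (h20 : ∀ γ, p.L γ 2 0 = 0) (h21 : ∀ γ, p.L γ 2 1 = 0) :
    ∃ k, (derivedSeries Γ k : Set Γ).Finite := by
  have hmulA : ∀ x y, p.blkA (x * y) = p.blkA x * p.blkA y := by
    intro x y
    ext i j
    fin_cases i <;> fin_cases j <;>
      simp [blkA, mul_fin_two, map_mul, mul_fin_three, h20, h21]
  have hA1 : p.blkA 1 = 1 := by
    ext i j
    fin_cases i <;> fin_cases j <;> simp [blkA]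
  have d2 : ∀ γ ∈ derivedSeries Γ 1, p.L γ 2 2 = 1 :=
    der_kill (derivedSeries Γ 0) (fun γ => p.L γ 2 2) (by simp)
      (by intro x hx y hy; simp [map_mul, mul_fin_three, h20, h21])
      (by intro x hx y hy; rw [mul_comm])
  have hle : derivedSeries Γ 2 ≤ derivedSeries Γ 1 := derivedSeries_antitone Γ (by omega)
  have hle3 : derivedSeries Γ 3 ≤ derivedSeries Γ 2 := derivedSeries_antitone Γ (by omega)
  have eu2 : ∀ γ ∈ derivedSeries Γ 2, p.u γ 2 = 0 :=
    der_kill_add (derivedSeries Γ 1) (fun γ => p.u γ 2) (by simp [u_one])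
      (by intro x hx y hy; simp [p.hu, mulVec_fin_three, d2 x hx, h20, h21])
  have hdet : ∀ γ ∈ derivedSeries Γ 1, (p.blkA γ).det = 1 := by
    intro γ hγ
    have := p.det_one γ hγ
    rw [Matrix.det_fin_three, h20, h21, d2 γ hγ] at this
    rw [Matrix.det_fin_two]
    simp [blkA]
    linarith
  have htr : ∀ γ ∈ derivedSeries Γ 2, |(p.blkA γ).trace| ≤ 2 := by
    intro γ hγ
    by_contra hc
    push Not at hc
    have hd := hdet γ (hle hγ)
    obtain ⟨l, e, he, hl0, hl1, hAe⟩ := hyp_eig _ hd hc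
    -- fixed point
    have hD : (1 - p.blkA γ).det ≠ 0 := by
      have : (1 - p.blkA γ).det = 2 - (p.blkA γ).trace := by
        rw [Matrix.det_fin_two] at hd ⊢
        rw [Matrix.trace_fin_two]
        simp
        linarith
      rw [this]
      intro h0
      rw [show (p.blkA γ).trace = 2 by linarith] at hc
      norm_num at hc
    have hU : IsUnit (1 - p.blkA γ).det := isUnit_iff_ne_zero.mpr hD
    set y := (1 - p.blkA γ)⁻¹ *ᵥ ![p.u γ 0, p.u γ 1] with hy
    have hy2 : (1 - p.blkA γ) *ᵥ y = ![p.u γ 0, p.u γ 1] := by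
      rw [hy, Matrix.mulVec_mulVec, Matrix.mul_nonsing_inv _ hU, Matrix.one_mulVec]
    have hfix : p.act γ ![y 0, y 1, 0] = ![y 0, y 1, 0] := by
      have k0 := congrFun hy2 0
      have k1 := congrFun hy2 1
      rw [mulVec_fin_two] at k0 k1
      simp [blkA] at k0 k1
      ext i
      rw [act_def, Pi.add_apply, mulVec_fin_three]
      fin_cases i
      · simp; linarith
      · simp; linarith
      · simp [h20, h21, eu2 γ hγ]
    obtain ⟨n, hn, hγn⟩ := p.finite_order_of_fixed γ _ hfix
    have hAp : ∀ k : ℕ, p.blkA (γ ^ k) = p.blkA γ ^ k := by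
      intro k
      induction k with
      | zero => simp [hA1]
      | succ k ih => rw [pow_succ, hmulA, ih, pow_succ]
    have h9 := pow_mulVec_eig _ e l hAe n
    rw [← hAp, hγn, hA1, Matrix.one_mulVec] at h9
    have h10 : (1 - l ^ n) • e = 0 := by rw [sub_smul, one_smul, ← h9, sub_self]
    rcases smul_eq_zero.mp h10 with h | h
    · exact pow_abs_lt_one hl1 hn (by linarith)
    · exact he h
  rcases lemS (derivedSeries Γ 2) p.blkA (fun x _ y _ => hmulA x y) hA1
    (fun x hx => hdet x (hle hx)) htr with hcomm | ⟨v, hv, hvv⟩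
  · refine ⟨3 + 4, p.tri_finite 3 ?_ (fun γ _ => h20 γ) (fun γ _ => h21 γ)⟩
    intro γ hγ
    have := der_kill (derivedSeries Γ 2) p.blkA hA1 (fun x _ y _ => hmulA x y) hcomm γ hγ
    simpa [blkA] using congrFun (congrFun this 1) 0
  · have hn : v 0 ^ 2 + v 1 ^ 2 ≠ 0 := by
      intro h
      apply hv
      ext i
      fin_cases i
      · simp; nlinarith [sq_nonneg (v 0), sq_nonneg (v 1)]
      · simp; nlinarith [sq_nonneg (v 0), sq_nonneg (v 1)]
    let P : M3 := !![v 0, -v 1, 0; v 1, v 0, 0; 0, 0, 1]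
    let P' : M3 := !![v 0 / (v 0 ^ 2 + v 1 ^ 2), v 1 / (v 0 ^ 2 + v 1 ^ 2), 0;
      - v 1 / (v 0 ^ 2 + v 1 ^ 2), v 0 / (v 0 ^ 2 + v 1 ^ 2), 0; 0, 0, 1]
    have hP : P' * P = 1 := by
      ext i j
      fin_cases i <;> fin_cases j <;> simp [P, P', mul_fin_three] <;> field_simp <;> ring
    have hP2 : P * P' = 1 := by
      ext i j
      fin_cases i <;> fin_cases j <;> simp [P, P', mul_fin_three] <;> field_simp <;> ring
    refine ⟨2 + 4, (p.conj P P' hP hP2).tri_finite 2 ?_ ?_ ?_⟩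
    · intro γ hγ
      have h := hvv γ hγ
      rw [mulVec_fin_two, mulVec_fin_two] at h
      simp [blkA] at h
      simp only [conj_L, mul_fin_three]
      simp [P, P']
      field_simp
      linarith
    · intro γ hγ
      simp only [conj_L, mul_fin_three, h20, h21]
      simp [P, P']
    · intro γ hγ
      simp only [conj_L, mul_fin_three, h20, h21]
      simp [P, P']

lemma act_pow_trans (γ : Γ) (q e0 e : V3) (l : ℝ) (h0 : p.L γ *ᵥ e0 = e0) (t : ℝ)
    (ha : p.act γ q = q + t • e0) (he : p.L γ *ᵥ e = l • e) (r : ℝ) (n : ℕ) :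
    p.act (γ ^ n) (q + r • e) = q + (n * t) • e0 + (r * l ^ n) • e := by
  induction n with
  | zero => simp [act_one]
  | succ n ih =>
    rw [pow_succ', act_mul, ih, act_add, act_add, ha, Matrix.mulVec_smul, Matrix.mulVec_smul, h0,
      he, smul_smul]
    push_cast
    ext i
    simp only [Pi.add_apply, Pi.smul_apply, smul_eq_mul]
    ring

lemma hyper_contra (γ δ : Γ) (e0 : V3) (hγ0 : p.L γ *ᵥ e0 = e0) (hδ0 : p.L δ *ᵥ e0 = e0)
    (hdet : (p.L γ).det = 1) (q : V3) (t : ℝ) (hq : p.act γ q = q + t • e0)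
    (e : V3) (l : ℝ) (hl1 : |l| < 1) (he : p.L γ *ᵥ e = l • e)
    (hind : (!![e0 0, e 0, (p.L δ *ᵥ e) 0; e0 1, e 1, (p.L δ *ᵥ e) 1;
      e0 2, e 2, (p.L δ *ᵥ e) 2] : M3).det ≠ 0) : False := by
  set e' := p.L δ *ᵥ e with he'
  set B : M3 := !![e0 0, e 0, e' 0; e0 1, e 1, e' 1; e0 2, e 2, e' 2] with hB
  have hBU : IsUnit B.det := isUnit_iff_ne_zero.mpr hind
  have hinv0 : ∀ η : Γ, p.L η *ᵥ e0 = e0 → p.L η⁻¹ *ᵥ e0 = e0 := by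
    intro η h
    conv_lhs => rw [← h]
    rw [Matrix.mulVec_mulVec, L_inv_mul, Matrix.one_mulVec]
  set γ' := δ * γ * δ⁻¹ with hγ'
  have hγ'0 : p.L γ' *ᵥ e0 = e0 := by
    rw [hγ', map_mul, map_mul, ← Matrix.mulVec_mulVec, hinv0 δ hδ0, ← Matrix.mulVec_mulVec, hγ0,
      hδ0]
  set q' := p.act δ q with hq'
  have hq'1 : p.act γ' q' = q' + t • e0 := by
    rw [hγ', hq', act_mul, act_mul, act_inv_act, hq, act_add, Matrix.mulVec_smul, hδ0]
  have he'1 : p.L γ' *ᵥ e' = l • e' := by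
    rw [hγ', he', Matrix.mulVec_mulVec, map_mul, map_mul, Matrix.mul_assoc, L_inv_mul,
      Matrix.mul_one, ← Matrix.mulVec_mulVec, he, Matrix.mulVec_smul]
  have hBv : ∀ c : V3, B *ᵥ c = c 0 • e0 + c 1 • e + c 2 • e' := by
    intro c
    ext i
    rw [mulVec_fin_three]
    fin_cases i <;> simp [hB] <;> ring
  set c := B⁻¹ *ᵥ (q' - q) with hc
  have hcq : q' - q = c 0 • e0 + c 1 • e + c 2 • e' := by
    rw [← hBv, hc, Matrix.mulVec_mulVec, Matrix.mul_nonsing_inv _ hBU, Matrix.one_mulVec]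
  -- q + c1 e = q' - c2 e' - c0 e0
  have hpt : q + c 1 • e = q' + (- c 2) • e' + (- c 0) • e0 := by
    have : q' = q + (c 0 • e0 + c 1 • e + c 2 • e') := by rw [← hcq]; abel
    rw [this]
    ext i
    simp only [Pi.add_apply, Pi.smul_apply, smul_eq_mul]
    ring
  have hpow0 : ∀ (η : Γ), p.L η *ᵥ e0 = e0 → ∀ n : ℕ, p.L (η ^ n) *ᵥ e0 = e0 := by
    intro η h n
    have := pow_mulVec_eig (p.L η) e0 1 (by rw [h, one_smul]) n
    rwa [one_pow, one_smul, ← map_pow] at this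
  set E : ℕ → Γ := fun n => γ' ^ n * (γ ^ n)⁻¹ with hE
  set X : ℕ → V3 := fun n => q + (c 1 * l ^ n) • e with hX
  have hact : ∀ n, p.act (E n) (X n) = q' + (-c 2 * l ^ n) • e' + (-c 0) • e0 := by
    intro n
    have s1 : X n = p.act (γ ^ n) (q + c 1 • e) + (-(n * t)) • e0 := by
      rw [p.act_pow_trans γ q e0 e l hγ0 t hq he, hX]
      ext i
      simp only [Pi.add_apply, Pi.smul_apply, smul_eq_mul]
      ring
    rw [hE, s1, act_mul, act_add, act_inv_act, Matrix.mulVec_smul, hinv0 _ (hpow0 _ hγ0 n),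
      act_add, Matrix.mulVec_smul, hpow0 _ hγ'0 n, hpt, act_add, Matrix.mulVec_smul,
      hpow0 _ hγ'0 n, p.act_pow_trans γ' q' e0 e' l hγ'0 t hq'1 he'1]
    ext i
    simp only [Pi.add_apply, Pi.smul_apply, smul_eq_mul]
    ring
  have hln : ∀ n : ℕ, |l ^ n| ≤ 1 := by
    intro n
    rw [abs_pow]
    exact pow_le_one₀ (abs_nonneg _) hl1.le
  obtain ⟨m, n, hmn, hEE⟩ := p.finite_of_bdd E X
    ((‖q‖ + |c 1| * ‖e‖) + (‖q'‖ + |c 2| * ‖e'‖ + ‖(-c 0) • e0‖)) (by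
      intro n
      have h1 : ‖X n‖ ≤ ‖q‖ + |c 1| * ‖e‖ := by
        refine (norm_add_le _ _).trans ?_
        rw [norm_smul, Real.norm_eq_abs, abs_mul]
        gcongr
        exact mul_le_of_le_one_right (abs_nonneg _) (hln n)
      have h2 : 0 ≤ ‖q'‖ + |c 2| * ‖e'‖ + ‖(-c 0) • e0‖ := by positivity
      linarith) (by
      intro n
      have h1 : ‖p.act (E n) (X n)‖ ≤ ‖q'‖ + |c 2| * ‖e'‖ + ‖(-c 0) • e0‖ := by
        rw [hact]
        refine (norm_add_le _ _).trans ?_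
        gcongr
        refine (norm_add_le _ _).trans ?_
        rw [norm_smul, Real.norm_eq_abs, abs_mul, abs_neg]
        gcongr
        exact mul_le_of_le_one_right (abs_nonneg _) (hln n)
      have h2 : 0 ≤ ‖q‖ + |c 1| * ‖e‖ := by positivity
      linarith)
  obtain ⟨k, hk, rfl⟩ : ∃ k, 1 ≤ k ∧ n = m + k := ⟨n - m, by omega, by omega⟩
  have hγk : γ' ^ k = γ ^ k := by
    simp only [hE] at hEE
    rw [pow_add, pow_add] at hEE
    have h1 : γ' ^ m * (γ ^ m)⁻¹ = γ' ^ m * (γ' ^ k * (γ ^ k)⁻¹) * (γ ^ m)⁻¹ := by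
      rw [hEE]; group
    have h2 := mul_right_cancel h1
    have h3 := left_eq_mul.mp h2
    exact mul_inv_eq_one.mp h3
  have k0 := hpow0 _ hγ0 k
  have k1 := pow_mulVec_eig _ e l he k
  have k2 := pow_mulVec_eig _ e' l he'1 k
  rw [← map_pow] at k1 k2
  rw [hγk] at k2
  have hMB : p.L (γ ^ k) * B = B * !![1, 0, 0; 0, l ^ k, 0; 0, 0, l ^ k] := by
    ext i j
    have a0 := congrFun k0 i
    have a1 := congrFun k1 i
    have a2 := congrFun k2 i
    rw [mulVec_fin_three] at a0 a1 a2
    rw [mul_fin_three, mul_fin_three]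
    fin_cases j
    · simp [hB] at a0 ⊢; rw [a0]; fin_cases i <;> simp
    · simp [hB] at a1 ⊢; rw [a1]; fin_cases i <;> simp <;> ring
    · simp [hB] at a2 ⊢; rw [a2]; fin_cases i <;> simp <;> ring
  have hdd := congrArg Matrix.det hMB
  rw [Matrix.det_mul, Matrix.det_mul, map_pow, Matrix.det_pow, hdet, one_pow, one_mul,
    Matrix.det_fin_three !![1, 0, 0; 0, l ^ k, 0; 0, 0, l ^ k]] at hdd
  have : l ^ (k + k) = 1 := by
    rw [pow_add]
    apply mul_left_cancel₀ hind
    simp only [Matrix.of_apply, Matrix.cons_val] at hdd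
    linarith
  exact pow_abs_lt_one hl1 (by omega) this

end PA
end Mess

open scoped commutatorElement

namespace Mess

open scoped Matrix Matrix.Norms.Operator

namespace PA
variable {Γ : Type} [Group Γ] (p : PA Γ)

lemma red_line_tri (h10 : ∀ γ, p.L γ 1 0 = 0) (h20 : ∀ γ, p.L γ 2 0 = 0) (v : Fin 2 → ℝ)
    (hv : v ≠ 0)
    (hvv : ∀ x ∈ derivedSeries Γ 1, v 0 * (p.blkB x *ᵥ v) 1 - v 1 * (p.blkB x *ᵥ v) 0 = 0) :
    ∃ k, (derivedSeries Γ k : Set Γ).Finite := by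
  have hn : v 0 ^ 2 + v 1 ^ 2 ≠ 0 := by
    intro h
    apply hv
    ext i
    fin_cases i
    · simp; nlinarith [sq_nonneg (v 0), sq_nonneg (v 1)]
    · simp; nlinarith [sq_nonneg (v 0), sq_nonneg (v 1)]
  let P : M3 := !![1, 0, 0; 0, v 0, -v 1; 0, v 1, v 0]
  let P' : M3 := !![1, 0, 0; 0, v 0 / (v 0 ^ 2 + v 1 ^ 2), v 1 / (v 0 ^ 2 + v 1 ^ 2);
    0, - v 1 / (v 0 ^ 2 + v 1 ^ 2), v 0 / (v 0 ^ 2 + v 1 ^ 2)]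
  have hP : P' * P = 1 := by
    ext i j
    fin_cases i <;> fin_cases j <;> simp [P, P', mul_fin_three] <;> field_simp <;> ring
  have hP2 : P * P' = 1 := by
    ext i j
    fin_cases i <;> fin_cases j <;> simp [P, P', mul_fin_three] <;> field_simp <;> ring
  refine ⟨1 + 4, (p.conj P P' hP hP2).tri_finite 1 ?_ ?_ ?_⟩
  · intro γ hγ
    simp only [conj_L, mul_fin_three, h10, h20]
    simp [P, P']
  · intro γ hγ
    simp only [conj_L, mul_fin_three, h10, h20]
    simp [P, P']
  · intro γ hγ
    have h := hvv γ hγ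
    rw [mulVec_fin_two, mulVec_fin_two] at h
    simp [blkB] at h
    simp only [conj_L, mul_fin_three]
    simp [P, P']
    field_simp
    linarith

lemma red_line (h10 : ∀ γ, p.L γ 1 0 = 0) (h20 : ∀ γ, p.L γ 2 0 = 0) :
    ∃ k, (derivedSeries Γ k : Set Γ).Finite := by
  have hmulB : ∀ x y, p.blkB (x * y) = p.blkB x * p.blkB y := by
    intro x y
    ext i j
    fin_cases i <;> fin_cases j <;>
      simp [blkB, mul_fin_two, map_mul, mul_fin_three, h20, h10]
  have hB1 : p.blkB 1 = 1 := by
    ext i j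
    fin_cases i <;> fin_cases j <;> simp [blkB]
  have d0 : ∀ γ ∈ derivedSeries Γ 1, p.L γ 0 0 = 1 :=
    der_kill (derivedSeries Γ 0) (fun γ => p.L γ 0 0) (by simp)
      (by intro x hx y hy; simp [map_mul, mul_fin_three, h20, h10])
      (by intro x hx y hy; rw [mul_comm])
  have hdet : ∀ γ ∈ derivedSeries Γ 1, (p.blkB γ).det = 1 := by
    intro γ hγ
    have := p.det_one γ hγ
    rw [Matrix.det_fin_three, h20, h10, d0 γ hγ] at this
    rw [Matrix.det_fin_two]
    simp [blkB]
    linarith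
  have hfix0 : ∀ γ ∈ derivedSeries Γ 1, p.L γ *ᵥ ![1, 0, 0] = ![1, 0, 0] := by
    intro γ hγ
    ext i
    rw [mulVec_fin_three]
    fin_cases i <;> simp [h10, h20, d0 γ hγ]
  by_cases htr : ∀ γ ∈ derivedSeries Γ 1, |(p.blkB γ).trace| ≤ 2
  · rcases lemS (derivedSeries Γ 1) p.blkB (fun x _ y _ => hmulB x y) hB1
      hdet htr with hcomm | ⟨v, hv, hvv⟩
    · refine ⟨2 + 4, p.tri_finite 2 (fun γ _ => h10 γ) (fun γ _ => h20 γ) ?_⟩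
      intro γ hγ
      have := der_kill (derivedSeries Γ 1) p.blkB hB1 (fun x _ y _ => hmulB x y) hcomm γ hγ
      simpa [blkB] using congrFun (congrFun this 1) 0
    · exact p.red_line_tri h10 h20 v hv hvv
  · push Not at htr
    obtain ⟨γ, hγ, hc⟩ := htr
    have hd := hdet γ hγ
    obtain ⟨l, e, he, hl0, hl1, hAe⟩ := hyp_eig _ hd hc
    by_cases hall : ∀ x ∈ derivedSeries Γ 1, e 0 * (p.blkB x *ᵥ e) 1 - e 1 * (p.blkB x *ᵥ e) 0 = 0
    · exact p.red_line_tri h10 h20 e he hall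
    exfalso
    push Not at hall
    obtain ⟨δ, hδ, hne⟩ := hall
    have hD : (1 - p.blkB γ).det ≠ 0 := by
      have : (1 - p.blkB γ).det = 2 - (p.blkB γ).trace := by
        rw [Matrix.det_fin_two] at hd ⊢
        rw [Matrix.trace_fin_two]
        simp
        linarith
      rw [this]
      intro h0
      rw [show (p.blkB γ).trace = 2 by linarith] at hc
      norm_num at hc
    have hU : IsUnit (1 - p.blkB γ).det := isUnit_iff_ne_zero.mpr hD
    set y := (1 - p.blkB γ)⁻¹ *ᵥ ![p.u γ 1, p.u γ 2] with hy
    have hy2 : (1 - p.blkB γ) *ᵥ y = ![p.u γ 1, p.u γ 2] := by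
      rw [hy, Matrix.mulVec_mulVec, Matrix.mul_nonsing_inv _ hU, Matrix.one_mulVec]
    have hfix : p.act γ ![0, y 0, y 1] = ![0, y 0, y 1] + (p.act γ ![0, y 0, y 1] 0) • ![1, 0, 0] := by
      have k0 := congrFun hy2 0
      have k1 := congrFun hy2 1
      rw [mulVec_fin_two] at k0 k1
      simp [blkB] at k0 k1
      ext i
      rw [act_def, Pi.add_apply, mulVec_fin_three]
      fin_cases i
      · simp; rw [mulVec_fin_three]; simp
      · simp; linarith
      · simp; linarith
    have hl : l - 1 ≠ 0 := by
      intro h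
      rw [show l = 1 by linarith] at hl1
      norm_num at hl1
    refine p.hyper_contra γ δ ![1, 0, 0] (hfix0 γ hγ) (hfix0 δ hδ) (p.det_one γ hγ) _ _ hfix
      ![(p.L γ 0 1 * e 0 + p.L γ 0 2 * e 1) / (l - 1), e 0, e 1] l hl1 ?_ ?_
    · have k0 := congrFun hAe 0
      have k1 := congrFun hAe 1
      rw [mulVec_fin_two] at k0 k1
      simp [blkB] at k0 k1
      ext i
      rw [mulVec_fin_three]
      fin_cases i
      · simp [d0 γ hγ]; field_simp; ring
      · simp [h10]; linarith
      · simp [h20]; linarith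
    · intro h
      apply hne
      rw [Matrix.det_fin_three] at h
      rw [mulVec_fin_two, mulVec_fin_two]
      simp only [mulVec_fin_three, h10, h20] at h
      simp at h
      simp [blkB]
      linarith

end PA
end Mess

open scoped commutatorElement

namespace Mess

open scoped Matrix Matrix.Norms.Operator

lemma exists_mat_map (x y : V3) (hx : x ≠ 0) (hy : y ≠ 0) :
    ∃ P P' : M3, P' * P = 1 ∧ P * P' = 1 ∧ P *ᵥ x = y := by
  obtain ⟨A, hA⟩ := SeparatingDual.exists_continuousLinearEquiv_apply_eq (R := ℝ) hx hy
  refine ⟨LinearMap.toMatrix' (A.toLinearEquiv : V3 →ₗ[ℝ] V3),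
    LinearMap.toMatrix' (A.toLinearEquiv.symm : V3 →ₗ[ℝ] V3), ?_, ?_, ?_⟩
  · rw [← LinearMap.toMatrix'_comp]; simp
  · rw [← LinearMap.toMatrix'_comp]; simp
  · rw [LinearMap.toMatrix'_mulVec]; exact hA

namespace PA
variable {Γ : Type} [Group Γ] (p : PA Γ)

lemma restrict_fin (H2 : ∀ k, ¬ (derivedSeries Γ k : Set Γ).Finite)
    (h : ∃ k, (derivedSeries (derivedSeries Γ 1) k : Set (derivedSeries Γ 1)).Finite) : False := by
  obtain ⟨k, hk⟩ := h
  apply H2 (1 + k)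
  rw [← derived_restrict]
  exact hk.image _

lemma irr_line (H2 : ∀ k, ¬ (derivedSeries Γ k : Set Γ).Finite) (v : V3) (hv : v ≠ 0)
    (h : ∀ γ ∈ derivedSeries Γ 1, ∃ c : ℝ, p.L γ *ᵥ v = c • v) : False := by
  obtain ⟨P, P', h1, h2, h3⟩ := exists_mat_map ![1, 0, 0] v (by
    intro h; simpa using congrFun h 0) hv
  have h4 : P' *ᵥ v = ![1, 0, 0] := by
    rw [← h3, Matrix.mulVec_mulVec, h1, Matrix.one_mulVec]
  have key : ∀ γ : derivedSeries Γ 1, ∃ c : ℝ, (((p.restrict (derivedSeries Γ 1)).conj P P' h1 h2).L γ) *ᵥ ![1, 0, 0] = c • ![1, 0, 0] := by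
    intro γ
    obtain ⟨c, hc⟩ := h γ γ.2
    refine ⟨c, ?_⟩
    rw [conj_L, ← Matrix.mulVec_mulVec, h3, ← Matrix.mulVec_mulVec]
    change P' *ᵥ (p.L γ *ᵥ v) = _
    rw [hc, Matrix.mulVec_smul, h4]
  apply restrict_fin H2
  apply ((p.restrict (derivedSeries Γ 1)).conj P P' h1 h2).red_line
  · intro γ
    obtain ⟨c, hc⟩ := key γ
    have := congrFun hc 1
    rw [mulVec_fin_three] at this
    simpa using this
  · intro γ
    obtain ⟨c, hc⟩ := key γ
    have := congrFun hc 2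
    rw [mulVec_fin_three] at this
    simpa using this

lemma irr_plane (H2 : ∀ k, ¬ (derivedSeries Γ k : Set Γ).Finite) (w : V3) (hw : w ≠ 0)
    (h : ∀ γ ∈ derivedSeries Γ 1, ∃ c : ℝ, w ᵥ* p.L γ = c • w) : False := by
  obtain ⟨Q, Q', h1, h2, h3⟩ := exists_mat_map ![0, 0, 1] w (by
    intro h; simpa using congrFun h 2) hw
  -- P' = Qᵀ , P = Q'ᵀ
  have e1 : Qᵀ * Q'ᵀ = 1 := by rw [← Matrix.transpose_mul, h1, Matrix.transpose_one]
  have e2 : Q'ᵀ * Qᵀ = 1 := by rw [← Matrix.transpose_mul, h2, Matrix.transpose_one]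
  have h4 : ![0, 0, 1] ᵥ* Qᵀ = w := by rw [Matrix.vecMul_transpose, h3]
  have h5 : w ᵥ* Q'ᵀ = ![0, 0, 1] := by
    rw [← h4, Matrix.vecMul_vecMul, e1, Matrix.vecMul_one]
  have key : ∀ γ : derivedSeries Γ 1, ∃ c : ℝ,
      ![0, 0, 1] ᵥ* (((p.restrict (derivedSeries Γ 1)).conj Q'ᵀ Qᵀ e1 e2).L γ) = c • ![0, 0, 1] := by
    intro γ
    obtain ⟨c, hc⟩ := h γ γ.2
    refine ⟨c, ?_⟩
    rw [conj_L, ← Matrix.vecMul_vecMul, ← Matrix.vecMul_vecMul, h4]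
    change (w ᵥ* p.L γ) ᵥ* Q'ᵀ = _
    rw [hc, Matrix.smul_vecMul, h5]
  apply restrict_fin H2
  apply ((p.restrict (derivedSeries Γ 1)).conj Q'ᵀ Qᵀ e1 e2).red_plane
  · intro γ
    obtain ⟨c, hc⟩ := key γ
    have := congrFun hc 0
    rw [Matrix.vecMul, dotProduct, Fin.sum_univ_three] at this
    simpa using this
  · intro γ
    obtain ⟨c, hc⟩ := key γ
    have := congrFun hc 1
    rw [Matrix.vecMul, dotProduct, Fin.sum_univ_three] at this
    simpa using this

lemma irr (H2 : ∀ k, ¬ (derivedSeries Γ k : Set Γ).Finite) (W : Submodule ℝ V3)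
    (hW : ∀ γ ∈ derivedSeries Γ 1, ∀ x ∈ W, p.L γ *ᵥ x ∈ W) : W = ⊥ ∨ W = ⊤ := by
  by_contra hcon
  push Not at hcon
  obtain ⟨hb, ht⟩ := hcon
  have r3 : Module.finrank ℝ V3 = 3 := by simp
  have l1 : Module.finrank ℝ W < 3 := by
    have := Submodule.finrank_lt ht
    omega
  have l2 : Module.finrank ℝ W ≠ 0 := fun h => hb (Submodule.finrank_eq_zero.mp h)
  have l3 : Module.finrank ℝ W = 1 ∨ Module.finrank ℝ W = 2 := by omega
  rcases l3 with l3 | l3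
  · obtain ⟨⟨v, hvW⟩, hv0, hv⟩ := finrank_eq_one_iff'.mp l3
    refine p.irr_line H2 v (fun h => hv0 (by simpa using h)) ?_
    intro γ hγ
    obtain ⟨c, hc⟩ := hv ⟨_, hW γ hγ v hvW⟩
    exact ⟨c, (congrArg Subtype.val hc).symm⟩
  · obtain ⟨f, hf0, hfW⟩ := W.exists_le_ker_of_lt_top (lt_top_iff_ne_top.mpr ht)
    have hker : W = LinearMap.ker f := by
      apply Submodule.eq_of_le_of_finrank_le hfW
      rw [l3]
      have := Submodule.finrank_lt (s := LinearMap.ker f) (fun h => hf0 (LinearMap.ker_eq_top.mp h))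
      rw [r3] at this
      omega
    obtain ⟨x0, hx0⟩ : ∃ x0, f x0 ≠ 0 := by
      by_contra h
      push Not at h
      exact hf0 (LinearMap.ext h)
    set w : V3 := fun i => f (Pi.single i 1) with hw
    have hfw : ∀ x, f x = w ⬝ᵥ x := by
      intro x
      conv_lhs => rw [LinearMap.pi_apply_eq_sum_univ f x]
      simp only [dotProduct, hw, smul_eq_mul]
      refine Finset.sum_congr rfl fun i _ => ?_
      rw [mul_comm]
      congr 2
      ext j
      simp [Pi.single_apply, eq_comm]
    refine p.irr_plane H2 w (fun h => hx0 (by rw [hfw, h]; simp)) ?_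
    intro γ hγ
    refine ⟨f (p.L γ *ᵥ x0) / f x0, ?_⟩
    have : ∀ x, (w ᵥ* p.L γ) ⬝ᵥ x = ((f (p.L γ *ᵥ x0) / f x0) • w) ⬝ᵥ x := by
      intro x
      rw [← Matrix.dotProduct_mulVec, smul_dotProduct, ← hfw, ← hfw]
      have hm : x - (f x / f x0) • x0 ∈ W := by
        rw [hker, LinearMap.mem_ker, map_sub, map_smul, smul_eq_mul]
        field_simp
        ring
      have := hW γ hγ _ hm
      rw [hker, LinearMap.mem_ker, Matrix.mulVec_sub, map_sub, Matrix.mulVec_smul, map_smul,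
        smul_eq_mul] at this
      rw [smul_eq_mul]
      field_simp at this ⊢
      linarith
    ext i
    have := this (Pi.single i 1)
    simpa using this

end PA
end Mess

open scoped commutatorElement

namespace Mess

open scoped Matrix Matrix.Norms.Operator

lemma lin_rec {E : Type*} [AddCommGroup E] [Module ℝ E] [FiniteDimensional ℝ E] (T : E →ₗ[ℝ] E)
    (hT : Function.Injective T) (F : E →ₗ[ℝ] ℝ) (x : E)
    (h : ∀ n : ℕ, F ((T ^ (n + 1)) x) = 0) : F x = 0 := by
  set W := Submodule.span ℝ (Set.range fun n : ℕ => (T ^ n) x) with hW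
  have h1 : W.map T = Submodule.span ℝ (Set.range fun n : ℕ => (T ^ (n + 1)) x) := by
    rw [hW, Submodule.map_span, ← Set.range_comp]
    congr 1
    ext y
    simp [pow_succ']
  have h2 : W.map T ≤ W := by
    rw [h1]
    apply Submodule.span_mono
    rintro _ ⟨n, rfl⟩
    exact ⟨n + 1, rfl⟩
  have h3 : W.map T = W := by
    apply Submodule.eq_of_le_of_finrank_le h2
    exact (Submodule.equivMapOfInjective T hT W).finrank_eq.le
  have hx : x ∈ W := Submodule.subset_span ⟨0, by simp⟩
  rw [← h3, h1] at hx
  have h4 : Submodule.span ℝ (Set.range fun n : ℕ => (T ^ (n + 1)) x) ≤ LinearMap.ker F := by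
    rw [Submodule.span_le]
    rintro _ ⟨n, rfl⟩
    exact h n
  exact h4 hx

lemma det_sub_one (X : M3) : (X - 1).det = X.det - X.adjugate.trace + X.trace - 1 := by
  rw [Matrix.trace_fin_three, Matrix.trace_fin_three, Matrix.adjugate_fin_three,
    Matrix.det_fin_three, Matrix.det_fin_three]
  simp
  ring

lemma exists_real_eig (X : M3) : ∃ l : ℝ, ∃ v : V3, v ≠ 0 ∧ X *ᵥ v = l • v := by
  obtain ⟨t, c, d, h⟩ : ∃ t c d : ℝ, ∀ l : ℝ, (X - l • 1).det = - l ^ 3 + t * l ^ 2 + c * l + d := by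
    refine ⟨X.trace, -X.adjugate.trace, X.det, fun l => ?_⟩
    rw [Matrix.trace_fin_three, Matrix.trace_fin_three, Matrix.adjugate_fin_three,
      Matrix.det_fin_three, Matrix.det_fin_three]
    simp
    ring
  set m := 1 + |t| + |c| + |d| with hm
  have t1 := neg_abs_le t
  have t2 := le_abs_self t
  have c1 := neg_abs_le c
  have c2 := le_abs_self c
  have d1 := neg_abs_le d
  have d2 := le_abs_self d
  have m1 : 1 ≤ m := by have := abs_nonneg t; have := abs_nonneg c; have := abs_nonneg d; linarith
  have m2 : m ≤ m ^ 2 := by nlinarith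
  have e0 : m ^ 3 = m ^ 2 + |t| * m ^ 2 + |c| * m ^ 2 + |d| * m ^ 2 := by
    rw [pow_succ]; nth_rewrite 2 [hm]; ring
  have e1 : |c| * m ≤ |c| * m ^ 2 := by gcongr
  have e2 : |d| ≤ |d| * m ^ 2 := le_mul_of_one_le_right (abs_nonneg _) (by linarith)
  have e3 : t * m ^ 2 ≤ |t| * m ^ 2 := by gcongr
  have e4 : -(|t| * m ^ 2) ≤ t * m ^ 2 := by
    rw [← neg_mul]; gcongr
  have e5 : c * m ≤ |c| * m := by gcongr
  have i1 : (fun l => - l ^ 3 + t * l ^ 2 + c * l + d) m ≤ 0 := by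
    simp only; linarith
  have i2 : 0 ≤ (fun l => - l ^ 3 + t * l ^ 2 + c * l + d) (-m) := by
    simp only
    have : -(-m)^3 = m ^ 3 := by ring
    have h2 : (-m)^2 = m ^ 2 := by ring
    rw [this, h2]
    linarith
  obtain ⟨l, -, hl⟩ := intermediate_value_Icc' (show -m ≤ m by linarith)
    (f := fun l => - l ^ 3 + t * l ^ 2 + c * l + d) (by fun_prop) ⟨i1, i2⟩
  obtain ⟨v, hv, hv2⟩ := Matrix.exists_mulVec_eq_zero_iff.mpr ((h l).trans hl)
  refine ⟨l, v, hv, ?_⟩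
  rw [Matrix.sub_mulVec, Matrix.smul_mulVec, Matrix.one_mulVec] at hv2
  exact sub_eq_zero.mp hv2

namespace PA
variable {Γ : Type} [Group Γ] (p : PA Γ)

lemma det_ne (γ : Γ) : (p.L γ).det ≠ 0 := by
  intro h
  have := congrArg Matrix.det (p.L_mul_inv γ)
  rw [Matrix.det_mul, h] at this
  simp at this

lemma adj_eq (γ : Γ) : (p.L γ).adjugate = (p.L γ).det • p.L γ⁻¹ := by
  have h := Matrix.adjugate_mul (p.L γ)
  have h2 := congrArg (· * p.L γ⁻¹) h
  simp only [Matrix.mul_assoc, L_mul_inv, Matrix.mul_one, Matrix.smul_mul, Matrix.one_mul] at h2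
  exact h2

lemma det_sub_one_of_ne (a : Γ →* Multiplicative ℤ) (γ : Γ) (h : a γ ≠ 1) :
    (p.L γ - 1).det = 0 := by
  by_contra hd
  have hU : IsUnit (p.L γ - 1).det := isUnit_iff_ne_zero.mpr hd
  obtain ⟨n, hn, hγ⟩ := p.finite_order_of_fixed γ ((p.L γ - 1)⁻¹ *ᵥ (- p.u γ)) (by
    set y := (p.L γ - 1)⁻¹ *ᵥ (- p.u γ) with hy
    have hy2 : (p.L γ - 1) *ᵥ y = -p.u γ := by
      rw [hy, Matrix.mulVec_mulVec, Matrix.mul_nonsing_inv _ hU, Matrix.one_mulVec]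
    rw [Matrix.sub_mulVec, Matrix.one_mulVec] at hy2
    rw [act_def, sub_eq_iff_eq_add.mp hy2]
    abel)
  apply h
  have := congrArg a hγ
  rw [map_pow, map_one] at this
  have h3 : (n : ℤ) * Multiplicative.toAdd (a γ) = 0 := by
    have := congrArg Multiplicative.toAdd this
    simpa using this
  have h4 : (n : ℤ) ≠ 0 := by omega
  have h5 := (mul_eq_zero.mp h3).resolve_left h4
  exact toAdd_eq_zero.mp h5

lemma det_sub_one_zero (a : Γ →* Multiplicative ℤ) (δ : Γ) (hδ : a δ = Multiplicative.ofAdd 1)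
    (γ : Γ) : (p.L γ - 1).det = 0 := by
  by_cases h : a γ = 1
  swap
  · exact p.det_sub_one_of_ne a γ h
  set D := p.L δ with hD
  let T : (M3 × M3 × ℝ × ℝ) →ₗ[ℝ] (M3 × M3 × ℝ × ℝ) :=
    { toFun := fun z => (D * z.1, z.2.1 * D.adjugate, D.det * z.2.2.1, z.2.2.2)
      map_add' := by
        rintro ⟨a, b, c, d⟩ ⟨a', b', c', d'⟩
        simp [mul_add, add_mul]
      map_smul' := by
        rintro r ⟨a, b, c, d⟩
        simp
        ring }
  let F : (M3 × M3 × ℝ × ℝ) →ₗ[ℝ] ℝ :=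
    { toFun := fun z => z.2.2.1 - z.2.1.trace + z.1.trace - z.2.2.2
      map_add' := by
        rintro ⟨a, b, c, d⟩ ⟨a', b', c', d'⟩
        simp
        ring
      map_smul' := by
        rintro r ⟨a, b, c, d⟩
        simp
        ring }
  have hT : Function.Injective T := by
    rw [← LinearMap.ker_eq_bot, LinearMap.ker_eq_bot']
    rintro ⟨a, b, c, d⟩ hz
    simp only [T, LinearMap.coe_mk, AddHom.coe_mk, Prod.mk_eq_zero] at hz
    obtain ⟨h1, h2, h3, h4⟩ := hz
    have k1 : a = 0 := by
      have := congrArg (p.L δ⁻¹ * ·) h1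
      simpa [← Matrix.mul_assoc, hD, L_inv_mul] using this
    have k2 : b = 0 := by
      have := congrArg (· * D) h2
      simp only [Matrix.mul_assoc, Matrix.adjugate_mul, Matrix.mul_smul, Matrix.mul_one,
        Matrix.zero_mul] at this
      exact (smul_eq_zero.mp this).resolve_left (p.det_ne δ)
    have k3 : c = 0 := (mul_eq_zero.mp h3).resolve_left (p.det_ne δ)
    rw [k1, k2, k3, h4]
    rfl
  have hpow : ∀ n : ℕ, (T ^ n) (p.L γ, (p.L γ).adjugate, (p.L γ).det, 1) =
      (p.L (δ ^ n * γ), (p.L (δ ^ n * γ)).adjugate, (p.L (δ ^ n * γ)).det, 1) := by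
    intro n
    induction n with
    | zero => simp
    | succ n ih =>
      rw [pow_succ', Module.End.mul_apply, ih]
      simp only [T, LinearMap.coe_mk, AddHom.coe_mk]
      rw [pow_succ' δ, mul_assoc, map_mul p.L δ, Matrix.adjugate_mul_distrib, Matrix.det_mul]
  have hF : ∀ η, F (p.L η, (p.L η).adjugate, (p.L η).det, 1) = (p.L η - 1).det := by
    intro η
    rw [det_sub_one]
    rfl
  have := lin_rec T hT F (p.L γ, (p.L γ).adjugate, (p.L γ).det, 1) (by
    intro n
    rw [hpow, hF]
    apply p.det_sub_one_of_ne a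
    rw [map_mul, map_pow, h, hδ, mul_one, ← ofAdd_nsmul]
    intro h
    have : ((n + 1) • (1 : ℤ)) = 0 := h
    simp at this
    omega)
  rwa [hF] at this

/-- Burnside -/
lemma burnside (H2 : ∀ k, ¬ (derivedSeries Γ k : Set Γ).Finite) (X : M3) :
    X ∈ Submodule.span ℝ (p.L '' (derivedSeries Γ 1 : Set Γ)) := by
  let f : Γ →* Module.End ℝ V3 := (Matrix.toLinAlgEquiv' (R := ℝ) (n := Fin 3)).toMonoidHom.comp p.L
  have hf : ∀ γ x, f γ x = p.L γ *ᵥ x := by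
    intro γ x
    simp [f]
  let 𝒜 : Subalgebra ℝ (Module.End ℝ V3) := Algebra.adjoin ℝ (f '' (derivedSeries Γ 1 : Set Γ))
  have hmem : ∀ γ ∈ derivedSeries Γ 1, f γ ∈ 𝒜 := fun γ hγ => Algebra.subset_adjoin ⟨γ, hγ, rfl⟩
  have : IsSimpleModule 𝒜 V3 := by
    refine (isSimpleModule_iff 𝒜 V3).mpr ⟨fun W => ?_⟩
    rcases p.irr H2 (W.restrictScalars ℝ) (by
      intro γ hγ x hx
      have := W.smul_mem (⟨f γ, hmem γ hγ⟩ : 𝒜) hx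
      rw [← hf]
      exact this) with h | h
    · left
      exact (Submodule.restrictScalars_eq_bot_iff ℝ _ _).mp h
    · right
      exact (Submodule.restrictScalars_eq_top_iff ℝ _ _).mp h
  have hscal : ∀ φ : Module.End 𝒜 V3, ∃ l : ℝ, ∀ x, φ x = l • x := by
    intro φ
    let φ' : V3 →ₗ[ℝ] V3 := φ.restrictScalars ℝ
    obtain ⟨l, v, hv, hlv⟩ := exists_real_eig (LinearMap.toMatrix' φ')
    rw [LinearMap.toMatrix'_mulVec] at hlv
    refine ⟨l, ?_⟩
    rcases p.irr H2 (LinearMap.ker (φ' - l • LinearMap.id)) (by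
      intro γ hγ x hx
      have h1 := φ.map_smul (⟨f γ, hmem γ hγ⟩ : 𝒜) x
      have h2 : φ (p.L γ *ᵥ x) = p.L γ *ᵥ (φ x) := by
        rw [← hf, ← hf]; exact h1
      rw [LinearMap.mem_ker] at hx ⊢
      simp only [LinearMap.sub_apply, LinearMap.smul_apply, LinearMap.id_apply] at hx ⊢
      have hx' : φ x = l • x := sub_eq_zero.mp hx
      change φ (p.L γ *ᵥ x) - _ = 0
      rw [h2, hx', Matrix.mulVec_smul, sub_self]) with h | h
    · exfalso
      apply hv
      have : v ∈ LinearMap.ker (φ' - l • LinearMap.id) := by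
        rw [LinearMap.mem_ker]
        simp [hlv]
      rw [h] at this
      simpa using this
    · intro x
      have : x ∈ LinearMap.ker (φ' - l • LinearMap.id) := by rw [h]; trivial
      rw [LinearMap.mem_ker] at this
      exact sub_eq_zero.mp this
  let g : Module.End (Module.End 𝒜 V3) V3 :=
    { toFun := fun x => X *ᵥ x
      map_add' := fun x y => Matrix.mulVec_add _ _ _
      map_smul' := by
        intro φ x
        obtain ⟨l, hl⟩ := hscal φ
        simp only [Module.End.smul_def, RingHom.id_apply]
        rw [hl, hl, Matrix.mulVec_smul] }
  obtain ⟨r, hr⟩ := jacobson_density (R := 𝒜) g (Finset.univ.image fun i : Fin 3 => Pi.single i (1:ℝ))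
  have hr2 : Matrix.toLin' X = (r : Module.End ℝ V3) := by
    apply LinearMap.pi_ext'
    intro i
    ext j
    have := congrFun (hr (Pi.single i 1) (by simp)) j
    simp only [LinearMap.comp_apply, LinearMap.single_apply, Matrix.toLin'_apply]
    exact this
  have hX : Matrix.toLin' X ∈ 𝒜 := by rw [hr2]; exact r.2
  have hspan : ∀ Y ∈ 𝒜, LinearMap.toMatrix' Y ∈ Submodule.span ℝ (p.L '' (derivedSeries Γ 1 : Set Γ)) := by
    intro Y hY
    have hcl : (Submonoid.closure (f '' (derivedSeries Γ 1 : Set Γ)) : Set (Module.End ℝ V3)) ⊆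
        f '' (derivedSeries Γ 1 : Set Γ) := by
      have : f '' (derivedSeries Γ 1 : Set Γ) = ((derivedSeries Γ 1).toSubmonoid.map f : Set _) := rfl
      rw [this, Submonoid.closure_eq]
    have : Y ∈ Subalgebra.toSubmodule 𝒜 := hY
    rw [Algebra.adjoin_eq_span] at this
    have h2 := Submodule.span_mono hcl this
    clear this hY
    induction h2 using Submodule.span_induction with
    | mem x hx =>
      obtain ⟨γ, hγ, rfl⟩ := hx
      apply Submodule.subset_span
      refine ⟨γ, hγ, ?_⟩
      ext i j
      rw [LinearMap.toMatrix'_apply, hf]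
      simp
    | zero => simp
    | add x y _ _ hx hy => rw [map_add]; exact Submodule.add_mem _ hx hy
    | smul c x _ hx => rw [map_smul]; exact Submodule.smul_mem _ _ hx
  simpa using hspan _ hX

end PA
end Mess

open scoped commutatorElement

namespace Mess

open scoped Matrix Matrix.Norms.Operator

namespace PA
variable {Γ : Type} [Group Γ] (p : PA Γ)

lemma burnside_tr (H2 : ∀ k, ¬ (derivedSeries Γ k : Set Γ).Finite) (Z : M3)
    (h : ∀ δ ∈ derivedSeries Γ 1, (Z * p.L δ).trace = 0) : Z = 0 := by
  have key : ∀ X : M3, (Z * X).trace = 0 := by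
    intro X
    have := p.burnside H2 X
    induction this using Submodule.span_induction with
    | mem x hx => obtain ⟨γ, hγ, rfl⟩ := hx; exact h γ hγ
    | zero => simp
    | add x y _ _ hx hy => rw [mul_add, Matrix.trace_add, hx, hy, add_zero]
    | smul c x _ hx => rw [Matrix.mul_smul, Matrix.trace_smul, hx, smul_zero]
  have := key Zᵀ
  have h2 := Matrix.trace_mul_conjTranspose_self_eq_zero_iff (A := Z)
  rw [Matrix.conjTranspose_eq_transpose_of_trivial] at h2
  exact h2.mp this

lemma form_eq_inv (S : M3) (γ : Γ) : (p.L γ)ᵀ * S * p.L γ = S ↔ S * p.L γ = (p.L γ⁻¹)ᵀ * S := by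
  have e1 : (p.L γ⁻¹)ᵀ * (p.L γ)ᵀ = 1 := by rw [← Matrix.transpose_mul, L_mul_inv, Matrix.transpose_one]
  have e2 : (p.L γ)ᵀ * (p.L γ⁻¹)ᵀ = 1 := by rw [← Matrix.transpose_mul, L_inv_mul, Matrix.transpose_one]
  constructor
  · intro h
    conv_rhs => rw [← h]
    rw [← Matrix.mul_assoc, ← Matrix.mul_assoc, e1, Matrix.one_mul]
  · intro h
    rw [Matrix.mul_assoc, h, ← Matrix.mul_assoc, e2, Matrix.one_mul]

lemma ker_form (H2 : ∀ k, ¬ (derivedSeries Γ k : Set Γ).Finite) (S : M3) (hS : S ≠ 0)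
    (h : ∀ γ ∈ derivedSeries Γ 1, S * p.L γ = (p.L γ⁻¹)ᵀ * S) : S.det ≠ 0 := by
  intro h0
  obtain ⟨v, hv, hv2⟩ := Matrix.exists_mulVec_eq_zero_iff.mpr h0
  rcases p.irr H2 (LinearMap.ker (Matrix.toLin' S)) (by
    intro γ hγ x hx
    rw [LinearMap.mem_ker, Matrix.toLin'_apply] at hx ⊢
    rw [Matrix.mulVec_mulVec, h γ hγ, ← Matrix.mulVec_mulVec, hx, Matrix.mulVec_zero]) with h | h
  · apply hv
    have : v ∈ LinearMap.ker (Matrix.toLin' S) := by simpa using hv2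
    rw [h] at this
    simpa using this
  · apply hS
    rw [LinearMap.ker_eq_top] at h
    simpa using h

/-- the graph of the intertwiner -/
def gr : Submodule ℝ (M3 × M3) :=
  Submodule.span ℝ ((fun γ => (p.L γ, (p.L γ⁻¹)ᵀ)) '' (derivedSeries Γ 1 : Set Γ))

lemma gr_mem {γ : Γ} (hγ : γ ∈ derivedSeries Γ 1) : (p.L γ, (p.L γ⁻¹)ᵀ) ∈ p.gr :=
  Submodule.subset_span ⟨γ, hγ, rfl⟩

lemma gr_mul_left {γ : Γ} (hγ : γ ∈ derivedSeries Γ 1) {z : M3 × M3} (hz : z ∈ p.gr) :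
    (p.L γ * z.1, (p.L γ⁻¹)ᵀ * z.2) ∈ p.gr := by
  unfold gr at hz
  induction hz using Submodule.span_induction with
  | mem x hx =>
    obtain ⟨δ, hδ, rfl⟩ := hx
    have := p.gr_mem (mul_mem hγ hδ)
    rwa [mul_inv_rev, map_mul, map_mul, Matrix.transpose_mul] at this
  | zero =>
    simp only [Prod.fst_zero, Prod.snd_zero, Matrix.mul_zero]
    exact Submodule.zero_mem p.gr
  | add x y _ _ hx hy =>
    have := add_mem hx hy
    simpa [mul_add] using this
  | smul c x _ hx =>
    have := Submodule.smul_mem _ c hx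
    simpa using this

lemma gr_ex (H2 : ∀ k, ¬ (derivedSeries Γ k : Set Γ).Finite) (X : M3) : ∃ Y, (X, Y) ∈ p.gr := by
  have := p.burnside H2 X
  induction this using Submodule.span_induction with
  | mem x hx => obtain ⟨γ, hγ, rfl⟩ := hx; exact ⟨_, p.gr_mem hγ⟩
  | zero => exact ⟨0, Submodule.zero_mem _⟩
  | add x y _ _ hx hy =>
    obtain ⟨a, ha⟩ := hx
    obtain ⟨b, hb⟩ := hy
    exact ⟨_, add_mem ha hb⟩
  | smul c x _ hx =>
    obtain ⟨a, ha⟩ := hx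
    exact ⟨_, Submodule.smul_mem _ c ha⟩

lemma gr_trace (htr : ∀ γ ∈ derivedSeries Γ 1, (p.L γ).trace = (p.L γ⁻¹).trace)
    {z : M3 × M3} (hz : z ∈ p.gr) : z.1.trace = z.2.trace := by
  unfold gr at hz
  induction hz using Submodule.span_induction with
  | mem x hx =>
    obtain ⟨δ, hδ, rfl⟩ := hx
    simp [htr δ hδ]
  | zero => simp
  | add x y _ _ hx hy => simp [hx, hy]
  | smul c x _ hx => simp [hx]

lemma gr_zero_left (H2 : ∀ k, ¬ (derivedSeries Γ k : Set Γ).Finite)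
    (htr : ∀ γ ∈ derivedSeries Γ 1, (p.L γ).trace = (p.L γ⁻¹).trace)
    (Y : M3) (h : ((0 : M3), Y) ∈ p.gr) : Y = 0 := by
  have : Yᵀ = 0 := by
    apply p.burnside_tr H2
    intro δ hδ
    have h1 := p.gr_trace htr (p.gr_mul_left (inv_mem hδ) h)
    simp only [inv_inv, Matrix.mul_zero, Matrix.trace_zero] at h1
    rw [← Matrix.trace_transpose, Matrix.transpose_mul, Matrix.transpose_transpose, ← h1]
  rw [← Matrix.transpose_transpose Y, this, Matrix.transpose_zero]

lemma gr_zero_right (H2 : ∀ k, ¬ (derivedSeries Γ k : Set Γ).Finite)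
    (htr : ∀ γ ∈ derivedSeries Γ 1, (p.L γ).trace = (p.L γ⁻¹).trace)
    (X : M3) (h : (X, (0 : M3)) ∈ p.gr) : X = 0 := by
  apply p.burnside_tr H2
  intro δ hδ
  have h1 := p.gr_trace htr (p.gr_mul_left hδ h)
  simp only [Matrix.mul_zero, Matrix.trace_zero] at h1
  rw [Matrix.trace_mul_comm, h1]

lemma form_ex (H2 : ∀ k, ¬ (derivedSeries Γ k : Set Γ).Finite)
    (htr : ∀ γ ∈ derivedSeries Γ 1, (p.L γ).trace = (p.L γ⁻¹).trace) :
    ∃ Q : M3, Q ≠ 0 ∧ ∀ γ ∈ derivedSeries Γ 1, Q * p.L γ = (p.L γ⁻¹)ᵀ * Q := by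
  choose σ hσ using p.gr_ex H2
  have uniq : ∀ X Y, (X, Y) ∈ p.gr → Y = σ X := by
    intro X Y h
    have := sub_mem h (hσ X)
    rw [Prod.mk_sub_mk, sub_self] at this
    exact sub_eq_zero.mp (p.gr_zero_left H2 htr _ this)
  let E : Fin 3 → M3 := fun i => Matrix.single i 0 1
  have hF : σ (E 0) ≠ 0 := by
    intro h
    have h1 := hσ (E 0)
    rw [h] at h1
    have h2 := p.gr_zero_right H2 htr _ h1
    have := congrFun (congrFun h2 0) 0
    simp [E] at this
  obtain ⟨w, hw⟩ : ∃ w : V3, σ (E 0) *ᵥ w ≠ 0 := by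
    by_contra hc
    push Not at hc
    apply hF
    exact Matrix.ext_of_mulVec_single (fun i => by rw [hc, Matrix.zero_mulVec])
  let Q : M3 := Matrix.of fun j i => (σ (E i) *ᵥ w) j
  refine ⟨Q, ?_, ?_⟩
  · intro h
    apply hw
    ext j
    exact congrFun (congrFun h j) 0
  · intro γ hγ
    ext j i
    have h1 : (p.L γ⁻¹)ᵀ * σ (E i) = ∑ k, p.L γ k i • σ (E k) := by
      have a1 := p.gr_mul_left hγ (hσ (E i))
      have a2 : (∑ k, p.L γ k i • E k, ∑ k, p.L γ k i • σ (E k)) ∈ p.gr := by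
        have := Submodule.sum_mem p.gr (t := Finset.univ) (f := fun k => p.L γ k i • (E k, σ (E k)))
          (fun k _ => Submodule.smul_mem _ _ (hσ (E k)))
        have e : (∑ k, p.L γ k i • E k, ∑ k, p.L γ k i • σ (E k)) = ∑ k, p.L γ k i • (E k, σ (E k)) := by
          apply Prod.ext
          · rw [Prod.fst_sum]; rfl
          · rw [Prod.snd_sum]; rfl
        rw [e]
        exact this
      have a3 : p.L γ * E i = ∑ k, p.L γ k i • E k := by
        ext a b
        rw [Matrix.sum_apply]
        fin_cases a <;> fin_cases b <;> simp [E, Matrix.mul_single_apply_same, Matrix.single_apply]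
      rw [uniq _ _ a1, uniq _ _ a2]
      simp only [a3]
    have h2 := congrFun (congrArg (· *ᵥ w) h1) j
    simp only [← Matrix.mulVec_mulVec, Matrix.sum_mulVec, Matrix.smul_mulVec, Finset.sum_apply, Pi.smul_apply, smul_eq_mul] at h2
    rw [Matrix.mul_apply, Matrix.mul_apply]
    rw [Matrix.mulVec, dotProduct] at h2
    simp only [Q, Matrix.of_apply]
    rw [h2]
    exact Finset.sum_congr rfl fun k _ => mul_comm _ _

lemma inv_form (H2 : ∀ k, ¬ (derivedSeries Γ k : Set Γ).Finite) (a : Γ →* Multiplicative ℤ) (δ : Γ)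
    (hδ : a δ = Multiplicative.ofAdd 1) :
    ∃ S : M3, Sᵀ = S ∧ S.det ≠ 0 ∧ (∀ γ, (p.L γ)ᵀ * S * p.L γ = S) ∧ ∀ γ, (p.L γ).det = 1 := by
  have hz := p.det_sub_one_zero a δ hδ
  have htr : ∀ γ ∈ derivedSeries Γ 1, (p.L γ).trace = (p.L γ⁻¹).trace := by
    intro γ hγ
    have := hz γ
    rw [det_sub_one, adj_eq, p.det_one γ hγ, one_smul] at this
    linarith
  obtain ⟨Q, hQ0, hQ⟩ := p.form_ex H2 htr
  have hQT : ∀ γ ∈ derivedSeries Γ 1, Qᵀ * p.L γ = (p.L γ⁻¹)ᵀ * Qᵀ := by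
    intro γ hγ
    have := congrArg Matrix.transpose (hQ γ⁻¹ (inv_mem hγ))
    rw [Matrix.transpose_mul, Matrix.transpose_mul, inv_inv, Matrix.transpose_transpose] at this
    exact this.symm
  set S := Q + Qᵀ with hS
  have hS1 : ∀ γ ∈ derivedSeries Γ 1, S * p.L γ = (p.L γ⁻¹)ᵀ * S := by
    intro γ hγ
    rw [hS, add_mul, mul_add, hQ γ hγ, hQT γ hγ]
  have hSs : Sᵀ = S := by
    rw [hS, Matrix.transpose_add, Matrix.transpose_transpose, add_comm]
  have hS0 : S ≠ 0 := by
    intro h0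
    apply p.ker_form H2 Q hQ0 hQ
    have h1 : Qᵀ = -Q := (neg_eq_of_add_eq_zero_right h0).symm
    have h2 := congrArg Matrix.det h1
    rw [Matrix.det_transpose, Matrix.det_neg] at h2
    simp at h2
    linarith
  have hSd := p.ker_form H2 S hS0 hS1
  have hSU : IsUnit S.det := isUnit_iff_ne_zero.mpr hSd
  have main : ∀ γ, p.L γ = (p.L γ).det • (S⁻¹ * (p.L γ⁻¹)ᵀ * S) ∧ (p.L γ).det = 1 := by
    intro γ
    set d := (p.L γ).det with hd
    set Y := p.L γ - d • (S⁻¹ * (p.L γ⁻¹)ᵀ * S) with hY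
    have hY1 : ∀ δ ∈ derivedSeries Γ 1, (Y * p.L δ).trace = 1 - d := by
      intro δ hδ
      have h1 := hz (γ * δ)
      rw [det_sub_one, adj_eq, map_mul, Matrix.det_mul, p.det_one δ hδ, mul_one, ← hd,
        Matrix.trace_smul, smul_eq_mul, mul_inv_rev, map_mul] at h1
      have h2 : (S⁻¹ * (p.L γ⁻¹)ᵀ * S * p.L δ).trace = (p.L δ⁻¹ * p.L γ⁻¹).trace := by
        rw [Matrix.mul_assoc, hS1 δ hδ, Matrix.mul_assoc, Matrix.trace_mul_comm, Matrix.mul_assoc,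
          Matrix.mul_assoc, Matrix.mul_nonsing_inv _ hSU, Matrix.mul_one, ← Matrix.transpose_mul,
          Matrix.trace_transpose]
      rw [hY, sub_mul, Matrix.trace_sub, Matrix.smul_mul, Matrix.trace_smul, h2, smul_eq_mul]
      linarith
    have hY2 : ∀ δ ∈ derivedSeries Γ 1, Y * p.L δ = Y := by
      intro δ hδ
      have : Y * p.L δ - Y = 0 := by
        apply p.burnside_tr H2
        intro η hη
        rw [sub_mul, Matrix.mul_assoc, ← map_mul, Matrix.trace_sub, hY1 _ (mul_mem hδ hη),
          hY1 _ hη, sub_self]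
      exact sub_eq_zero.mp this
    have hY0 : Y = 0 := by
      by_contra hne
      obtain ⟨i, hi⟩ : ∃ i, Y i ≠ 0 := by
        by_contra hc
        push Not at hc
        exact hne (by ext i j; rw [hc i]; rfl)
      apply p.irr_plane H2 (Y i) hi
      intro γ hγ
      refine ⟨1, ?_⟩
      rw [one_smul]
      ext j
      exact congrFun (congrFun (hY2 γ hγ) i) j
    have h1 := hY1 1 (one_mem _)
    rw [hY0] at h1
    simp at h1
    exact ⟨sub_eq_zero.mp (hY ▸ hY0), by linarith⟩
  refine ⟨S, hSs, hSd, ?_, fun γ => (main γ).2⟩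
  intro γ
  rw [form_eq_inv]
  have h1 := (main γ).1
  rw [(main γ).2, one_smul] at h1
  conv_lhs => rw [h1]
  rw [← Matrix.mul_assoc, ← Matrix.mul_assoc, Matrix.mul_nonsing_inv _ hSU, Matrix.one_mul]

end PA
end Mess

open scoped commutatorElement

namespace Mess

open scoped Matrix Matrix.Norms.Operator

/-- the Lorentz form -/
def J : M3 := !![0, 0, -1; 0, 1, 0; -1, 0, 0]

lemma diag_form (S : M3) (hS : Sᵀ = S) (hd : S.det ≠ 0) :
    ∃ P : M3, ∃ s : Fin 3 → ℝ, (∀ i, s i = 1 ∨ s i = -1) ∧ Pᵀ * S * P = Matrix.diagonal s := by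
  have hA : S.IsHermitian := by
    rw [Matrix.IsHermitian, Matrix.conjTranspose_eq_transpose_of_trivial, hS]
  have h1 := hA.conjStarAlgAut_star_eigenvectorUnitary
  rw [Unitary.conjStarAlgAut_star_apply] at h1
  set U : M3 := (hA.eigenvectorUnitary : M3) with hU
  set l := hA.eigenvalues with hl
  have hl0 : ∀ i, l i ≠ 0 := by
    intro i hi
    apply hd
    rw [hA.det_eq_prod_eigenvalues]
    exact Finset.prod_eq_zero (Finset.mem_univ i) (by simpa using hi)
  rw [Matrix.star_eq_conjTranspose, Matrix.conjTranspose_eq_transpose_of_trivial] at h1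
  refine ⟨U * Matrix.diagonal (fun i => (√|l i|)⁻¹), fun i => l i / |l i|, ?_, ?_⟩
  · intro i
    rcases lt_or_gt_of_ne (hl0 i) with h | h
    · right; beta_reduce; rw [abs_of_neg h, div_neg, div_self (hl0 i)]
    · left; beta_reduce; rw [abs_of_pos h]; field_simp
  · rw [Matrix.transpose_mul, Matrix.diagonal_transpose]
    have : Matrix.diagonal (fun i => (√|l i|)⁻¹) * Uᵀ * S * (U * Matrix.diagonal (fun i => (√|l i|)⁻¹)) =
      Matrix.diagonal (fun i => (√|l i|)⁻¹) * (Uᵀ * S * U) * Matrix.diagonal (fun i => (√|l i|)⁻¹) := by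
      simp only [Matrix.mul_assoc]
    rw [this, h1, Matrix.diagonal_mul_diagonal, Matrix.diagonal_mul_diagonal]
    congr 1
    ext i
    have h2 : 0 < |l i| := abs_pos.mpr (hl0 i)
    have h3 := Real.mul_self_sqrt h2.le
    have h4 : √|l i| ≠ 0 := (Real.sqrt_pos.mpr h2).ne'
    simp only [Function.comp_apply, RCLike.ofReal_real_eq_id, id_eq]
    rw [div_eq_mul_inv]
    calc _ = l i * (√|l i| * √|l i|)⁻¹ := by field_simp
      _ = _ := by rw [h3]

lemma sq_half : (√(1/2:ℝ)) * √(1/2:ℝ) = 1/2 := Real.mul_self_sqrt (by norm_num)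

lemma norm_form (S : M3) (hS : Sᵀ = S) (hd : S.det ≠ 0) :
    ∃ P : M3, ∃ e : ℝ, (e = 1 ∨ e = -1) ∧ (Pᵀ * S * P = e • 1 ∨ Pᵀ * S * P = e • J) := by
  obtain ⟨P, s, hs, hP⟩ := diag_form S hS hd
  have key : ∀ (R : M3) (e : ℝ), (e = 1 ∨ e = -1) → (Rᵀ * Matrix.diagonal s * R = e • J) →
      ∃ P : M3, ∃ e : ℝ, (e = 1 ∨ e = -1) ∧ (Pᵀ * S * P = e • 1 ∨ Pᵀ * S * P = e • J) := by
    intro R e he hR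
    refine ⟨P * R, e, he, Or.inr ?_⟩
    rw [← hR, ← hP, Matrix.transpose_mul]
    simp only [Matrix.mul_assoc]
  have hq := sq_half
  set r := √(1/2:ℝ)
  have k0 := key !![r, 0, r; 0, 1, 0; r, 0, -r] (s 1)
  have k1 := key !![0, 1, 0; r, 0, r; r, 0, -r] (s 0)
  have k2 := key !![0, 1, 0; r, 0, -r; r, 0, r] (s 0)
  have hsame : s 0 = s 1 → s 1 = s 2 → ∃ P : M3, ∃ e : ℝ, (e = 1 ∨ e = -1) ∧ (Pᵀ * S * P = e • 1 ∨ Pᵀ * S * P = e • J) := by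
    intro h1 h2
    refine ⟨P, s 0, hs 0, Or.inl ?_⟩
    rw [hP]
    ext i j
    fin_cases i <;> fin_cases j <;> simp [h1, h2]
  rcases hs 0 with h0 | h0 <;> rcases hs 1 with h1 | h1 <;> rcases hs 2 with h2 | h2
  · exact hsame (by rw [h0, h1]) (by rw [h1, h2])
  · apply k2 (by simp [h0])
    ext i j
    rw [mul_fin_three, mul_fin_three, mul_fin_three, mul_fin_three]
    fin_cases i <;> fin_cases j <;> simp [J, h0, h1, h2] <;> linarith
  · apply k1 (by simp [h0])
    ext i j
    rw [mul_fin_three, mul_fin_three, mul_fin_three, mul_fin_three]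
    fin_cases i <;> fin_cases j <;> simp [J, h0, h1, h2] <;> linarith
  · apply k0 (by simp [h1])
    ext i j
    rw [mul_fin_three, mul_fin_three, mul_fin_three, mul_fin_three]
    fin_cases i <;> fin_cases j <;> simp [J, h0, h1, h2] <;> linarith
  · apply k0 (by simp [h1])
    ext i j
    rw [mul_fin_three, mul_fin_three, mul_fin_three, mul_fin_three]
    fin_cases i <;> fin_cases j <;> simp [J, h0, h1, h2] <;> linarith
  · apply k1 (by simp [h0])
    ext i j
    rw [mul_fin_three, mul_fin_three, mul_fin_three, mul_fin_three]
    fin_cases i <;> fin_cases j <;> simp [J, h0, h1, h2] <;> linarith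
  · apply k2 (by simp [h0])
    ext i j
    rw [mul_fin_three, mul_fin_three, mul_fin_three, mul_fin_three]
    fin_cases i <;> fin_cases j <;> simp [J, h0, h1, h2] <;> linarith
  · exact hsame (by rw [h0, h1]) (by rw [h1, h2])

namespace PA
variable {Γ : Type} [Group Γ]

lemma normalize (p : PA Γ) (H2 : ∀ k, ¬ (derivedSeries Γ k : Set Γ).Finite) (a : Γ →* Multiplicative ℤ) (δ : Γ)
    (hδ : a δ = Multiplicative.ofAdd 1) :
    ∃ q : PA Γ, ((∀ γ, (q.L γ)ᵀ * 1 * q.L γ = 1) ∨ (∀ γ, (q.L γ)ᵀ * J * q.L γ = J)) ∧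
      ∀ γ, (q.L γ).det = 1 := by
  obtain ⟨S, hS, hd, hL, hdet⟩ := p.inv_form H2 a δ hδ
  obtain ⟨P, e, he, hP⟩ := norm_form S hS hd
  have he0 : e ≠ 0 := by rcases he with h | h <;> rw [h] <;> norm_num
  have hPd : IsUnit P.det := by
    rw [isUnit_iff_ne_zero]
    intro h0
    rcases hP with h | h
    · have := congrArg Matrix.det h
      rw [Matrix.det_mul, Matrix.det_mul, h0, Matrix.det_smul] at this
      simp at this
      exact he0 (pow_eq_zero_iff (by norm_num) |>.mp this.symm)
    · have := congrArg Matrix.det h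
      rw [Matrix.det_mul, Matrix.det_mul, h0, Matrix.det_smul, Matrix.det_fin_three J] at this
      simp [he0, J] at this
  have h1 := Matrix.nonsing_inv_mul _ hPd
  have h2 := Matrix.mul_nonsing_inv _ hPd
  refine ⟨p.conj P P⁻¹ h1 h2, ?_, ?_⟩
  · have key : ∀ T : M3, Pᵀ * S * P = e • T → ∀ γ, ((p.conj P P⁻¹ h1 h2).L γ)ᵀ * T *
        (p.conj P P⁻¹ h1 h2).L γ = T := by
      intro T hT γ
      have hT2 : T = e⁻¹ • (Pᵀ * S * P) := by rw [hT, smul_smul, inv_mul_cancel₀ he0, one_smul]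
      rw [conj_L, hT2, Matrix.mul_smul, Matrix.smul_mul]
      congr 1
      have h3 : (P⁻¹)ᵀ * Pᵀ = 1 := by rw [← Matrix.transpose_mul, h2, Matrix.transpose_one]
      calc (P⁻¹ * p.L γ * P)ᵀ * (Pᵀ * S * P) * (P⁻¹ * p.L γ * P)
          = Pᵀ * (p.L γ)ᵀ * ((P⁻¹)ᵀ * Pᵀ) * S * (P * P⁻¹) * p.L γ * P := by
            simp only [Matrix.transpose_mul, Matrix.mul_assoc]
        _ = Pᵀ * ((p.L γ)ᵀ * S * p.L γ) * P := by
            rw [h3, h2]; simp only [Matrix.mul_one, Matrix.mul_assoc]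
        _ = Pᵀ * S * P := by rw [hL]
    rcases hP with h | h
    · exact Or.inl (key 1 h)
    · exact Or.inr (key J h)
  · intro γ
    rw [conj_L, Matrix.det_mul, Matrix.det_mul, hdet, mul_one, ← Matrix.det_mul, h1, Matrix.det_one]

end PA
end Mess

open scoped commutatorElement

namespace Mess

open scoped Matrix Matrix.Norms.Operator

/-- conditions on the form -/
structure FormOK (S : M3) : Prop where
  symm : Sᵀ = S
  sq : S * S = 1
  null : ∀ v w : V3, v ≠ 0 → v ⬝ᵥ S *ᵥ v = 0 → w ⬝ᵥ S *ᵥ w = 0 → v ⬝ᵥ S *ᵥ w = 0 → ∃ c : ℝ, w = c • v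

lemma formOK_one : FormOK 1 where
  symm := Matrix.transpose_one
  sq := one_mul 1
  null := by
    intro v w hv h
    rw [Matrix.one_mulVec] at h
    exact absurd (dotProduct_self_eq_zero.mp h) hv

lemma dot_fin_three (v w : V3) : v ⬝ᵥ w = v 0 * w 0 + v 1 * w 1 + v 2 * w 2 := by
  rw [dotProduct, Fin.sum_univ_three]

lemma J_dot (v w : V3) : v ⬝ᵥ J *ᵥ w = v 1 * w 1 - v 0 * w 2 - v 2 * w 0 := by
  rw [dot_fin_three, mulVec_fin_three, mulVec_fin_three, mulVec_fin_three]
  simp [J]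
  ring

lemma formOK_J : FormOK J where
  symm := by ext i j; fin_cases i <;> fin_cases j <;> simp [J]
  sq := by ext i j; rw [mul_fin_three]; fin_cases i <;> fin_cases j <;> simp [J]
  null := by
    intro v w hv h1 h2 h3
    rw [J_dot] at h1 h2 h3
    have k01 : (v 0 * w 1 - v 1 * w 0) ^ 2 = 0 := by
      linear_combination v 0 ^ 2 * h2 + w 0 ^ 2 * h1 - 2 * v 0 * w 0 * h3
    have k12 : (v 2 * w 1 - v 1 * w 2) ^ 2 = 0 := by
      linear_combination v 2 ^ 2 * h2 + w 2 ^ 2 * h1 - 2 * v 2 * w 2 * h3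
    have e01 : v 0 * w 1 - v 1 * w 0 = 0 := by simpa using k01
    have e12 : v 2 * w 1 - v 1 * w 2 = 0 := by simpa using k12
    by_cases h : v 0 = 0
    · have hv1 : v 1 = 0 := by
        rw [h] at h1; nlinarith
      have hv2 : v 2 ≠ 0 := by
        intro h'; apply hv; ext i; fin_cases i <;> simp [h, hv1, h']
      have hw1 : w 1 = 0 := by
        rw [hv1] at e12
        have : v 2 * w 1 = 0 := by linarith
        exact (mul_eq_zero.mp this).resolve_left hv2
      have hw0 : w 0 = 0 := by
        rw [h, hv1] at h3
        have : v 2 * w 0 = 0 := by linarith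
        exact (mul_eq_zero.mp this).resolve_left hv2
      refine ⟨w 2 / v 2, ?_⟩
      ext i
      fin_cases i
      · simp [h, hw0]
      · simp [hv1, hw1]
      · simp; field_simp
    · refine ⟨w 0 / v 0, ?_⟩
      have hw1 : w 1 = w 0 / v 0 * v 1 := by field_simp; linarith
      ext i
      fin_cases i
      · simp; field_simp
      · simpa using hw1
      · simp
        field_simp
        have : v 0 * (w 2 * v 0 - w 0 * v 2) = 0 := by
          linear_combination - v 0 * h3 + v 1 * e01 + w 0 * h1
        have := (mul_eq_zero.mp this).resolve_left h
        linarith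

lemma antisymm_ker (M : M3) (hM : Mᵀ = -M) (hM0 : M ≠ 0) (u u' : V3) (hu : u ≠ 0)
    (h : M *ᵥ u = 0) (h' : M *ᵥ u' = 0) : ∃ c : ℝ, u' = c • u := by
  have hs : ∀ i j, M j i = - M i j := fun i j => congrFun (congrFun hM i) j
  have d0 : M 0 0 = 0 := by have := hs 0 0; linarith
  have d1 : M 1 1 = 0 := by have := hs 1 1; linarith
  have d2 : M 2 2 = 0 := by have := hs 2 2; linarith
  have s10 := hs 0 1
  have s20 := hs 0 2
  have s21 := hs 1 2
  set v : V3 := ![M 1 2, - M 0 2, M 0 1] with hv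
  have par : ∀ u : V3, M *ᵥ u = 0 → ∃ c : ℝ, u = c • v := by
    intro u h
    have k0 := congrFun h 0
    have k1 := congrFun h 1
    have k2 := congrFun h 2
    rw [mulVec_fin_three, Pi.zero_apply] at k0 k1 k2
    rw [d0] at k0
    rw [d1, s10] at k1
    rw [d2, s20, s21] at k2
    by_cases h01 : M 0 1 = 0
    · by_cases h02 : M 0 2 = 0
      · by_cases h12 : M 1 2 = 0
        · exfalso
          apply hM0
          ext i j
          fin_cases i <;> fin_cases j <;> simp [d0, d1, d2, s10, s20, s21, h01, h02, h12]
        · refine ⟨u 0 / M 1 2, ?_⟩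
          rw [h01] at k1
          rw [h02] at k2
          have a1 : u 1 = 0 := by
            have : M 1 2 * u 1 = 0 := by linarith
            exact (mul_eq_zero.mp this).resolve_left h12
          have a2 : u 2 = 0 := by
            have : M 1 2 * u 2 = 0 := by linarith
            exact (mul_eq_zero.mp this).resolve_left h12
          ext i
          fin_cases i
          · simp [hv]; field_simp
          · simp [hv, h02, a1]
          · simp [hv, h01, a2]
      · refine ⟨- u 1 / M 0 2, ?_⟩
        rw [h01] at k0 k1
        have a2 : u 2 = 0 := by
          have : M 0 2 * u 2 = 0 := by linarith
          exact (mul_eq_zero.mp this).resolve_left h02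
        ext i
        fin_cases i
        · simp [hv]; field_simp; linarith
        · simp [hv]; field_simp
        · simp [hv, h01, a2]
    · refine ⟨u 2 / M 0 1, ?_⟩
      ext i
      fin_cases i
      · simp [hv]; field_simp; linarith
      · simp [hv]; field_simp; linarith
      · simp [hv]; field_simp
  obtain ⟨c, hc⟩ := par u h
  obtain ⟨c', hc'⟩ := par u' h'
  have hc0 : c ≠ 0 := by rintro rfl; apply hu; rw [hc, zero_smul]
  exact ⟨c' / c, by rw [hc, hc', smul_smul, div_mul_cancel₀ _ hc0]⟩

lemma ker_one (S g g' : M3) (hS : FormOK S) (hg : S * g = g'ᵀ * S) (hgg : g' * g = 1)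
    (hne : g ≠ g') (w w' : V3) (hw0 : w ≠ 0) (hw : g *ᵥ w = w)
    (hw' : g *ᵥ w' = w') : ∃ c : ℝ, w' = c • w := by
  have inv : ∀ x : V3, g *ᵥ x = x → g' *ᵥ x = x := by
    intro x hx
    conv_lhs => rw [← hx]
    rw [Matrix.mulVec_mulVec, hgg, Matrix.one_mulVec]
  have hSS : ∀ x : V3, S *ᵥ (S *ᵥ x) = x := by
    intro x; rw [Matrix.mulVec_mulVec, hS.sq, Matrix.one_mulVec]
  have e1 : g * S = S * g'ᵀ := by
    have := congrArg (fun X => S * X * S) hg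
    simp only [← Matrix.mul_assoc, hS.sq, Matrix.one_mul] at this
    rwa [Matrix.mul_assoc, Matrix.mul_assoc, hS.sq, Matrix.mul_one] at this
  have e2 : S * gᵀ = g' * S := by
    have := congrArg Matrix.transpose hg
    rw [Matrix.transpose_mul, Matrix.transpose_mul, hS.symm, Matrix.transpose_transpose] at this
    have := congrArg (fun X => S * X * S) this
    simp only [Matrix.mul_assoc, hS.sq, Matrix.mul_one] at this
    rwa [← Matrix.mul_assoc, ← Matrix.mul_assoc, hS.sq, Matrix.one_mul] at this
  obtain ⟨c, hc⟩ := antisymm_ker ((g - g') * S) (by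
      rw [Matrix.transpose_mul, Matrix.transpose_sub, hS.symm, mul_sub, e2, ← e1, sub_mul, neg_sub])
    (by
      intro h0
      apply hne
      have := congrArg (· * S) h0
      simp only [Matrix.mul_assoc, hS.sq, Matrix.mul_one, Matrix.zero_mul] at this
      exact sub_eq_zero.mp this) (S *ᵥ w) (S *ᵥ w') (by
      intro h
      apply hw0
      rw [← hSS w, h, Matrix.mulVec_zero]) (by
      rw [← Matrix.mulVec_mulVec, hSS, Matrix.sub_mulVec, hw, inv w hw, sub_self]) (by
      rw [← Matrix.mulVec_mulVec, hSS, Matrix.sub_mulVec, hw', inv w' hw', sub_self])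
  refine ⟨c, ?_⟩
  rw [← hSS w', hc, Matrix.mulVec_smul, hSS]

lemma form_pres (S g : M3) (hg : gᵀ * S * g = S) (v w : V3) :
    (g *ᵥ v) ⬝ᵥ S *ᵥ (g *ᵥ w) = v ⬝ᵥ S *ᵥ w := by
  conv_rhs => rw [← hg]
  rw [← Matrix.mulVec_mulVec, ← Matrix.mulVec_mulVec, Matrix.dotProduct_mulVec v, Matrix.vecMul_transpose]

lemma star_lem (S g g' : M3) (hS : FormOK S) (hpres : gᵀ * S * g = S) (hg : S * g = g'ᵀ * S)
    (hgg : g' * g = 1) (hg1 : g ≠ 1) (hnear : ‖g - 1‖ < 1)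
    (v w : V3) (hv0 : v ≠ 0) (hv : g *ᵥ v = v) (hvw : w ⬝ᵥ S *ᵥ w = v ⬝ᵥ S *ᵥ v) (c : ℝ)
    (hw : g *ᵥ w = c • w) : ∃ c' : ℝ, w = c' • v := by
  have hne : g ≠ g' := by
    intro h
    rw [← h] at hgg
    apply hg1
    have h2 : (g - 1) * (g - 1) = -((2:ℝ) • (g - 1)) := by
      rw [sub_mul, mul_sub, hgg, two_smul]; simp; abel
    have h3 : 2 * ‖g - 1‖ ≤ ‖g - 1‖ * ‖g - 1‖ := by
      have := norm_mul_le (g - 1) (g - 1)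
      rw [h2, norm_neg, norm_smul] at this
      simpa using this
    have h4 : ‖g - 1‖ = 0 := by nlinarith [norm_nonneg (g - 1)]
    exact sub_eq_zero.mp (norm_eq_zero.mp h4)
  by_cases hw0 : w = 0
  · exact ⟨0, by rw [hw0, zero_smul]⟩
  have hc1 : |c - 1| < 1 := by
    have h1 : (g - 1) *ᵥ w = (c - 1) • w := by
      rw [Matrix.sub_mulVec, hw, Matrix.one_mulVec, sub_smul, one_smul]
    have h2 := Matrix.linfty_opNorm_mulVec (g - 1) w
    rw [h1, norm_smul, Real.norm_eq_abs] at h2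
    have h3 : 0 < ‖w‖ := norm_pos_iff.mpr hw0
    have := le_of_mul_le_mul_right h2 h3
    linarith
  by_cases hc : c = 1
  · rw [hc, one_smul] at hw
    exact ker_one S g g' hS hg hgg hne v w hv0 hv hw
  have h1 := form_pres S g hpres w w
  rw [hw, Matrix.mulVec_smul, smul_dotProduct, dotProduct_smul, smul_eq_mul, smul_eq_mul] at h1
  have hww : w ⬝ᵥ S *ᵥ w = 0 := by
    have : (c * c - 1) * (w ⬝ᵥ S *ᵥ w) = 0 := by linarith
    rcases mul_eq_zero.mp this with h | h
    · exfalso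
      have hc2 : (c - 1) * (c + 1) = 0 := by linarith
      rcases mul_eq_zero.mp hc2 with h | h
      · exact hc (by linarith)
      · rw [show c = -1 by linarith] at hc1
        norm_num at hc1
    · exact h
  have h2 := form_pres S g hpres v w
  rw [hw, hv, Matrix.mulVec_smul, dotProduct_smul, smul_eq_mul] at h2
  have hvw0 : v ⬝ᵥ S *ᵥ w = 0 := by
    have : (c - 1) * (v ⬝ᵥ S *ᵥ w) = 0 := by linarith
    rcases mul_eq_zero.mp this with h | h
    · exact absurd (by linarith) hc
    · exact h
  exact hS.null v w hv0 (hvw ▸ hww) hww hvw0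

end Mess

open scoped commutatorElement

namespace Mess

open scoped Matrix Matrix.Norms.Operator

lemma inv_norm_le (g g' : M3) (h : g * g' = 1) (hg : ‖g - 1‖ ≤ 1 / 16) : ‖g'‖ ≤ 16 / 15 := by
  have e : g' = 1 - (g - 1) * g' := by rw [sub_mul, h]; simp
  have h1 : ‖g'‖ ≤ ‖(1 : M3)‖ + ‖g - 1‖ * ‖g'‖ := by
    conv_lhs => rw [e]
    exact (norm_sub_le _ _).trans (add_le_add le_rfl (norm_mul_le _ _))
  rw [norm_one] at h1
  nlinarith [norm_nonneg g']

lemma norm_le_of_near (g : M3) (hg : ‖g - 1‖ ≤ 1 / 16) : ‖g‖ ≤ 17 / 16 := by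
  have e : g = (g - 1) + 1 := by simp
  have h1 : ‖g‖ ≤ ‖g - 1‖ + ‖(1 : M3)‖ := by
    conv_lhs => rw [e]
    exact norm_add_le _ _
  rw [norm_one] at h1
  linarith

lemma comm_near (g g' h h' : M3) (hg : g * g' = 1) (hh : h * h' = 1) (ag : ‖g - 1‖ ≤ 1 / 16)
    (ah : ‖h - 1‖ ≤ 1 / 16) : ‖g * h * g' * h' - 1‖ ≤ ‖h - 1‖ / 2 := by
  have e : g * h * g' * h' - 1 = ((g - 1) * (h - 1) - (h - 1) * (g - 1)) * (g' * h') := by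
    have : (g - 1) * (h - 1) - (h - 1) * (g - 1) = g * h - h * g := by noncomm_ring
    rw [this, sub_mul]
    congr 1
    · simp only [mul_assoc]
    · rw [mul_assoc, ← mul_assoc g, hg, one_mul, hh]
  rw [e]
  have h1 := inv_norm_le g g' hg ag
  have h2 := inv_norm_le h h' hh ah
  have h3 : ‖(g - 1) * (h - 1) - (h - 1) * (g - 1)‖ ≤ ‖h - 1‖ / 8 := by
    refine (norm_sub_le _ _).trans ?_
    have a := norm_mul_le (g - 1) (h - 1)
    have b := norm_mul_le (h - 1) (g - 1)
    nlinarith [norm_nonneg (h - 1)]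
  have h4 : ‖g' * h'‖ ≤ 4 := by
    refine (norm_mul_le _ _).trans ?_
    nlinarith [norm_nonneg g', norm_nonneg h']
  calc _ ≤ _ := norm_mul_le _ _
    _ ≤ (‖h - 1‖ / 8) * 4 := mul_le_mul h3 h4 (norm_nonneg _) (by positivity)
    _ = _ := by ring

variable {Γ : Type} [Group Γ]

/-- iterated commutators -/
def cs (γ η : Γ) : ℕ → Γ
  | 0 => η
  | n + 1 => ⁅γ, cs γ η n⁆

namespace PA

variable (p : PA Γ)

lemma L_mul' (γ δ : Γ) : p.L (γ * δ) = p.L γ * p.L δ := map_mul _ _ _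

lemma L_comm (γ η : Γ) : p.L ⁅γ, η⁆ = p.L γ * p.L η * p.L γ⁻¹ * p.L η⁻¹ := by
  rw [commutatorElement_def, map_mul, map_mul, map_mul]

lemma u_comm (γ η : Γ) : p.u ⁅γ, η⁆ =
    (1 - p.L γ * p.L η * p.L γ⁻¹) *ᵥ p.u γ + (p.L γ - p.L ⁅γ, η⁆) *ᵥ p.u η := by
  rw [L_comm, commutatorElement_def, p.hu, p.hu, p.hu, p.u_inv, p.u_inv, map_mul, map_mul, map_mul]
  simp only [Matrix.sub_mulVec, Matrix.mulVec_neg, Matrix.mulVec_mulVec, Matrix.one_mulVec]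
  abel

lemma cs_near (γ η : Γ) (h1 : ‖p.L γ - 1‖ ≤ 1 / 16) (h2 : ‖p.L η - 1‖ ≤ 1 / 16) (n : ℕ) :
    ‖p.L (cs γ η n) - 1‖ ≤ 1 / 16 ∧ ‖p.L (cs γ η (n+1)) - 1‖ ≤ ‖p.L (cs γ η n) - 1‖ / 2 := by
  have key : ∀ δ, ‖p.L δ - 1‖ ≤ 1 / 16 → ‖p.L ⁅γ, δ⁆ - 1‖ ≤ ‖p.L δ - 1‖ / 2 := by
    intro δ hδ
    rw [L_comm]
    exact comm_near _ _ _ _ (p.L_mul_inv γ) (p.L_mul_inv δ) h1 hδ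
  induction n with
  | zero => exact ⟨h2, key _ h2⟩
  | succ n ih =>
    have : ‖p.L (cs γ η (n+1)) - 1‖ ≤ 1 / 16 := by
      have := ih.2
      linarith [ih.1, norm_nonneg (p.L (cs γ η n) - 1)]
    exact ⟨this, key _ this⟩

lemma lemZ (γ η : Γ) (h1 : ‖p.L γ - 1‖ ≤ 1 / 16) (h2 : ‖p.L η - 1‖ ≤ 1 / 16) :
    ∃ n, p.L (cs γ η n) = 1 := by
  have hu : ∀ n, ‖p.u (cs γ η n)‖ ≤ max ‖p.u γ‖ ‖p.u η‖ := by
    intro n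
    induction n with
    | zero => exact le_max_right _ _
    | succ n ih =>
      set R := max ‖p.u γ‖ ‖p.u η‖
      have hγ : ‖p.u γ‖ ≤ R := le_max_left _ _
      have hR : 0 ≤ R := (norm_nonneg _).trans hγ
      obtain ⟨a1, a2⟩ := p.cs_near γ η h1 h2 n
      set h := cs γ η n
      have e : cs γ η (n+1) = ⁅γ, h⁆ := rfl
      rw [e] at a2 ⊢
      rw [u_comm]
      have b1 : ‖1 - p.L γ * p.L h * p.L γ⁻¹‖ ≤ 1 / 2 := by
        have : 1 - p.L γ * p.L h * p.L γ⁻¹ = - (p.L γ * (p.L h - 1) * p.L γ⁻¹) := by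
          rw [mul_sub, sub_mul, mul_one, p.L_mul_inv γ]; simp
        rw [this, norm_neg]
        have c1 := norm_le_of_near _ h1
        have c2 := inv_norm_le _ _ (p.L_mul_inv γ) h1
        calc _ ≤ _ := norm_mul_le _ _
          _ ≤ (‖p.L γ‖ * ‖p.L h - 1‖) * ‖p.L γ⁻¹‖ := by gcongr; exact norm_mul_le _ _
          _ ≤ (17 / 16 * (1 / 16)) * (16 / 15) := by gcongr
          _ ≤ 1 / 2 := by norm_num
      have b2 : ‖p.L γ - p.L ⁅γ, h⁆‖ ≤ 1 / 2 := by
        have : p.L γ - p.L ⁅γ, h⁆ = (p.L γ - 1) - (p.L ⁅γ, h⁆ - 1) := by abel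
        rw [this]
        refine (norm_sub_le _ _).trans ?_
        linarith
      calc _ ≤ _ := norm_add_le _ _
        _ ≤ 1 / 2 * R + 1 / 2 * R := by
          gcongr
          · exact (Matrix.linfty_opNorm_mulVec _ _).trans (by gcongr)
          · exact (Matrix.linfty_opNorm_mulVec _ _).trans (by gcongr)
        _ = R := by ring
  obtain ⟨m, n, hmn, he⟩ := p.finite_of_bdd (cs γ η) (fun _ => 0) (max ‖p.u γ‖ ‖p.u η‖)
    (fun n => by simp) (fun n => by rw [act_def]; simpa using hu n)
  refine ⟨m, ?_⟩
  have hd : ∀ k, ‖p.L (cs γ η (m+k+1)) - 1‖ ≤ ‖p.L (cs γ η m) - 1‖ / 2 := by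
    intro k
    induction k with
    | zero => exact (p.cs_near γ η h1 h2 m).2
    | succ k ih =>
      have := (p.cs_near γ η h1 h2 (m+k+1)).2
      have h3 := norm_nonneg (p.L (cs γ η (m+k+1)) - 1)
      rw [show m + (k+1) + 1 = m + k + 1 + 1 by ring]
      linarith
  have := hd (n - m - 1)
  rw [show m + (n - m - 1) + 1 = n by omega, ← he] at this
  have h0 : ‖p.L (cs γ η m) - 1‖ = 0 := by linarith [norm_nonneg (p.L (cs γ η m) - 1)]
  exact sub_eq_zero.mp (norm_eq_zero.mp h0)

lemma act_line_inv (γ : Γ) (v : V3) (hv : v ≠ 0) (c : ℝ) (h : p.L γ *ᵥ v = c • v) :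
    c ≠ 0 ∧ p.L γ⁻¹ *ᵥ v = c⁻¹ • v := by
  have h2 : v = c • p.L γ⁻¹ *ᵥ v := by
    rw [← Matrix.mulVec_smul, ← h, Matrix.mulVec_mulVec, p.L_inv_mul γ, Matrix.one_mulVec]
  have hc : c ≠ 0 := by rintro rfl; rw [zero_smul] at h2; exact hv h2
  refine ⟨hc, ?_⟩
  conv_rhs => rw [h2]
  rw [smul_smul, inv_mul_cancel₀ hc, one_smul]

variable {S : M3}

lemma star (hS : FormOK S) (hp : ∀ γ, (p.L γ)ᵀ * S * p.L γ = S) (γ : Γ) (h1 : ‖p.L γ - 1‖ ≤ 1 / 16)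
    (hne : p.L γ ≠ 1) (v w : V3) (hv0 : v ≠ 0) (hv : p.L γ *ᵥ v = v)
    (hvw : w ⬝ᵥ S *ᵥ w = v ⬝ᵥ S *ᵥ v) (c : ℝ)
    (hw : p.L γ *ᵥ w = c • w) : ∃ c' : ℝ, w = c' • v :=
  star_lem S (p.L γ) (p.L γ⁻¹) hS (hp γ) ((p.form_eq_inv S γ).mp (hp γ)) (p.L_inv_mul γ) hne
    (by linarith) v w hv0 hv hvw c hw

lemma lemZ' (hS : FormOK S) (hp : ∀ γ, (p.L γ)ᵀ * S * p.L γ = S) (γ η : Γ)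
    (h1 : ‖p.L γ - 1‖ ≤ 1 / 16) (h2 : ‖p.L η - 1‖ ≤ 1 / 16) (hne : p.L γ ≠ 1) (v : V3) (hv0 : v ≠ 0)
    (hv : p.L γ *ᵥ v = v) : ∃ c : ℝ, p.L η *ᵥ v = c • v := by
  obtain ⟨n, hn⟩ := p.lemZ γ η h1 h2
  have hn' : ∃ c : ℝ, p.L (cs γ η n) *ᵥ v = c • v := ⟨1, by rw [hn, Matrix.one_mulVec, one_smul]⟩
  clear hn
  induction n with
  | zero => exact hn'
  | succ n ih =>
    apply ih
    obtain ⟨c, hc⟩ := hn'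
    obtain ⟨hc0, -⟩ := p.act_line_inv _ v hv0 c hc
    set h := cs γ η n
    have e : cs γ η (n+1) = ⁅γ, h⁆ := rfl
    rw [e, L_comm] at hc
    have hγv : p.L γ⁻¹ *ᵥ v = v := by
      conv_lhs => rw [← hv]
      rw [Matrix.mulVec_mulVec, p.L_inv_mul γ, Matrix.one_mulVec]
    have k := congrArg (fun x => p.L γ *ᵥ (p.L h⁻¹ *ᵥ (p.L γ⁻¹ *ᵥ x))) hc
    simp only [Matrix.mulVec_smul, hγv] at k
    simp only [Matrix.mulVec_mulVec, ← mul_assoc] at k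
    have k2 : p.L γ * p.L h⁻¹ * p.L γ⁻¹ * p.L γ * p.L h * p.L γ⁻¹ * p.L h⁻¹ = p.L h⁻¹ := by
      simp only [← L_mul']
      congr 1
      group
    rw [k2] at k
    obtain ⟨c', hc'⟩ := p.star hS hp γ h1 hne v (p.L h⁻¹ *ᵥ v) hv0 hv (form_pres S _ (hp _) _ _) c⁻¹ (by
      conv_rhs => rw [k]
      rw [smul_smul, inv_mul_cancel₀ hc0, one_smul, Matrix.mulVec_mulVec])
    obtain ⟨-, h5⟩ := p.act_line_inv _ v hv0 c' hc'
    rw [inv_inv] at h5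
    exact ⟨_, h5⟩

lemma line_closure (S0 : Set Γ) (hS0 : Subgroup.closure S0 = ⊤) (v : V3) (hv0 : v ≠ 0)
    (h : ∀ δ ∈ S0, ∃ c : ℝ, p.L δ *ᵥ v = c • v) (γ : Γ) : ∃ c : ℝ, p.L γ *ᵥ v = c • v := by
  have hγ : γ ∈ Subgroup.closure S0 := by rw [hS0]; trivial
  induction hγ using Subgroup.closure_induction with
  | mem x hx => exact h x hx
  | one => exact ⟨1, by rw [map_one, Matrix.one_mulVec, one_smul]⟩
  | mul x y _ _ hx hy =>
    obtain ⟨c, hc⟩ := hx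
    obtain ⟨d, hd⟩ := hy
    exact ⟨d * c, by rw [map_mul, ← Matrix.mulVec_mulVec, hd, Matrix.mulVec_smul, hc, smul_smul]⟩
  | inv x _ hx =>
    obtain ⟨c, hc⟩ := hx
    exact ⟨_, (p.act_line_inv x v hv0 c hc).2⟩

lemma discrete (hS : FormOK S) (hp : ∀ γ, (p.L γ)ᵀ * S * p.L γ = S)
    (H2 : ∀ k, ¬ (derivedSeries Γ k : Set Γ).Finite)
    (a : Γ →* Multiplicative ℤ) (δ₀ : Γ) (hδ : a δ₀ = Multiplicative.ofAdd 1)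
    (S0 : Finset Γ) (hS0 : Subgroup.closure (S0 : Set Γ) = ⊤) :
    ∃ ε : ℝ, 0 < ε ∧ ∀ γ, ‖p.L γ - 1‖ < ε → p.L γ = 1 := by
  set M : ℝ := ∑ δ ∈ S0, ‖p.L δ‖ * ‖p.L δ⁻¹‖ with hM
  have hM0 : 0 ≤ M := Finset.sum_nonneg (fun i _ => by positivity)
  refine ⟨1 / (16 * (M + 1)), by positivity, ?_⟩
  intro γ hγ
  by_contra hne
  have hγM : (M + 1) * ‖p.L γ - 1‖ ≤ 1 / 16 := by
    rw [lt_div_iff₀ (by positivity)] at hγ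
    linarith
  have hγ16 : ‖p.L γ - 1‖ ≤ 1 / 16 := by nlinarith [norm_nonneg (p.L γ - 1)]
  obtain ⟨v, hv0, hv⟩ := Matrix.exists_mulVec_eq_zero_iff.mpr (p.det_sub_one_zero a δ₀ hδ γ)
  have hv : p.L γ *ᵥ v = v := by
    rw [Matrix.sub_mulVec, Matrix.one_mulVec] at hv
    exact sub_eq_zero.mp hv
  have hall := p.line_closure S0 hS0 v hv0 (by
    intro δ hδS
    have hle : ‖p.L δ‖ * ‖p.L δ⁻¹‖ ≤ M :=
      Finset.single_le_sum (f := fun δ => ‖p.L δ‖ * ‖p.L δ⁻¹‖) (fun i _ => by positivity) hδS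
    have e : p.L (δ * γ * δ⁻¹) - 1 = p.L δ * (p.L γ - 1) * p.L δ⁻¹ := by
      rw [map_mul, map_mul, mul_sub, sub_mul, mul_one, p.L_mul_inv δ]
    have hn1 : ‖p.L (δ * γ * δ⁻¹) - 1‖ ≤ 1 / 16 := by
      rw [e]
      calc _ ≤ _ := norm_mul_le _ _
        _ ≤ (‖p.L δ‖ * ‖p.L γ - 1‖) * ‖p.L δ⁻¹‖ := by gcongr; exact norm_mul_le _ _
        _ = (‖p.L δ‖ * ‖p.L δ⁻¹‖) * ‖p.L γ - 1‖ := by ring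
        _ ≤ (M + 1) * ‖p.L γ - 1‖ := by gcongr; linarith
        _ ≤ _ := hγM
    have hne' : p.L (δ * γ * δ⁻¹) ≠ 1 := by
      intro h
      apply hne
      have : γ = δ⁻¹ * (δ * γ * δ⁻¹) * δ := by group
      rw [this, map_mul, map_mul, h, mul_one, p.L_inv_mul]
    have hw0 : p.L δ *ᵥ v ≠ 0 := by
      intro h
      apply hv0
      rw [← Matrix.one_mulVec v, ← p.L_inv_mul δ, ← Matrix.mulVec_mulVec, h, Matrix.mulVec_zero]
    obtain ⟨c, hc⟩ := p.lemZ' hS hp (δ * γ * δ⁻¹) γ hn1 hγ16 hne' (p.L δ *ᵥ v) hw0 (by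
      rw [Matrix.mulVec_mulVec, ← map_mul, inv_mul_cancel_right, map_mul, ← Matrix.mulVec_mulVec, hv])
    exact p.star hS hp γ hγ16 hne v _ hv0 hv (form_pres S _ (hp _) _ _) c hc)
  exact p.irr_line H2 v hv0 (fun γ _ => hall γ)

end PA
end Mess

open scoped commutatorElement

namespace Mess

open scoped Matrix Matrix.Norms.Operator
open Filter Topology

lemma norm_le_of_entries (A : M3) (c : ℝ) (hc : 0 ≤ c) (h : ∀ i j, |A i j| ≤ c) : ‖A‖ ≤ 3 * c := by
  rw [Matrix.linfty_opNorm_def]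
  have : ∀ i, ∑ j, ‖A i j‖₊ ≤ (⟨3 * c, by positivity⟩ : NNReal) := by
    intro i
    refine NNReal.coe_le_coe.mp ?_
    rw [NNReal.coe_sum, Fin.sum_univ_three]
    simp only [coe_nnnorm, Real.norm_eq_abs]
    have h0 := h i 0
    have h1 := h i 1
    have h2 := h i 2
    show |A i 0| + |A i 1| + |A i 2| ≤ 3 * c
    linarith
  have h2 : (Finset.univ.sup fun i : Fin 3 => ∑ j, ‖A i j‖₊) ≤ (⟨3 * c, by positivity⟩ : NNReal) :=
    Finset.sup_le (fun i _ => this i)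
  exact NNReal.coe_le_coe.mpr h2

lemma entry_le_norm (A : M3) (i j : Fin 3) : |A i j| ≤ ‖A‖ := by
  rw [Matrix.linfty_opNorm_def]
  have h1 : ‖A i j‖₊ ≤ ∑ j, ‖A i j‖₊ :=
    Finset.single_le_sum (f := fun j => ‖A i j‖₊) (fun _ _ => bot_le) (Finset.mem_univ j)
  have h2 : ∑ j, ‖A i j‖₊ ≤ Finset.univ.sup fun i : Fin 3 => ∑ j, ‖A i j‖₊ :=
    Finset.le_sup (f := fun i : Fin 3 => ∑ j, ‖A i j‖₊) (Finset.mem_univ i)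
  have := NNReal.coe_le_coe.mpr (h1.trans h2)
  simpa using this

lemma norm_transpose_le (A : M3) : ‖Aᵀ‖ ≤ 3 * ‖A‖ :=
  norm_le_of_entries _ _ (norm_nonneg _) (fun i j => entry_le_norm A j i)

namespace PA
variable {Γ : Type} [Group Γ] (p : PA Γ) {S : M3}

lemma L_inv_eq (hS : FormOK S) (hp : ∀ γ, (p.L γ)ᵀ * S * p.L γ = S) (γ : Γ) :
    p.L γ⁻¹ = S * (p.L γ)ᵀ * S := by
  have h := (p.form_eq_inv S γ).mp (hp γ)
  have h2 := congrArg (fun X => (X * S)ᵀ) h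
  simp only [Matrix.mul_assoc, hS.sq, Matrix.mul_one] at h2
  rw [Matrix.transpose_mul, Matrix.transpose_mul, Matrix.transpose_transpose, hS.symm] at h2
  exact h2.symm

lemma L_eq_of_bdd (hS : FormOK S) (hp : ∀ γ, (p.L γ)ᵀ * S * p.L γ = S)
    (ε : ℝ) (hε : 0 < ε) (hd : ∀ γ, ‖p.L γ - 1‖ < ε → p.L γ = 1)
    (f : ℕ → Γ) (R : ℝ) (hf : ∀ n, ‖p.L (f n)‖ ≤ R) : ∃ m n, m < n ∧ p.L (f m) = p.L (f n) := by
  obtain ⟨A, -, φ, hφ, hlim⟩ := tendsto_subseq_of_bounded (s := Metric.closedBall (0 : M3) R)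
    Metric.isBounded_closedBall (x := fun n => p.L (f n)) (fun n => by simpa using hf n)
  have hlim' : Tendsto (fun n => p.L (f (φ (n+1)))) atTop (𝓝 A) :=
    hlim.comp (tendsto_add_atTop_nat 1)
  have hinv : Tendsto (fun n => p.L (f (φ n))⁻¹) atTop (𝓝 (S * Aᵀ * S)) := by
    have hc : Continuous (fun X : M3 => S * Xᵀ * S) := by fun_prop
    have := (hc.tendsto A).comp hlim
    refine this.congr ?_
    intro n
    exact (p.L_inv_eq hS hp _).symm
  have h1 : S * Aᵀ * S * A = 1 := by
    have := hinv.mul hlim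
    refine tendsto_nhds_unique this ?_
    refine tendsto_const_nhds.congr ?_
    intro n
    exact (p.L_inv_mul _).symm
  have h2 := hinv.mul hlim'
  rw [h1] at h2
  have h3 := (Metric.tendsto_nhds.mp h2 ε hε).exists
  obtain ⟨n, hn⟩ := h3
  rw [dist_eq_norm, ← map_mul] at hn
  refine ⟨φ n, φ (n+1), hφ (Nat.lt_succ_self n), ?_⟩
  have h4 := hd _ hn
  rw [map_mul] at h4
  have := congrArg (fun X => p.L (f (φ n)) * X) h4
  simp only [← mul_assoc, p.L_mul_inv, one_mul, mul_one] at this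
  exact this.symm

lemma range_finite (hS : FormOK S) (hp : ∀ γ, (p.L γ)ᵀ * S * p.L γ = S)
    (ε : ℝ) (hε : 0 < ε) (hd : ∀ γ, ‖p.L γ - 1‖ < ε → p.L γ = 1) (R : ℝ) :
    (p.L '' {γ | ‖p.L γ‖ ≤ R}).Finite := by
  by_contra hinf
  have hinf : (p.L '' {γ | ‖p.L γ‖ ≤ R}).Infinite := hinf
  set e := hinf.natEmbedding
  have hch : ∀ n, ∃ γ, ‖p.L γ‖ ≤ R ∧ p.L γ = (e n : M3) := by
    intro n
    obtain ⟨γ, h1, h2⟩ := (e n).2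
    exact ⟨γ, h1, h2⟩
  choose f hf hfe using hch
  obtain ⟨m, n, hmn, he⟩ := p.L_eq_of_bdd hS hp ε hε hd f R hf
  rw [hfe, hfe] at he
  have := e.injective (Subtype.ext he)
  omega

lemma u_conj (γ δ : Γ) (hδ : p.L δ = 1) : p.u (γ * δ * γ⁻¹) = p.L γ *ᵥ p.u δ := by
  rw [p.hu, p.hu, p.u_inv, map_mul, hδ, mul_one, Matrix.mulVec_neg, Matrix.mulVec_mulVec,
    p.L_mul_inv, Matrix.one_mulVec]
  abel

lemma range_finite_of_trans (H2 : ∀ k, ¬ (derivedSeries Γ k : Set Γ).Finite)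
    (δ₁ : Γ) (h1 : p.L δ₁ = 1) (h1' : p.u δ₁ ≠ 0) : (Set.range p.L).Finite := by
  set T : Set V3 := {x | ∃ δ, p.L δ = 1 ∧ p.u δ = x} with hT
  have hspan : Submodule.span ℝ T = ⊤ := by
    rcases p.irr H2 (Submodule.span ℝ T) (by
      intro γ _ x hx
      induction hx using Submodule.span_induction with
      | mem x hx =>
        obtain ⟨δ, hδ, rfl⟩ := hx
        apply Submodule.subset_span
        refine ⟨γ * δ * γ⁻¹, ?_, p.u_conj γ δ hδ⟩
        rw [map_mul, map_mul, hδ, mul_one, p.L_mul_inv]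
      | zero => rw [Matrix.mulVec_zero]; exact zero_mem _
      | add x y _ _ hx hy => rw [Matrix.mulVec_add]; exact add_mem hx hy
      | smul c x _ hx => rw [Matrix.mulVec_smul]; exact Submodule.smul_mem _ _ hx) with h | h
    · exfalso
      apply h1'
      have : p.u δ₁ ∈ Submodule.span ℝ T := Submodule.subset_span ⟨δ₁, h1, rfl⟩
      rw [h] at this
      simpa using this
    · exact h
  set b := Module.Basis.ofSpan hspan.ge with hb
  have hbT : Set.range b ⊆ T := Module.Basis.ofSpan_subset hspan.ge
  haveI := FiniteDimensional.fintypeBasisIndex b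
  have hz : ∀ x ∈ Submodule.span ℤ (Set.range b), x ∈ T := by
    intro x hx
    have : Submodule.span ℤ (Set.range b) ≤
      AddSubgroup.toIntSubmodule
      { carrier := T
        zero_mem' := ⟨1, map_one _, p.u_one⟩
        add_mem' := by
          rintro x y ⟨δ, hδ, rfl⟩ ⟨δ', hδ', rfl⟩
          refine ⟨δ * δ', ?_, ?_⟩
          · rw [map_mul, hδ, hδ', one_mul]
          · rw [p.hu, hδ, Matrix.one_mulVec]
        neg_mem' := by
          rintro x ⟨δ, hδ, rfl⟩
          have h0 : p.L δ⁻¹ = 1 := by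
            have := p.L_inv_mul δ
            rwa [hδ, mul_one] at this
          refine ⟨δ⁻¹, h0, ?_⟩
          rw [p.u_inv, h0, Matrix.one_mulVec] } := by
      rw [Submodule.span_le]
      exact hbT
    exact this hx
  set C := ∑ i, ‖b i‖
  refine ((p.proper C).image p.L).subset ?_
  rintro _ ⟨γ, rfl⟩
  obtain ⟨τ, hτ, hτ'⟩ := hz _ (ZSpan.floor b (- p.u γ)).2
  refine ⟨τ * γ, ⟨0, ?_, ?_⟩, ?_⟩
  · rw [norm_zero]; exact Finset.sum_nonneg (fun i _ => norm_nonneg _)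
  · rw [Matrix.mulVec_zero, zero_add, p.hu, hτ, Matrix.one_mulVec, hτ']
    have := ZSpan.norm_fract_le b (- p.u γ)
    rw [ZSpan.fract_apply] at this
    rw [← norm_neg]
    rw [neg_add, add_comm, ← sub_eq_add_neg]
    exact this
  · rw [map_mul, hτ, one_mul]

lemma ker_trivial (H2 : ∀ k, ¬ (derivedSeries Γ k : Set Γ).Finite)
    (H3 : ∀ m : ℕ, 1 ≤ m → ∃ x y : Γ, ∀ n : ℕ, 1 ≤ n → ⁅x^m, y^m⁆^n ≠ 1)
    (δ : Γ) (hδ : p.L δ = 1) : p.u δ = 0 := by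
  by_contra hne
  have hfin := p.range_finite_of_trans H2 δ hδ hne
  have hK : (p.L.toHomUnits).ker.index ≠ 0 := by
    rw [Subgroup.index_ker]
    have : (Set.range p.L.toHomUnits).Finite := by
      apply Set.Finite.of_finite_image (f := fun x : M3ˣ => (x : M3))
      · refine hfin.subset ?_
        rintro _ ⟨_, ⟨γ, rfl⟩, rfl⟩
        exact ⟨γ, rfl⟩
      · intro x _ y _ h
        exact Units.ext h
    have : Finite p.L.toHomUnits.range := this.to_subtype
    exact Nat.card_pos.ne'
  obtain ⟨x, y, hxy⟩ := H3 _ (Nat.one_le_iff_ne_zero.mpr hK)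
  have hker : ∀ z, p.L (z ^ (p.L.toHomUnits).ker.index) = 1 := by
    intro z
    have := Subgroup.pow_index_mem (p.L.toHomUnits).ker z
    rw [MonoidHom.mem_ker] at this
    have := congrArg Units.val this
    simpa using this
  set m := (p.L.toHomUnits).ker.index
  have hinv : ∀ z, p.L z = 1 → p.L z⁻¹ = 1 := by
    intro z hz
    have := p.L_inv_mul z
    rwa [hz, mul_one] at this
  have hu : p.u ⁅x^m, y^m⁆ = 0 := by
    rw [p.u_comm, p.L_comm, hinv _ (hker x), hinv _ (hker y), hker x, hker y]
    simp
  obtain ⟨n, hn, hn'⟩ := p.finite_order_of_fixed ⁅x^m, y^m⁆ 0 (by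
    rw [act_def, hu, Matrix.mulVec_zero, zero_add])
  exact hxy n hn hn'

lemma L_proper (hS : FormOK S) (hp : ∀ γ, (p.L γ)ᵀ * S * p.L γ = S)
    (H2 : ∀ k, ¬ (derivedSeries Γ k : Set Γ).Finite)
    (H3 : ∀ m : ℕ, 1 ≤ m → ∃ x y : Γ, ∀ n : ℕ, 1 ≤ n → ⁅x^m, y^m⁆^n ≠ 1)
    (a : Γ →* Multiplicative ℤ) (δ₀ : Γ) (hδ : a δ₀ = Multiplicative.ofAdd 1)
    (S0 : Finset Γ) (hS0 : Subgroup.closure (S0 : Set Γ) = ⊤) (R : ℝ) :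
    {γ | ‖p.L γ‖ ≤ R}.Finite := by
  obtain ⟨ε, hε, hd⟩ := p.discrete hS hp H2 a δ₀ hδ S0 hS0
  apply Set.Finite.of_finite_fibers p.L (p.range_finite hS hp ε hε hd R)
  rintro _ ⟨γ, -, rfl⟩
  have hK : {δ | p.L δ = 1}.Finite := by
    refine (p.proper 0).subset ?_
    intro δ hδ
    refine ⟨0, by simp, ?_⟩
    rw [p.ker_trivial H2 H3 δ hδ]
    simp
  refine (hK.image (fun δ => γ * δ)).subset ?_
  rintro γ' ⟨-, h⟩
  have h : p.L γ' = p.L γ := h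
  refine ⟨γ⁻¹ * γ', ?_, by group⟩
  show p.L _ = 1
  rw [map_mul, h, p.L_inv_mul]

theorem reduce (p : PA Γ) (H2 : ∀ k, ¬ (derivedSeries Γ k : Set Γ).Finite)
    (H3 : ∀ m : ℕ, 1 ≤ m → ∃ x y : Γ, ∀ n : ℕ, 1 ≤ n → ⁅x^m, y^m⁆^n ≠ 1)
    (a : Γ →* Multiplicative ℤ) (δ₀ : Γ) (hδ : a δ₀ = Multiplicative.ofAdd 1)
    (S0 : Finset Γ) (hS0 : Subgroup.closure (S0 : Set Γ) = ⊤) :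
    ∃ q : PA Γ, (∀ γ, (q.L γ)ᵀ * J * q.L γ = J) ∧ (∀ γ, (q.L γ).det = 1) ∧
      ∀ R : ℝ, {γ | ‖q.L γ‖ ≤ R}.Finite := by
  obtain ⟨q, h1 | h1, h2⟩ := p.normalize H2 a δ₀ hδ
  · exfalso
    have hf := q.L_proper formOK_one h1 H2 H3 a δ₀ hδ S0 hS0 3
    apply H2 0
    refine Set.Finite.subset hf ?_
    intro γ _
    have h3 := h1 γ
    rw [mul_one] at h3
    have := norm_le_of_entries (q.L γ) 1 zero_le_one (by
      intro i j
      have h4 := congrFun (congrFun h3 j) j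
      rw [mul_fin_three, Matrix.one_apply_eq] at h4
      simp only [Matrix.transpose_apply] at h4
      rw [abs_le_one_iff_mul_self_le_one]
      fin_cases i
      · show q.L γ 0 j * q.L γ 0 j ≤ 1
        nlinarith [mul_self_nonneg (q.L γ 1 j), mul_self_nonneg (q.L γ 2 j)]
      · show q.L γ 1 j * q.L γ 1 j ≤ 1
        nlinarith [mul_self_nonneg (q.L γ 0 j), mul_self_nonneg (q.L γ 2 j)]
      · show q.L γ 2 j * q.L γ 2 j ≤ 1
        nlinarith [mul_self_nonneg (q.L γ 1 j), mul_self_nonneg (q.L γ 0 j)])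
    rw [mul_one] at this
    exact this
  · exact ⟨q, h1, h2, q.L_proper formOK_J h1 H2 H3 a δ₀ hδ S0 hS0⟩

end PA
end Mess

open scoped commutatorElement

namespace Mess

open scoped Matrix Matrix.Norms.Operator
open Filter Topology

/-- the Lorentz form -/
def B (x y : V3) : ℝ := x 1 * y 1 - x 0 * y 2 - x 2 * y 0

/-- time coordinate -/
def T (x : V3) : ℝ := x 0 + x 2

/-- base point -/
def o : V3 := ![1, 0, 1]

lemma B_eq (x y : V3) : x ⬝ᵥ J *ᵥ y = B x y := J_dot x y

lemma B_comm (x y : V3) : B x y = B y x := by unfold B; ring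
lemma B_smul_left (c : ℝ) (x y : V3) : B (c • x) y = c * B x y := by simp [B]; ring
lemma B_smul_right (c : ℝ) (x y : V3) : B x (c • y) = c * B x y := by simp [B]; ring
lemma B_add_left (x x' y : V3) : B (x + x') y = B x y + B x' y := by simp [B]; ring
lemma B_add_right (x y y' : V3) : B x (y + y') = B x y + B x y' := by simp [B]; ring
lemma T_smul (c : ℝ) (x : V3) : T (c • x) = c * T x := by simp [T]; ring
lemma T_add (x y : V3) : T (x + y) = T x + T y := by simp [T]; ring
lemma o_2 : o 2 = 1 := rfl
lemma T_eq (x : V3) : T x = - B o x := by simp [T, B, o]; try ring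
lemma T_o : T o = 2 := by
  show o 0 + o 2 = 2
  rw [o_2]; simp [o]; norm_num
lemma B_oo : B o o = -2 := by simp [B, o]; norm_num
lemma T_sq (x : V3) : x 0 ^ 2 + x 1 ^ 2 + x 2 ^ 2 = T x ^ 2 + B x x := by unfold T B; ring

lemma cont_T : Continuous T := by unfold T; fun_prop
lemma cont_B : Continuous (fun z : V3 × V3 => B z.1 z.2) := by unfold B; fun_prop

lemma B_pres (g : M3) (hg : gᵀ * J * g = J) (x y : V3) : B (g *ᵥ x) (g *ᵥ y) = B x y := by
  rw [← B_eq, ← B_eq, form_pres J g hg]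

lemma B_null (v w : V3) (hv : v ≠ 0) (h1 : B v v = 0) (h2 : B w w = 0) (h3 : B v w = 0) :
    ∃ c : ℝ, w = c • v := by
  simp only [← B_eq] at h1 h2 h3
  exact formOK_J.null v w hv h1 h2 h3

lemma T_ne_of_null (x : V3) (hx : x ≠ 0) (h : B x x ≤ 0) : T x ≠ 0 := by
  intro h0
  have := T_sq x
  rw [h0] at this
  apply hx
  have a0 : x 0 = 0 := by nlinarith [sq_nonneg (x 0), sq_nonneg (x 1), sq_nonneg (x 2)]
  have a1 : x 1 = 0 := by nlinarith [sq_nonneg (x 0), sq_nonneg (x 1), sq_nonneg (x 2)]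
  have a2 : x 2 = 0 := by nlinarith [sq_nonneg (x 0), sq_nonneg (x 1), sq_nonneg (x 2)]
  ext i
  fin_cases i
  · exact a0
  · exact a1
  · exact a2

lemma OJ_inv (h : M3) (hh : hᵀ * J * h = J) : (J * hᵀ * J) * h = 1 ∧ h * (J * hᵀ * J) = 1 := by
  have h1 : (J * hᵀ * J) * h = 1 := by
    rw [Matrix.mul_assoc, Matrix.mul_assoc, ← Matrix.mul_assoc hᵀ, hh, formOK_J.sq]
  exact ⟨h1, mul_eq_one_comm.mp h1⟩

lemma OJ_transpose (h : M3) (hh : hᵀ * J * h = J) : h * J * hᵀ = J := by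
  have h1 := (OJ_inv h hh).2
  have := congrArg (fun X => X * J) h1
  simp only [Matrix.mul_assoc, formOK_J.sq, Matrix.mul_one, Matrix.one_mul] at this
  rw [Matrix.mul_assoc]
  exact this

lemma OJ_frob (h : M3) (hh : hᵀ * J * h = J) :
    (h 0 0)^2 + (h 0 1)^2 + (h 0 2)^2 + ((h 1 0)^2 + (h 1 1)^2 + (h 1 2)^2)
     + ((h 2 0)^2 + (h 2 1)^2 + (h 2 2)^2) = T (h *ᵥ o) ^ 2 - 1 := by
  have h1 := OJ_transpose h hh
  have r : ∀ i, B (h i) (h i) = J i i := by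
    intro i
    have := congrFun (congrFun h1 i) i
    rw [← this, mul_fin_three]
    simp only [mul_fin_three, Matrix.transpose_apply]
    simp [B, J]
    ring
  have e0 := T_sq (h 0)
  have e1 := T_sq (h 1)
  have e2 := T_sq (h 2)
  rw [r] at e0 e1 e2
  have e3 := T_sq (h *ᵥ o)
  rw [B_pres h hh, B_oo] at e3
  have e4 : ∀ i, (h *ᵥ o) i = T (h i) := by
    intro i
    rw [mulVec_fin_three]
    simp [o, T]
  rw [e4, e4, e4] at e3
  have j0 : J 0 0 = 0 := by simp [J]
  have j1 : J 1 1 = 1 := by simp [J]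
  have j2 : J 2 2 = 0 := by simp [J]
  rw [j0] at e0
  rw [j1] at e1
  rw [j2] at e2
  linarith

lemma OJ_norm_le (h : M3) (hh : hᵀ * J * h = J) : ‖h‖ ≤ 3 * |T (h *ᵥ o)| := by
  apply norm_le_of_entries _ _ (abs_nonneg _)
  intro i j
  have := OJ_frob h hh
  apply sq_le_sq.mp
  fin_cases i <;> fin_cases j <;> simp <;>
  nlinarith [sq_nonneg (h 0 0), sq_nonneg (h 0 1), sq_nonneg (h 0 2), sq_nonneg (h 1 0), sq_nonneg (h 1 1), sq_nonneg (h 1 2), sq_nonneg (h 2 0), sq_nonneg (h 2 1), sq_nonneg (h 2 2)]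

lemma T_le_norm (x : V3) : |T x| ≤ 2 * ‖x‖ := by
  have h0 := norm_le_pi_norm x 0
  have h2 := norm_le_pi_norm x 2
  rw [Real.norm_eq_abs] at h0 h2
  exact (abs_add_le _ _).trans (by linarith)

lemma norm_le_three (x : V3) (c : ℝ) (hc : 0 ≤ c) (h0 : |x 0| ≤ c) (h1 : |x 1| ≤ c) (h2 : |x 2| ≤ c) : ‖x‖ ≤ c := by
  rw [pi_norm_le_iff_of_nonneg hc]
  intro i
  fin_cases i
  · exact h0
  · exact h1
  · exact h2

lemma norm_le_T (x : V3) (h : B x x ≤ 0) : ‖x‖ ≤ |T x| := by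
  have := T_sq x
  apply norm_le_three x _ (abs_nonneg _) <;> apply sq_le_sq.mp <;>
  nlinarith [sq_nonneg (x 0), sq_nonneg (x 1), sq_nonneg (x 2)]

namespace PA
variable {Γ : Type} [Group Γ] (q : PA Γ)

lemma B_L (hp : ∀ γ, (q.L γ)ᵀ * J * q.L γ = J) (γ : Γ) (x y : V3) :
    B (q.L γ *ᵥ x) (q.L γ *ᵥ y) = B x y := B_pres _ (hp γ) x y

lemma stepE (hp : ∀ γ, (q.L γ)ᵀ * J * q.L γ = J) (G : Set M3) (hG : ∀ g ∈ G, gᵀ * J * g = J) :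
    (∃ R : ℝ, ∀ g ∈ G, ∃ γ, ‖q.L γ * g‖ ≤ R) ∨
    ∃ v : V3, B v v = 0 ∧ T v = 1 ∧ ∀ δ, 1 / 2 ≤ |T (q.L δ *ᵥ v)| := by
  have hO : ∀ γ, ∀ g ∈ G, (q.L γ * g)ᵀ * J * (q.L γ * g) = J := by
    intro γ g hg
    rw [Matrix.transpose_mul]
    calc gᵀ * (q.L γ)ᵀ * J * (q.L γ * g) = gᵀ * ((q.L γ)ᵀ * J * q.L γ) * g := by
          simp only [Matrix.mul_assoc]
      _ = J := by rw [hp, hG g hg]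
  by_cases hc : ∃ R : ℝ, ∀ g ∈ G, ∃ γ, |T ((q.L γ * g) *ᵥ o)| ≤ R
  · left
    obtain ⟨R, hR⟩ := hc
    refine ⟨3 * R, fun g hg => ?_⟩
    obtain ⟨γ, hγ⟩ := hR g hg
    refine ⟨γ, (OJ_norm_le _ (hO γ g hg)).trans (by linarith)⟩
  · right
    push Not at hc
    have key : ∀ n : ℕ, ∃ x : V3, B x x ≤ 0 ∧ |B x x| ≤ 2 / (n+1) ∧ T x = 1 ∧
        ∀ δ, 1 / 2 ≤ |T (q.L δ *ᵥ x)| := by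
      intro n
      obtain ⟨g, hg, hgn⟩ := hc (n + 1)
      set F : Γ → ℝ := fun γ => |T ((q.L γ * g) *ᵥ o)| with hF
      have hbdd : BddBelow (Set.range F) := ⟨0, by rintro _ ⟨γ, rfl⟩; exact abs_nonneg _⟩
      have hm : (n : ℝ) + 1 ≤ ⨅ γ, F γ := le_ciInf (fun γ => (hgn γ).le)
      have hn : (0:ℝ) < n + 1 := by positivity
      obtain ⟨γ, hγ⟩ := exists_lt_of_ciInf_lt (show ⨅ γ, F γ < 2 * ⨅ γ, F γ by linarith)
      have hmin : ∀ δ, F γ ≤ 2 * F δ := by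
        intro δ
        have := ciInf_le hbdd δ
        linarith
      set x := (q.L γ * g) *ᵥ o with hx
      have hTx : (n:ℝ) + 1 < |T x| := hgn γ
      have hT0 : T x ≠ 0 := by
        intro h; rw [h, abs_zero] at hTx; linarith
      have hTsq : (n + 1 : ℝ) ≤ (T x) ^ 2 := by
        rw [← sq_abs]
        have : (1:ℝ) ≤ n + 1 := by linarith [Nat.cast_nonneg (α := ℝ) n]
        nlinarith
      have hBx : B x x = -2 := by rw [hx, B_pres _ (hO γ g hg), B_oo]
      have hBB : B ((T x)⁻¹ • x) ((T x)⁻¹ • x) = - (2 / (T x) ^ 2) := by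
        rw [B_smul_left, B_smul_right, hBx]; field_simp
      have hpos : 0 < (T x) ^ 2 := by positivity
      refine ⟨(T x)⁻¹ • x, ?_, ?_, ?_, ?_⟩
      · rw [hBB, neg_nonpos]; positivity
      · rw [hBB, abs_neg, abs_of_nonneg (by positivity)]
        gcongr
      · rw [T_smul, inv_mul_cancel₀ hT0]
      · intro δ
        rw [Matrix.mulVec_smul, T_smul, abs_mul, abs_inv]
        have h1 : F (δ * γ) = |T (q.L δ *ᵥ x)| := by
          simp only [hF, hx]
          rw [Matrix.mulVec_mulVec, map_mul, Matrix.mul_assoc]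
        have h2 := hmin (δ * γ)
        rw [h1] at h2
        have h3 : F γ = |T x| := rfl
        rw [h3] at h2
        rw [inv_mul_eq_div, div_le_div_iff₀ (by norm_num) (by positivity)]
        linarith
    choose x hx1 hx2 hx3 hx4 using key
    obtain ⟨v, -, φ, hφ, hlim⟩ := tendsto_subseq_of_bounded (s := Metric.closedBall (0 : V3) 1)
      Metric.isBounded_closedBall (x := x) (fun n => by
        have := norm_le_T (x n) (hx1 n)
        rw [hx3] at this
        simpa using this)
    refine ⟨v, ?_, ?_, ?_⟩
    · have h1 : Tendsto (fun n => B (x (φ n)) (x (φ n))) atTop (𝓝 (B v v)) :=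
        (cont_B.tendsto (v, v)).comp (hlim.prodMk_nhds hlim)
      refine tendsto_nhds_unique h1 ?_
      have h2 : Tendsto (fun n : ℕ => 2 / ((n : ℝ) + 1)) atTop (𝓝 0) := by
        have := (tendsto_one_div_add_atTop_nhds_zero_nat (𝕜 := ℝ)).const_mul 2
        simpa [div_eq_mul_inv] using this
      exact squeeze_zero_norm (fun n => hx2 (φ n)) (h2.comp hφ.tendsto_atTop)
    · have h1 : Tendsto (fun n => T (x (φ n))) atTop (𝓝 (T v)) := (cont_T.tendsto v).comp hlim
      refine tendsto_nhds_unique h1 ?_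
      simp only [hx3]
      exact tendsto_const_nhds
    · intro δ
      have hcont : Continuous (fun y : V3 => |T (q.L δ *ᵥ y)|) :=
        (cont_T.comp (Continuous.matrix_mulVec continuous_const continuous_id)).abs
      exact ge_of_tendsto' ((hcont.tendsto v).comp hlim) (fun n => hx4 (φ n) δ)

end PA
end Mess

open scoped commutatorElement

namespace Mess

open scoped Matrix Matrix.Norms.Operator
open Filter Topology

/-- determinant -/
def D (x y z : V3) : ℝ :=
  x 0 * (y 1 * z 2 - y 2 * z 1) - x 1 * (y 0 * z 2 - y 2 * z 0) + x 2 * (y 0 * z 1 - y 1 * z 0)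

lemma D_smul (a : ℝ) (x y z : V3) : D (a • x) y z = a * D x y z := by simp [D]; ring
lemma D_smul2 (a : ℝ) (x y z : V3) : D x (a • y) z = a * D x y z := by simp [D]; ring
lemma D_smul3 (a : ℝ) (x y z : V3) : D x y (a • z) = a * D x y z := by simp [D]; ring
lemma D_add (x x' y z : V3) : D (x + x') y z = D x y z + D x' y z := by simp [D]; ring
lemma D_gram (x y z : V3) : D x y z ^ 2 =
    - (B x x * (B y y * B z z - B y z ^ 2) - B x y * (B x y * B z z - B y z * B x z)
      + B x z * (B x y * B y z - B y y * B x z)) := by unfold D B; ring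
lemma cont_D : Continuous (fun z : V3 × V3 × V3 => D z.1 z.2.1 z.2.2) := by unfold D; fun_prop

lemma fut_nonneg (x : V3) (h : B x x ≤ 0) (hT : 0 < T x) : 0 ≤ x 0 ∧ 0 ≤ x 2 := by
  unfold B at h
  unfold T at hT
  constructor
  · by_contra h0; push Not at h0
    have : 0 < x 2 := by linarith
    nlinarith [sq_nonneg (x 1), mul_pos_of_neg_of_neg h0 (neg_lt_zero.mpr this)]
  · by_contra h0; push Not at h0
    have : 0 < x 0 := by linarith
    nlinarith [sq_nonneg (x 1), mul_pos_of_neg_of_neg h0 (neg_lt_zero.mpr this)]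

lemma fut_neg (x y : V3) (hx : B x x ≤ 0) (hTx : 0 < T x) (hy : B y y ≤ 0) (hTy : 0 < T y) :
    B x y ≤ 0 := by
  obtain ⟨x0, x2⟩ := fut_nonneg x hx hTx
  obtain ⟨y0, y2⟩ := fut_nonneg y hy hTy
  unfold B at hx hy ⊢
  have h1 : (x 1 * y 1) ^ 2 ≤ (x 0 * y 2 + x 2 * y 0) ^ 2 := by
    have a : x 1 ^ 2 ≤ 2 * (x 0 * x 2) := by nlinarith
    have b : y 1 ^ 2 ≤ 2 * (y 0 * y 2) := by nlinarith
    have c : x 1 ^ 2 * y 1 ^ 2 ≤ 2 * (x 0 * x 2) * (2 * (y 0 * y 2)) :=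
      mul_le_mul a b (sq_nonneg _) (by positivity)
    nlinarith [sq_nonneg (x 0 * y 2 - x 2 * y 0)]
  have h2 := abs_le_of_sq_le_sq h1 (by positivity)
  linarith [(abs_le.mp h2).2]

lemma decomp (z v w : V3) (hv : B v v = 0) (hw : B w w = 0) (hk : B v w ≠ 0) (hD : D z v w = 0) :
    z = (B z w / B v w) • v + (B z v / B v w) • w := by
  set a := B z w / B v w with ha
  set b := B z v / B v w with hb
  set r : V3 := z + ((-a) • v + (-b) • w) with hr
  have r1 : B r v = 0 := by
    rw [hr]
    simp only [B_add_left, B_smul_left, hv, B_comm w v]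
    rw [hb]; field_simp; ring
  have r2 : B r w = 0 := by
    rw [hr]
    simp only [B_add_left, B_smul_left, hw]
    rw [ha]; field_simp; ring
  have rD : D r v w = 0 := by
    rw [hr, D_add, D_add, D_smul, D_smul, hD]
    simp [D]; ring
  have h1 := D_gram r v w
  rw [rD, r1, r2, hv, hw] at h1
  have h2 : B r r * B v w ^ 2 = 0 := by linarith
  have h3 : B r r = 0 := (mul_eq_zero.mp h2).resolve_right (pow_ne_zero 2 hk)
  have hv0 : v ≠ 0 := by rintro rfl; apply hk; simp [B]
  obtain ⟨c, hc⟩ := B_null v r hv0 hv h3 (by rw [B_comm, r1])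
  have h4 : c = 0 := by
    rw [hc, B_smul_left] at r2
    exact (mul_eq_zero.mp r2).resolve_right hk
  rw [h4, zero_smul] at hc
  have : z = r + (a • v + b • w) := by rw [hr]; simp only [neg_smul]; abel
  rw [this, hc, zero_add]

lemma conv_lt (s t a b C : ℝ) (hs : 0 ≤ s) (ht : 0 ≤ t) (hst : s + t = 1) (ha : C < a) (hb : C < b) :
    C < s * a + t * b := by
  have e : C = s * C + t * C := by rw [← add_mul, hst, one_mul]
  rcases lt_or_eq_of_le hs with h | h
  · have h1 : s * C < s * a := mul_lt_mul_of_pos_left ha h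
    have h2 : t * C ≤ t * b := mul_le_mul_of_nonneg_left hb.le ht
    linarith
  · rw [← h] at hst ⊢
    rw [show t = 1 by linarith]; linarith

set_option maxHeartbeats 1000000 in
lemma cross_bound (p q v w : V3) (hp : B p p = -2) (hq : B q q = -2) (hTp : 0 < T p) (hTq : 0 < T q)
    (hv : B v v = 0) (hw : B w w = 0) (hTv : 0 < T v) (hTw : 0 < T w) (hk : B v w ≠ 0)
    (c : ℝ) (hc : 0 < c) (pv : c ≤ - B p v) (pw : c ≤ - B p w) (qv : c ≤ - B q v) (qw : c ≤ - B q w)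
    (hDp : 0 < D p v w) (hDq : D q v w ≤ 0) (κ : ℝ) (hκ : |B p q| ≤ κ) :
    T p ≤ (4 + 2 * κ) / (2 * c) * (T v + T w) ∨ T q ≤ (4 + 2 * κ) / (2 * c) * (T v + T w) := by
  by_contra hcon
  push Not at hcon
  obtain ⟨c1, c2⟩ := hcon
  set d := D p v w - D q v w with hd
  have hd0 : 0 < d := by linarith
  set s := - D q v w / d with hs
  set t := D p v w / d with ht
  have hs0 : 0 ≤ s := div_nonneg (by linarith) hd0.le
  have ht0 : 0 ≤ t := div_nonneg hDp.le hd0.le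
  have hst : s + t = 1 := by rw [hs, ht, ← add_div, div_eq_one_iff_eq hd0.ne']; rw [hd]; ring
  have hκ0 : 0 ≤ κ := (abs_nonneg _).trans hκ
  set z : V3 := s • p + t • q with hz
  have zD : D z v w = 0 := by
    rw [hz, D_add, D_smul, D_smul, hs, ht]; field_simp; ring
  have zv : c ≤ - B z v := by
    rw [hz, B_add_left, B_smul_left, B_smul_left]
    nlinarith
  have zw : c ≤ - B z w := by
    rw [hz, B_add_left, B_smul_left, B_smul_left]
    nlinarith
  have zz : - B z z ≤ 4 + 2 * κ := by
    have e : B z z = s ^ 2 * B p p + t ^ 2 * B q q + 2 * s * t * B p q := by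
      rw [hz]
      simp only [B_add_left, B_add_right, B_smul_left, B_smul_right, B_comm q p]
      ring
    rw [e, hp, hq]
    have h1 := (abs_le.mp hκ).1
    have hs1 : s ≤ 1 := by linarith
    have ht1 : t ≤ 1 := by linarith
    have h2 : s * t ≤ 1 := by nlinarith
    have h3 : 0 ≤ s * t := mul_nonneg hs0 ht0
    nlinarith [mul_le_mul_of_nonneg_left hκ h3]
  have dz := decomp z v w hv hw hk zD
  set k := - B v w with hk'
  have hk0 : 0 < k := by
    have := fut_neg v w hv.le hTv hw.le hTw
    rcases lt_or_eq_of_le this with h | h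
    · linarith
    · exact absurd h hk
  set α := B z w / B v w with hα
  set β := B z v / B v w with hβ
  have kα : k * α = - B z w := by rw [hα, hk']; field_simp
  have kβ : k * β = - B z v := by rw [hβ, hk']; field_simp
  have hαβ : 2 * k * α * β ≤ 4 + 2 * κ := by
    have e : B z z = - (2 * k * α * β) := by
      rw [dz]
      simp only [B_add_left, B_add_right, B_smul_left, B_smul_right, B_comm w v, hv, hw]
      rw [hk']; ring
    linarith
  have hα0 : 0 < α := by
    by_contra h; push Not at h
    nlinarith
  have hβ0 : 0 < β := by
    by_contra h; push Not at h
    nlinarith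
  have hα1 : α ≤ (4 + 2 * κ) / (2 * c) := by
    rw [le_div_iff₀ (by positivity)]
    have h1 : c ≤ k * β := by rw [kβ]; exact zv
    calc α * (2 * c) ≤ α * (2 * (k * β)) := by gcongr
      _ = 2 * k * α * β := by ring
      _ ≤ _ := hαβ
  have hβ1 : β ≤ (4 + 2 * κ) / (2 * c) := by
    rw [le_div_iff₀ (by positivity)]
    have h1 : c ≤ k * α := by rw [kα]; exact zw
    calc β * (2 * c) ≤ β * (2 * (k * α)) := by gcongr
      _ = 2 * k * α * β := by ring
      _ ≤ _ := hαβ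
  have Tz : T z ≤ (4 + 2 * κ) / (2 * c) * (T v + T w) := by
    have : T z = α * T v + β * T w := by rw [dz, T_add, T_smul, T_smul]
    rw [this, mul_add]
    gcongr
  have Tz' : T z = s * T p + t * T q := by rw [hz, T_add, T_smul, T_smul]
  rw [Tz'] at Tz
  linarith [conv_lt s t (T p) (T q) _ hs0 ht0 hst c1 c2]

namespace PA
variable {Γ : Type} [Group Γ] (q : PA Γ)

lemma abs_T_L (q : PA Γ) (hp : ∀ γ, (q.L γ)ᵀ * J * q.L γ = J) (δ : Γ) : T (q.L δ *ᵥ o) ≠ 0 := by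
  intro h
  have := T_sq (q.L δ *ᵥ o)
  rw [h, q.B_L hp, B_oo] at this
  nlinarith [sq_nonneg ((q.L δ *ᵥ o) 0), sq_nonneg ((q.L δ *ᵥ o) 1), sq_nonneg ((q.L δ *ᵥ o) 2)]

open Classical in
/-- side function -/
noncomputable def side (v w : V3) (δ : Γ) : ℤ :=
  if 0 < D (q.L δ *ᵥ o) v w * T (q.L δ *ᵥ o) then 1 else 0

lemma F1 (hp : ∀ γ, (q.L γ)ᵀ * J * q.L γ = J) (hprop : ∀ R : ℝ, {γ | ‖q.L γ‖ ≤ R}.Finite)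
    (v w : V3) (hv : B v v = 0) (hw : B w w = 0) (hTv : 0 < T v) (hTw : 0 < T w) (hk : B v w ≠ 0)
    (c : ℝ) (hc : 0 < c) (cv : ∀ δ, c ≤ |B (q.L δ *ᵥ o) v|) (cw : ∀ δ, c ≤ |B (q.L δ *ᵥ o) w|)
    (s : Γ) : {δ | q.side v w (δ * s) ≠ q.side v w δ}.Finite := by
  set κ := |B o (q.L s *ᵥ o)| with hκ
  set C := (4 + 2 * κ) / (2 * c) * (T v + T w) with hC
  have hfin : ({δ | ‖q.L δ‖ ≤ 3 * C} ∪ (fun δ => δ * s⁻¹) '' {δ | ‖q.L δ‖ ≤ 3 * C}).Finite :=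
    (hprop _).union ((hprop _).image _)
  refine hfin.subset ?_
  intro δ hδ
  -- signs
  have sgn : ∀ δ, ∃ σ : ℝ, (σ = 1 ∨ σ = -1) ∧ 0 < T (σ • (q.L δ *ᵥ o)) := by
    intro δ
    rcases lt_or_gt_of_ne (q.abs_T_L hp δ) with h | h
    · exact ⟨-1, Or.inr rfl, by rw [T_smul]; linarith⟩
    · exact ⟨1, Or.inl rfl, by rw [T_smul]; linarith⟩
  have bd : ∀ δ, ∀ σ : ℝ, (σ = 1 ∨ σ = -1) → T (σ • (q.L δ *ᵥ o)) ≤ C → 0 < T (σ • (q.L δ *ᵥ o)) → ‖q.L δ‖ ≤ 3 * C := by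
    intro δ σ hσ h h0
    refine (OJ_norm_le _ (hp δ)).trans ?_
    rw [T_smul] at h h0
    have : |T (q.L δ *ᵥ o)| = σ * T (q.L δ *ᵥ o) := by
      rcases hσ with rfl | rfl
      · rw [one_mul] at h0 ⊢; exact abs_of_pos h0
      · rw [neg_one_mul] at h0 ⊢; exact abs_of_neg (by linarith)
    linarith
  have sd : ∀ δ, ∀ σ : ℝ, (σ = 1 ∨ σ = -1) → 0 < T (σ • (q.L δ *ᵥ o)) →
      (0 < D (q.L δ *ᵥ o) v w * T (q.L δ *ᵥ o) ↔ 0 < D (σ • (q.L δ *ᵥ o)) v w) := by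
    intro δ σ hσ h0
    have : D (q.L δ *ᵥ o) v w * T (q.L δ *ᵥ o) = D (σ • (q.L δ *ᵥ o)) v w * T (σ • (q.L δ *ᵥ o)) := by
      rw [D_smul, T_smul]
      rcases hσ with rfl | rfl <;> ring
    rw [this]
    exact mul_pos_iff_of_pos_right h0
  have bb : ∀ δ, ∀ σ : ℝ, (σ = 1 ∨ σ = -1) → B (σ • (q.L δ *ᵥ o)) (σ • (q.L δ *ᵥ o)) = -2 := by
    intro δ σ hσ
    rw [B_smul_left, B_smul_right, q.B_L hp, B_oo]
    rcases hσ with rfl | rfl <;> ring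
  have bc : ∀ x : V3, B x x = 0 → 0 < T x → (∀ δ, c ≤ |B (q.L δ *ᵥ o) x|) → ∀ δ, ∀ σ : ℝ, (σ = 1 ∨ σ = -1) → 0 < T (σ • (q.L δ *ᵥ o)) →
      c ≤ - B (σ • (q.L δ *ᵥ o)) x := by
    intro x hx hTx hcx δ σ hσ h0
    have h1 := fut_neg (σ • (q.L δ *ᵥ o)) x (by rw [bb δ σ hσ]; norm_num) h0 hx.le hTx
    rw [← abs_of_nonpos h1, B_smul_left, abs_mul]
    have : |σ| = 1 := by rcases hσ with rfl | rfl <;> simp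
    rw [this, one_mul]
    exact hcx δ
  have bk : ∀ σ σ' : ℝ, (σ = 1 ∨ σ = -1) → (σ' = 1 ∨ σ' = -1) →
      |B (σ • (q.L δ *ᵥ o)) (σ' • (q.L (δ * s) *ᵥ o))| ≤ κ := by
    intro σ σ' hσ hσ'
    rw [B_smul_left, B_smul_right, map_mul, ← Matrix.mulVec_mulVec, q.B_L hp, abs_mul, abs_mul]
    have h1 : |σ| = 1 := by rcases hσ with rfl | rfl <;> simp
    have h2 : |σ'| = 1 := by rcases hσ' with rfl | rfl <;> simp
    rw [h1, h2, one_mul, one_mul]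
  obtain ⟨σ, hσ, hσT⟩ := sgn δ
  obtain ⟨σ', hσ', hσT'⟩ := sgn (δ * s)
  have s1 := sd δ σ hσ hσT
  have s2 := sd (δ * s) σ' hσ' hσT'
  have fin : T (σ • (q.L δ *ᵥ o)) ≤ C ∨ T (σ' • (q.L (δ * s) *ᵥ o)) ≤ C := by
    by_cases h1 : 0 < D (σ • (q.L δ *ᵥ o)) v w
    · by_cases h2 : 0 < D (σ' • (q.L (δ * s) *ᵥ o)) v w
      · exfalso
        apply hδ
        unfold side
        rw [if_pos (s1.mpr h1), if_pos (s2.mpr h2)]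
      · push Not at h2
        exact cross_bound _ _ v w (bb _ _ hσ) (bb _ _ hσ') hσT hσT' hv hw hTv hTw hk c hc
          (bc v hv hTv cv _ _ hσ hσT) (bc w hw hTw cw _ _ hσ hσT)
          (bc v hv hTv cv _ _ hσ' hσT') (bc w hw hTw cw _ _ hσ' hσT') h1 h2 κ (bk _ _ hσ hσ')
    · by_cases h2 : 0 < D (σ' • (q.L (δ * s) *ᵥ o)) v w
      · push Not at h1
        exact (cross_bound _ _ v w (bb _ _ hσ') (bb _ _ hσ) hσT' hσT hv hw hTv hTw hk c hc
          (bc v hv hTv cv _ _ hσ' hσT') (bc w hw hTw cw _ _ hσ' hσT')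
          (bc v hv hTv cv _ _ hσ hσT) (bc w hw hTw cw _ _ hσ hσT) h2 h1 κ
          (by rw [B_comm]; exact bk _ _ hσ hσ')).symm
      · exfalso
        apply hδ
        unfold side
        rw [if_neg (fun h => h1 (s1.mp h)), if_neg (fun h => h2 (s2.mp h))]
  rcases fin with h | h
  · left
    exact bd δ σ hσ h hσT
  · right
    exact ⟨δ * s, bd _ σ' hσ' h hσT', by group⟩

end PA
end Mess

open scoped commutatorElement

namespace Mess

open scoped Matrix Matrix.Norms.Operator
open Filter Topology

lemma T_dot (x : V3) : T x = o ⬝ᵥ x := by rw [dot_fin_three]; simp [T, o]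

lemma D_zero_of_par (x y z : V3) (hy : B y y = 0) (hz : B z z = 0) (h : B y z = 0) : D x y z = 0 := by
  have := D_gram x y z
  rw [hy, hz, h] at this
  simpa using this

lemma D_ne (x y z : V3) (hx : B x x = 0) (hy : B y y = 0) (hz : B z z = 0) (h1 : B x y ≠ 0)
    (h2 : B x z ≠ 0) (h3 : B y z ≠ 0) : D x y z ≠ 0 := by
  intro h
  have := D_gram x y z
  rw [hx, hy, hz, h] at this
  have h4 : B x y * B x z * B y z = 0 := by linarith
  simp [h1, h2, h3] at h4

lemma par_of_D (y z : V3) (hy : B y y = 0) (h : ∀ x, D x y z = 0) : B y z = 0 := by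
  have a0 := h ![1, 0, 0]
  have a1 := h ![0, 1, 0]
  have a2 := h ![0, 0, 1]
  simp [D] at a0 a1 a2
  have : B y z ^ 2 = 0 := by
    have e : B y z ^ 2 = B y y * B z z + (y 0 * z 2 - y 2 * z 0) ^ 2
      - 2 * (y 1 * z 2 - y 2 * z 1) * (y 0 * z 1 - y 1 * z 0) := by unfold B; ring
    rw [e, hy, a0]
    have : y 0 * z 2 - y 2 * z 0 = 0 := by linarith
    rw [this]; ring
  simpa using this

lemma sign_contra (x1 x2 x3 x4 : V3) (T1 : T x1 ≠ 0) (T2 : T x2 ≠ 0) (T3 : T x3 ≠ 0) (T4 : T x4 ≠ 0)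
    (d1 : D x2 x3 x4 ≠ 0) (d2 : D x1 x3 x4 ≠ 0) (d3 : D x1 x2 x4 ≠ 0) (d4 : D x1 x2 x3 ≠ 0)
    (h12 : 0 ≤ D x1 x3 x4 * T x1 * (D x2 x3 x4 * T x2))
    (h13 : 0 ≤ D x1 x2 x4 * T x1 * (D x3 x2 x4 * T x3))
    (h14 : 0 ≤ D x1 x2 x3 * T x1 * (D x4 x2 x3 * T x4))
    (h34 : 0 ≤ D x3 x1 x2 * T x3 * (D x4 x1 x2 * T x4)) : False := by
  have e1 : D x3 x2 x4 = - D x2 x3 x4 := by unfold D; ring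
  have e2 : D x4 x2 x3 = D x2 x3 x4 := by unfold D; ring
  have e3 : D x3 x1 x2 = D x1 x2 x3 := by unfold D; ring
  have e4 : D x4 x1 x2 = D x1 x2 x4 := by unfold D; ring
  rw [e1] at h13
  rw [e2] at h14
  rw [e3, e4] at h34
  -- combine
  have k13 : D x1 x2 x4 * T x1 * (D x2 x3 x4 * T x3) < 0 := by
    have : D x1 x2 x4 * T x1 * (D x2 x3 x4 * T x3) ≠ 0 := by simp [*]
    rcases lt_or_gt_of_ne this with h | h
    · exact h
    · nlinarith
  have k14 : 0 < D x1 x2 x3 * T x1 * (D x2 x3 x4 * T x4) :=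
    lt_of_le_of_ne h14 (by symm; simp [*])
  have k34 : 0 < D x1 x2 x3 * T x3 * (D x1 x2 x4 * T x4) :=
    lt_of_le_of_ne h34 (by symm; simp [*])
  have := mul_pos k14 k34
  have e : D x1 x2 x3 * T x1 * (D x2 x3 x4 * T x4) * (D x1 x2 x3 * T x3 * (D x1 x2 x4 * T x4))
    = (D x1 x2 x3 * T x4) ^ 2 * (D x1 x2 x4 * T x1 * (D x2 x3 x4 * T x3)) := by ring
  rw [e] at this
  have h0 : 0 ≤ (D x1 x2 x3 * T x4) ^ 2 := sq_nonneg _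
  nlinarith

namespace PA
variable {Γ : Type} [Group Γ] (q : PA Γ)

lemma orbit_span (H2 : ∀ k, ¬ (derivedSeries Γ k : Set Γ).Finite) (x : V3) (hx : x ≠ 0)
    (φ : V3 →ₗ[ℝ] ℝ) (h : ∀ β, φ (q.L β *ᵥ x) = 0) (y : V3) : φ y = 0 := by
  rcases q.irr H2 (Submodule.span ℝ (Set.range fun β => q.L β *ᵥ x)) (by
      intro γ _ z hz
      induction hz using Submodule.span_induction with
      | mem z hz =>
        obtain ⟨δ, rfl⟩ := hz
        apply Submodule.subset_span
        exact ⟨γ * δ, by simp only [map_mul, Matrix.mulVec_mulVec]⟩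
      | zero => rw [Matrix.mulVec_zero]; exact zero_mem _
      | add x y _ _ hx hy => rw [Matrix.mulVec_add]; exact add_mem hx hy
      | smul c x _ hx => rw [Matrix.mulVec_smul]; exact Submodule.smul_mem _ _ hx) with h0 | h0
  · exfalso
    apply hx
    have : x ∈ Submodule.span ℝ (Set.range fun β => q.L β *ᵥ x) :=
      Submodule.subset_span ⟨1, by simp⟩
    rw [h0] at this
    simpa using this
  · have : y ∈ Submodule.span ℝ (Set.range fun β => q.L β *ᵥ x) := by rw [h0]; trivial
    have h1 : Submodule.span ℝ (Set.range fun β => q.L β *ᵥ x) ≤ LinearMap.ker φ := by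
      rw [Submodule.span_le]
      rintro _ ⟨β, rfl⟩
      exact h β
    exact h1 this

/-- the form as linear functional -/
def Bl (x : V3) : V3 →ₗ[ℝ] ℝ where
  toFun y := B x y
  map_add' := B_add_right x
  map_smul' c y := B_smul_right c x y

/-- det as linear functional -/
def Dl (y z : V3) : V3 →ₗ[ℝ] ℝ where
  toFun x := D x y z
  map_add' x x' := D_add x x' y z
  map_smul' c x := D_smul c x y z

lemma lim_seq (hp : ∀ γ, (q.L γ)ᵀ * J * q.L γ = J) (hprop : ∀ R : ℝ, {γ | ‖q.L γ‖ ≤ R}.Finite)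
    (H2 : ∀ k, ¬ (derivedSeries Γ k : Set Γ).Finite) :
    ∃ δ : ℕ → Γ, ∃ M : M3, Function.Injective δ ∧
      Tendsto (fun n => (T (q.L (δ n) *ᵥ o))⁻¹ • q.L (δ n)) atTop (𝓝 M) ∧ T (M *ᵥ o) = 1 ∧
      Mᵀ * J * M = 0 ∧ M * J * Mᵀ = 0 := by
  have : Infinite Γ := by
    by_contra h
    rw [not_infinite_iff_finite] at h
    exact H2 0 (Set.toFinite _)
  set f : ℕ → Γ := fun n => Infinite.natEmbedding Γ n with hf
  have hfi : Function.Injective f := (Infinite.natEmbedding Γ).injective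
  have h1 : Tendsto (fun n => |T (q.L (f n) *ᵥ o)|) atTop atTop := by
    rw [tendsto_atTop]
    intro b
    rw [← Nat.cofinite_eq_atTop]
    refine ((hprop (3 * b)).preimage hfi.injOn).subset ?_
    intro n hn
    have hn : ¬ (b ≤ |T (q.L (f n) *ᵥ o)|) := hn
    push Not at hn
    show ‖q.L (f n)‖ ≤ 3 * b
    exact (OJ_norm_le _ (hp _)).trans (by linarith)
  have h2 : Tendsto (fun n => (T (q.L (f n) *ᵥ o))⁻¹) atTop (𝓝 0) := by
    rw [tendsto_zero_iff_abs_tendsto_zero]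
    refine (tendsto_inv_atTop_zero.comp h1).congr ?_
    intro n
    simp [abs_inv]
  obtain ⟨M, -, φ, hφ, hlim⟩ := tendsto_subseq_of_bounded (s := Metric.closedBall (0 : M3) 3)
    Metric.isBounded_closedBall (x := fun n => (T (q.L (f n) *ᵥ o))⁻¹ • q.L (f n)) (fun n => by
      rw [mem_closedBall_zero_iff, norm_smul, norm_inv, Real.norm_eq_abs]
      have h3 := OJ_norm_le _ (hp (f n))
      have h4 : 0 < |T (q.L (f n) *ᵥ o)| := abs_pos.mpr (q.abs_T_L hp (f n))
      rw [inv_mul_le_iff₀ h4]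
      linarith)
  have h3 := h2.comp hφ.tendsto_atTop
  have h4 : Tendsto (fun n => ((T (q.L (f (φ n)) *ᵥ o))⁻¹ * (T (q.L (f (φ n)) *ᵥ o))⁻¹) • J) atTop (𝓝 0) := by
    have := (h3.mul h3).smul_const J
    simpa using this
  refine ⟨f ∘ φ, M, hfi.comp hφ.injective, hlim, ?_, ?_, ?_⟩
  · have hc : Continuous (fun X : M3 => T (X *ᵥ o)) :=
      cont_T.comp (Continuous.matrix_mulVec continuous_id continuous_const)
    refine tendsto_nhds_unique ((hc.tendsto M).comp hlim) ?_
    refine tendsto_const_nhds.congr ?_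
    intro n
    simp only [Function.comp]
    rw [Matrix.smul_mulVec, T_smul, inv_mul_cancel₀ (q.abs_T_L hp _)]
  · have hc : Continuous (fun X : M3 => Xᵀ * J * X) := by fun_prop
    refine tendsto_nhds_unique ((hc.tendsto M).comp hlim) ?_
    refine h4.congr ?_
    intro n
    simp only [Function.comp, Matrix.transpose_smul, Matrix.smul_mul, Matrix.mul_smul, smul_smul, hp]
  · have hc : Continuous (fun X : M3 => X * J * Xᵀ) := by fun_prop
    refine tendsto_nhds_unique ((hc.tendsto M).comp hlim) ?_
    refine h4.congr ?_
    intro n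
    simp only [Function.comp, Matrix.transpose_smul, Matrix.smul_mul, Matrix.mul_smul, smul_smul,
      OJ_transpose _ (hp _)]

lemma side_lim (hp : ∀ γ, (q.L γ)ᵀ * J * q.L γ = J) (δ : ℕ → Γ) (M : M3)
    (hlim : Tendsto (fun n => (T (q.L (δ n) *ᵥ o))⁻¹ • q.L (δ n)) atTop (𝓝 M)) (v w : V3) (β : Γ)
    (x : V3) (hx : x = q.L β *ᵥ (M *ᵥ o)) (hA : D x v w * T x ≠ 0) :
    ∀ᶠ j in atTop, (0 < D (q.L (β * δ j) *ᵥ o) v w * T (q.L (β * δ j) *ᵥ o) ↔ 0 < D x v w * T x) := by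
  have hc : Continuous (fun X : M3 => D (q.L β *ᵥ (X *ᵥ o)) v w * T (q.L β *ᵥ (X *ᵥ o))) := by
    have h1 : Continuous (fun X : M3 => q.L β *ᵥ (X *ᵥ o)) :=
      Continuous.matrix_mulVec continuous_const
        (Continuous.matrix_mulVec continuous_id continuous_const)
    have h2 : Continuous (fun X : M3 => D (q.L β *ᵥ (X *ᵥ o)) v w) :=
      cont_D.comp (h1.prodMk (continuous_const (y := (v, w))))
    exact h2.mul (cont_T.comp h1)
  have h1 := (hc.tendsto M).comp hlim
  simp only [← hx] at h1
  have h2 : ∀ j, D (q.L (β * δ j) *ᵥ o) v w * T (q.L (β * δ j) *ᵥ o) = T (q.L (δ j) *ᵥ o) ^ 2 *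
      ((fun X : M3 => D (q.L β *ᵥ (X *ᵥ o)) v w * T (q.L β *ᵥ (X *ᵥ o))) ((T (q.L (δ j) *ᵥ o))⁻¹ • q.L (δ j))) := by
    intro j
    have := q.abs_T_L hp (δ j)
    simp only [Matrix.smul_mulVec, Matrix.mulVec_smul, D_smul, T_smul, map_mul, Matrix.mulVec_mulVec]
    field_simp
  have h3 : ∀ j, 0 < T (q.L (δ j) *ᵥ o) ^ 2 := fun j => by
    have := q.abs_T_L hp (δ j)
    positivity
  rcases lt_or_gt_of_ne hA with h | h
  · filter_upwards [h1.eventually (gt_mem_nhds h)] with j hj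
    rw [h2, mul_pos_iff_of_pos_left (h3 j)]
    exact ⟨fun h' => absurd h' (not_lt.mpr (le_of_lt hj)), fun h' => absurd h' (not_lt.mpr h.le)⟩
  · filter_upwards [h1.eventually (lt_mem_nhds h)] with j hj
    rw [h2, mul_pos_iff_of_pos_left (h3 j)]
    exact ⟨fun _ => h, fun _ => hj⟩

end PA
end Mess

open scoped commutatorElement

namespace Mess

open scoped Matrix Matrix.Norms.Operator
open Filter Topology

namespace PA
variable {Γ : Type} [Group Γ] (q : PA Γ)

lemma orbit_low (hp : ∀ γ, (q.L γ)ᵀ * J * q.L γ = J) (v : V3) (hv : B v v = 0)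
    (hlow : ∀ δ, 1 / 2 ≤ |T (q.L δ *ᵥ v)|) (a : ℝ) (η : Γ) :
    B (a • q.L η *ᵥ v) (a • q.L η *ᵥ v) = 0 ∧ ∀ δ, |a| / 2 ≤ |B (q.L δ *ᵥ o) (a • q.L η *ᵥ v)| := by
  refine ⟨by rw [B_smul_left, B_smul_right, q.B_L hp, hv]; simp, ?_⟩
  intro δ
  have e : q.L η *ᵥ v = q.L δ *ᵥ (q.L (δ⁻¹ * η) *ᵥ v) := by
    rw [Matrix.mulVec_mulVec, ← map_mul, mul_inv_cancel_left]
  rw [B_smul_right, e, q.B_L hp, abs_mul]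
  have h1 := hlow (δ⁻¹ * η)
  rw [T_eq, abs_neg] at h1
  have := mul_le_mul_of_nonneg_left h1 (abs_nonneg a)
  linarith

set_option maxHeartbeats 1000000 in
lemma F2 (hp : ∀ γ, (q.L γ)ᵀ * J * q.L γ = J) (hprop : ∀ R : ℝ, {γ | ‖q.L γ‖ ≤ R}.Finite)
    (H2 : ∀ k, ¬ (derivedSeries Γ k : Set Γ).Finite)
    (H5 : ∀ f : Γ → ℤ, (∀ s, {γ | f (γ * s) ≠ f γ}.Finite) → ∃ c, {γ | f γ ≠ c}.Finite)
    (v : V3) (hv : B v v = 0) (hv0 : v ≠ 0) (hlow : ∀ δ, 1 / 2 ≤ |T (q.L δ *ᵥ v)|)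
    (δ : ℕ → Γ) (hδ : Function.Injective δ) (M : M3)
    (hlim : Tendsto (fun n => (T (q.L (δ n) *ᵥ o))⁻¹ • q.L (δ n)) atTop (𝓝 M))
    (hMx : ∀ x, M *ᵥ x = T (M *ᵥ x) • (M *ᵥ o)) (n : V3) (hn : ∀ x, T (M *ᵥ x) = B n x)
    (hMo : T (M *ᵥ o) = 1) (β1 β2 β3 β4 : Γ) (x1 x2 x3 x4 : V3)
    (h1 : x1 = q.L β1 *ᵥ (M *ᵥ o)) (h2 : x2 = q.L β2 *ᵥ (M *ᵥ o))
    (h3 : x3 = q.L β3 *ᵥ (M *ᵥ o)) (h4 : x4 = q.L β4 *ᵥ (M *ᵥ o)) :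
    0 ≤ D x1 x3 x4 * T x1 * (D x2 x3 x4 * T x2) := by
  by_contra hneg
  push Not at hneg
  obtain ⟨β', hβ'⟩ : ∃ β', T (M *ᵥ (q.L β' *ᵥ v)) ≠ 0 := by
    by_contra hcon
    push Not at hcon
    have := q.orbit_span H2 v hv0 (Bl n) (fun β => by
      have := hcon β
      rw [hn] at this
      exact this) o
    have h5 : B n o = 0 := this
    rw [← hn, hMo] at h5
    exact one_ne_zero h5
  set ℓ := T (M *ᵥ (q.L β' *ᵥ v)) with hℓ
  have hc : Continuous (fun X : M3 => D x1 (q.L β3 *ᵥ (X *ᵥ (q.L β' *ᵥ v))) (q.L β4 *ᵥ (X *ᵥ (q.L β' *ᵥ v))) * T x1 *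
      (D x2 (q.L β3 *ᵥ (X *ᵥ (q.L β' *ᵥ v))) (q.L β4 *ᵥ (X *ᵥ (q.L β' *ᵥ v))) * T x2)) := by
    have c0 : ∀ β, Continuous (fun X : M3 => q.L β *ᵥ (X *ᵥ (q.L β' *ᵥ v))) := fun β =>
      Continuous.matrix_mulVec continuous_const
        (Continuous.matrix_mulVec continuous_id continuous_const)
    have c1 : ∀ x : V3, Continuous (fun X : M3 =>
        D x (q.L β3 *ᵥ (X *ᵥ (q.L β' *ᵥ v))) (q.L β4 *ᵥ (X *ᵥ (q.L β' *ᵥ v)))) := fun x =>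
      cont_D.comp ((continuous_const (y := x)).prodMk ((c0 β3).prodMk (c0 β4)))
    exact ((c1 x1).mul continuous_const).mul ((c1 x2).mul continuous_const)
  have hval : D x1 (q.L β3 *ᵥ (M *ᵥ (q.L β' *ᵥ v))) (q.L β4 *ᵥ (M *ᵥ (q.L β' *ᵥ v))) * T x1 *
      (D x2 (q.L β3 *ᵥ (M *ᵥ (q.L β' *ᵥ v))) (q.L β4 *ᵥ (M *ᵥ (q.L β' *ᵥ v))) * T x2) < 0 := by
    rw [hMx (q.L β' *ᵥ v), ← hℓ, Matrix.mulVec_smul, Matrix.mulVec_smul, ← h3, ← h4]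
    simp only [D_smul2, D_smul3]
    have : ℓ * (ℓ * D x1 x3 x4) * T x1 * (ℓ * (ℓ * D x2 x3 x4) * T x2) =
      (ℓ ^ 2) ^ 2 * (D x1 x3 x4 * T x1 * (D x2 x3 x4 * T x2)) := by ring
    rw [this]
    have : 0 < (ℓ ^ 2) ^ 2 := by positivity
    exact mul_neg_of_pos_of_neg this hneg
  obtain ⟨k, hk⟩ := (((hc.tendsto M).comp hlim).eventually (gt_mem_nhds hval)).exists
  simp only [Function.comp] at hk
  set t := (T (q.L (δ k) *ᵥ o))⁻¹ with ht
  have ht0 : t ≠ 0 := inv_ne_zero (q.abs_T_L hp _)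
  have e : ∀ β, q.L β *ᵥ ((t • q.L (δ k)) *ᵥ (q.L β' *ᵥ v)) = t • q.L (β * δ k * β') *ᵥ v := by
    intro β
    rw [Matrix.smul_mulVec, Matrix.mulVec_smul, Matrix.mulVec_mulVec, Matrix.mulVec_mulVec, map_mul, map_mul,
      Matrix.mul_assoc]
  rw [e, e] at hk
  have hT : ∀ η, T (q.L η *ᵥ v) ≠ 0 := by
    intro η h
    have := hlow η
    rw [h, abs_zero] at this
    norm_num at this
  set a3 := T (q.L (β3 * δ k * β') *ᵥ v) with ha3
  set a4 := T (q.L (β4 * δ k * β') *ᵥ v) with ha4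
  have ha30 : a3 ≠ 0 := hT _
  have ha40 : a4 ≠ 0 := hT _
  obtain ⟨b3, c3⟩ := q.orbit_low hp v hv hlow a3 (β3 * δ k * β')
  obtain ⟨b4, c4⟩ := q.orbit_low hp v hv hlow a4 (β4 * δ k * β')
  have T3 : 0 < T (a3 • q.L (β3 * δ k * β') *ᵥ v) := by
    rw [T_smul, ← ha3]; exact mul_self_pos.mpr ha30
  have T4 : 0 < T (a4 • q.L (β4 * δ k * β') *ᵥ v) := by
    rw [T_smul, ← ha4]; exact mul_self_pos.mpr ha40
  set v3 := q.L (β3 * δ k * β') *ᵥ v with hv3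
  set v4 := q.L (β4 * δ k * β') *ᵥ v with hv4
  have hk' : D x1 (a3 • v3) (a4 • v4) * T x1 * (D x2 (a3 • v3) (a4 • v4) * T x2) < 0 := by
    simp only [D_smul2, D_smul3] at hk ⊢
    have e1 : t * (t * D x1 v3 v4) * T x1 * (t * (t * D x2 v3 v4) * T x2) =
      (t ^ 2) ^ 2 * (D x1 v3 v4 * T x1 * (D x2 v3 v4 * T x2)) := by ring
    have e2 : a4 * (a3 * D x1 v3 v4) * T x1 * (a4 * (a3 * D x2 v3 v4) * T x2) =
      (a3 * a4) ^ 2 * (D x1 v3 v4 * T x1 * (D x2 v3 v4 * T x2)) := by ring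
    have e2' : a3 * (a4 * D x1 v3 v4) * T x1 * (a3 * (a4 * D x2 v3 v4) * T x2) =
      (a3 * a4) ^ 2 * (D x1 v3 v4 * T x1 * (D x2 v3 v4 * T x2)) := by ring
    rw [e1] at hk
    have p1 : 0 < (t ^ 2) ^ 2 := by positivity
    have p2 : 0 < (a3 * a4) ^ 2 := by positivity
    have hh : D x1 v3 v4 * T x1 * (D x2 v3 v4 * T x2) < 0 := by
      by_contra h
      push Not at h
      exact absurd hk (not_lt.mpr (mul_nonneg p1.le h))
    first
    | rw [e2]; exact mul_neg_of_pos_of_neg p2 hh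
    | rw [e2']; exact mul_neg_of_pos_of_neg p2 hh
  set w3 := a3 • v3
  set w4 := a4 • v4
  have hA1 : D x1 w3 w4 * T x1 ≠ 0 := by intro h; rw [h] at hk'; simp at hk'
  have hA2 : D x2 w3 w4 * T x2 ≠ 0 := by intro h; rw [h] at hk'; simp at hk'
  have hB : B w3 w4 ≠ 0 := by
    intro h
    apply hA1
    rw [D_zero_of_par x1 w3 w4 b3 b4 h, zero_mul]
  set c := min (|a3| / 2) (|a4| / 2) with hc'
  have hcpos : 0 < c := lt_min (by positivity) (by positivity)
  obtain ⟨m, hm⟩ := H5 (q.side w3 w4) (fun s => q.F1 hp hprop w3 w4 b3 b4 T3 T4 hB c hcpos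
    (fun δ => (min_le_left _ _).trans (c3 δ)) (fun δ => (min_le_right _ _).trans (c4 δ)) s)
  have ev : ∀ β, ∀ᶠ j in atTop, q.side w3 w4 (β * δ j) = m := by
    intro β
    rw [← Nat.cofinite_eq_atTop]
    have hinj : Function.Injective (fun j => β * δ j) := fun i j h => hδ (mul_left_cancel h)
    exact hm.preimage hinj.injOn
  obtain ⟨j, j1, j2, j3, j4⟩ := ((ev β1).and ((ev β2).and
    ((q.side_lim hp δ M hlim w3 w4 β1 x1 h1 hA1).and
      (q.side_lim hp δ M hlim w3 w4 β2 x2 h2 hA2)))).exists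
  have j5 := j1.trans j2.symm
  unfold side at j5
  rw [if_congr j3 rfl rfl, if_congr j4 rfl rfl] at j5
  by_cases p1 : 0 < D x1 w3 w4 * T x1
  · by_cases p2 : 0 < D x2 w3 w4 * T x2
    · exact absurd hk' (not_lt.mpr (mul_pos p1 p2).le)
    · rw [if_pos p1, if_neg p2] at j5
      norm_num at j5
  · by_cases p2 : 0 < D x2 w3 w4 * T x2
    · rw [if_neg p1, if_pos p2] at j5
      norm_num at j5
    · push Not at p1 p2
      exact absurd hk' (not_lt.mpr (mul_nonneg_of_nonpos_of_nonpos p1 p2))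

end PA
end Mess

open scoped commutatorElement

namespace Mess

open scoped Matrix Matrix.Norms.Operator
open Filter Topology

lemma par3 (x y z : V3) (hz0 : z ≠ 0) (hx : B x x = 0) (hy : B y y = 0) (hz : B z z = 0)
    (h1 : B z x = 0) (h2 : B z y = 0) : B x y = 0 := by
  obtain ⟨c, rfl⟩ := B_null z x hz0 hz hx h1
  obtain ⟨d, rfl⟩ := B_null z y hz0 hz hy h2
  rw [B_smul_left, B_smul_right, hz]; simp

namespace PA
variable {Γ : Type} [Group Γ] (q : PA Γ)

lemma F3 (hp : ∀ γ, (q.L γ)ᵀ * J * q.L γ = J) (hprop : ∀ R : ℝ, {γ | ‖q.L γ‖ ≤ R}.Finite)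
    (H2 : ∀ k, ¬ (derivedSeries Γ k : Set Γ).Finite)
    (H5 : ∀ f : Γ → ℤ, (∀ s, {γ | f (γ * s) ≠ f γ}.Finite) → ∃ c, {γ | f γ ≠ c}.Finite)
    (v : V3) (hv : B v v = 0) (hv0 : T v = 1) (hlow : ∀ δ, 1 / 2 ≤ |T (q.L δ *ᵥ v)|) : False := by
  have hv0' : v ≠ 0 := by
    rintro rfl
    simp [T] at hv0
  obtain ⟨δ, M, hδ, hlim, hMo, hM1, hM2⟩ := q.lim_seq hp hprop H2
  set l := M *ᵥ o with hl
  have hB0 : ∀ x y, B (M *ᵥ x) (M *ᵥ y) = 0 := by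
    intro x y
    rw [← B_eq, Matrix.mulVec_mulVec, ← Matrix.vecMul_transpose M x, ← Matrix.dotProduct_mulVec,
      Matrix.mulVec_mulVec, ← Matrix.mul_assoc, hM1]
    simp
  have hl0 : l ≠ 0 := by
    intro h
    rw [h] at hMo
    simp [T] at hMo
  have hln : B l l = 0 := hB0 o o
  have hMx : ∀ x, M *ᵥ x = T (M *ᵥ x) • l := by
    intro x
    obtain ⟨c, hc⟩ := B_null l (M *ᵥ x) hl0 hln (hB0 x x) (hB0 o x)
    rw [hc, T_smul, hMo, mul_one]
  set n : V3 := J *ᵥ (Mᵀ *ᵥ o) with hn'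
  have hJn : J *ᵥ n = Mᵀ *ᵥ o := by
    rw [hn', Matrix.mulVec_mulVec, formOK_J.sq, Matrix.one_mulVec]
  have hn : ∀ x, T (M *ᵥ x) = B n x := by
    intro x
    rw [B_comm, ← B_eq, hJn, T_dot, Matrix.mulVec_transpose, Matrix.dotProduct_mulVec, dotProduct_comm]
  have hn0 : n ≠ 0 := by
    intro h
    have := hn o
    rw [h, ← hl, hMo] at this
    simp [B] at this
  have hnn : B n n = 0 := by
    rw [← hn, hn', T_dot, Matrix.mulVec_mulVec, Matrix.mulVec_mulVec, hM2]
    simp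
  have hLn : ∀ β, B (q.L β *ᵥ l) (q.L β *ᵥ l) = 0 := fun β => by rw [q.B_L hp, hln]
  have hL0 : ∀ β, q.L β *ᵥ l ≠ 0 := by
    intro β h
    apply hl0
    have := congrArg (fun z => q.L β⁻¹ *ᵥ z) h
    simpa [Matrix.mulVec_mulVec, ← map_mul] using this
  -- second point
  obtain ⟨β2, h12⟩ : ∃ β, B l (q.L β *ᵥ l) ≠ 0 := by
    by_contra hcon
    push Not at hcon
    have := q.orbit_span H2 l hl0 (Bl l) hcon o
    have h5 : B l o = 0 := this
    rw [B_comm] at h5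
    have h6 := T_eq l
    rw [h5, hMo] at h6
    norm_num at h6
  set x2 := q.L β2 *ᵥ l with hx2
  obtain ⟨β3, h13, h23⟩ : ∃ β, B l (q.L β *ᵥ l) ≠ 0 ∧ B x2 (q.L β *ᵥ l) ≠ 0 := by
    by_contra hcon
    push Not at hcon
    apply h12
    apply par_of_D l x2 hln
    refine q.orbit_span H2 l hl0 (Dl l x2) (fun β => ?_)
    show D (q.L β *ᵥ l) l x2 = 0
    have hg := D_gram (q.L β *ᵥ l) l x2
    rw [hLn β, hln, hLn β2, B_comm _ l, B_comm (q.L β *ᵥ l) x2] at hg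
    have : B l (q.L β *ᵥ l) * B x2 (q.L β *ᵥ l) = 0 := by
      by_cases h : B l (q.L β *ᵥ l) = 0
      · rw [h, zero_mul]
      · rw [hcon β h, mul_zero]
    have h2 : D (q.L β *ᵥ l) l x2 ^ 2 = 0 := by
      rw [hg]
      linear_combination (-2) * (B l x2) * this
    simpa using h2
  set x3 := q.L β3 *ᵥ l with hx3
  obtain ⟨β4, h14, h24, h34⟩ : ∃ β, B l (q.L β *ᵥ l) ≠ 0 ∧ B x2 (q.L β *ᵥ l) ≠ 0 ∧
      B x3 (q.L β *ᵥ l) ≠ 0 := by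
    by_contra hcon
    push Not at hcon
    have key : ∀ α, B n (q.L α *ᵥ l) ≠ 0 → ∀ᶠ k in atTop, B l (q.L (δ k) *ᵥ (q.L α *ᵥ l)) = 0 := by
      intro α hα
      have hev : ∀ x, B l x ≠ 0 → ∀ᶠ k in atTop, B x (q.L (δ k) *ᵥ (q.L α *ᵥ l)) ≠ 0 := by
        intro x hx
        have hc : Continuous (fun X : M3 => B x (X *ᵥ (q.L α *ᵥ l))) :=
          cont_B.comp ((continuous_const (y := x)).prodMk
            (Continuous.matrix_mulVec continuous_id continuous_const))
        have hne : B x (M *ᵥ (q.L α *ᵥ l)) ≠ 0 := by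
          rw [hMx, hn, B_smul_right, B_comm x l]
          exact mul_ne_zero hα hx
        filter_upwards [((hc.tendsto M).comp hlim).eventually_ne hne] with k hk h
        apply hk
        simp only [Function.comp, Matrix.smul_mulVec, B_smul_right, h, mul_zero]
      filter_upwards [hev x2 h12, hev x3 h13] with k k2 k3
      by_contra k1
      have e : q.L (δ k) *ᵥ (q.L α *ᵥ l) = q.L (δ k * α) *ᵥ l := by
        rw [map_mul, Matrix.mulVec_mulVec]
      rw [e] at k1 k2 k3
      exact k3 (hcon _ k1 k2)
    have two : ∀ α β, B n (q.L α *ᵥ l) ≠ 0 → B n (q.L β *ᵥ l) ≠ 0 →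
        B (q.L α *ᵥ l) (q.L β *ᵥ l) = 0 := by
      intro α β ha hb
      obtain ⟨k, k1, k2⟩ := ((key α ha).and (key β hb)).exists
      have := par3 _ _ l hl0 (by rw [q.B_L hp, hLn]) (by rw [q.B_L hp, hLn]) hln k1 k2
      rwa [q.B_L hp] at this
    have one : ∀ α β, B (q.L α *ᵥ l) (q.L β *ᵥ l) ≠ 0 → B n (q.L α *ᵥ l) = 0 →
        B n (q.L β *ᵥ l) ≠ 0 := fun α β h h1 h2 => h (par3 _ _ n hn0 (hLn _) (hLn _) hnn h1 h2)
    have e1 : l = q.L 1 *ᵥ l := by simp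
    have g12 : B (q.L 1 *ᵥ l) (q.L β2 *ᵥ l) ≠ 0 := by rw [← e1]; exact h12
    have g13 : B (q.L 1 *ᵥ l) (q.L β3 *ᵥ l) ≠ 0 := by rw [← e1]; exact h13
    by_cases c1 : B n (q.L 1 *ᵥ l) = 0
    · exact h23 (two _ _ (one _ _ g12 c1) (one _ _ g13 c1))
    · by_cases c2 : B n (q.L β2 *ᵥ l) = 0
      · exact g13 (two _ _ c1 (one _ _ h23 c2))
      · exact g12 (two _ _ c1 c2)
  set x4 := q.L β4 *ᵥ l with hx4
  have e1 : l = q.L 1 *ᵥ l := by simp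
  have F : ∀ β1 β2 β3 β4 (x1 x2 x3 x4 : V3) (_ : x1 = q.L β1 *ᵥ l) (_ : x2 = q.L β2 *ᵥ l)
    (_ : x3 = q.L β3 *ᵥ l) (_ : x4 = q.L β4 *ᵥ l),
    0 ≤ D x1 x3 x4 * T x1 * (D x2 x3 x4 * T x2) := fun β1 β2 β3 β4 x1 x2 x3 x4 a b c d =>
    q.F2 hp hprop H2 H5 v hv hv0' hlow δ hδ M hlim hMx n hn hMo β1 β2 β3 β4 x1 x2 x3 x4 a b c d
  have tn : ∀ β, T (q.L β *ᵥ l) ≠ 0 := fun β => T_ne_of_null _ (hL0 β) (hLn β).le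
  refine sign_contra l x2 x3 x4 (T_ne_of_null _ hl0 hln.le) (tn _) (tn _) (tn _)
    (D_ne _ _ _ (hLn _) (hLn _) (hLn _) h23 h24 h34)
    (D_ne _ _ _ hln (hLn _) (hLn _) h13 h14 h34)
    (D_ne _ _ _ hln (hLn _) (hLn _) h12 h14 h24)
    (D_ne _ _ _ hln (hLn _) (hLn _) h12 h13 h23)
    (F 1 β2 β3 β4 _ _ _ _ e1 rfl rfl rfl)
    (F 1 β3 β2 β4 _ _ _ _ e1 rfl rfl rfl)
    (F 1 β4 β2 β3 _ _ _ _ e1 rfl rfl rfl)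
    (F β3 β4 1 β2 _ _ _ _ rfl rfl e1 rfl)

end PA
end Mess

open scoped commutatorElement

namespace Mess

open scoped Matrix Matrix.Norms.Operator
open Filter Topology

/-- the upper triangular group -/
noncomputable def G (p : ℝ × ℝ) : M3 :=
  !![Real.exp p.2, p.1, p.1 ^ 2 / 2 * Real.exp (-p.2); 0, 1, p.1 * Real.exp (-p.2); 0, 0, Real.exp (-p.2)]

/-- inverse of `G` -/
noncomputable def Gi (p : ℝ × ℝ) : M3 :=
  !![Real.exp (-p.2), - p.1 * Real.exp (-p.2), p.1 ^ 2 / 2 * Real.exp (-p.2); 0, 1, - p.1; 0, 0, Real.exp p.2]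

lemma exp_mul_neg (t : ℝ) : Real.exp t * Real.exp (-t) = 1 := by
  rw [← Real.exp_add]; simp

lemma G_form (p : ℝ × ℝ) : (G p)ᵀ * J * G p = J := by
  have h := exp_mul_neg p.2
  generalize hE : Real.exp p.2 = e at *
  generalize hF : Real.exp (-p.2) = f at *
  ext i j
  rw [mul_fin_three]
  simp only [mul_fin_three]
  fin_cases i <;> fin_cases j <;> simp [G, J, hE, hF] <;> first | linear_combination h | linear_combination (-1) * h | ring

lemma Gi_G (p : ℝ × ℝ) : Gi p * G p = 1 := by
  have h := exp_mul_neg p.2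
  generalize hE : Real.exp p.2 = e at *
  generalize hF : Real.exp (-p.2) = f at *
  ext i j
  rw [mul_fin_three]
  fin_cases i <;> fin_cases j <;> simp [G, Gi, hE, hF] <;> first | linear_combination h | linear_combination (-1) * h | ring

lemma G_Gi (p : ℝ × ℝ) : G p * Gi p = 1 := mul_eq_one_comm.mp (Gi_G p)

lemma cont_G : Continuous G := by
  refine continuous_matrix fun i j => ?_
  fin_cases i <;> fin_cases j <;> simp [G] <;> fun_prop

lemma OJ_inv_norm (h : M3) (_hh : hᵀ * J * h = J) : ‖J * hᵀ * J‖ ≤ ‖J‖ * (3 * ‖h‖) * ‖J‖ := by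
  refine (norm_mul_le _ _).trans ?_
  gcongr
  refine (norm_mul_le _ _).trans ?_
  gcongr
  exact norm_transpose_le h

namespace PA
variable {Γ : Type} [Group Γ] (q : PA Γ)

lemma OJ_LG (hp : ∀ γ, (q.L γ)ᵀ * J * q.L γ = J) (γ : Γ) (p : ℝ × ℝ) :
    (q.L γ * G p)ᵀ * J * (q.L γ * G p) = J := by
  rw [Matrix.transpose_mul]
  calc (G p)ᵀ * (q.L γ)ᵀ * J * (q.L γ * G p) = (G p)ᵀ * ((q.L γ)ᵀ * J * q.L γ) * G p := by
        simp only [Matrix.mul_assoc]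
    _ = J := by rw [hp, G_form]

lemma act_conv (γ : Γ) (c : ℝ) : Convex ℝ {z | ‖q.act γ z‖ ≤ c} := by
  intro x hx y hy a b ha hb hab
  have e : q.act γ (a • x + b • y) = a • q.act γ x + b • q.act γ y := by
    simp only [act, Matrix.mulVec_add, Matrix.mulVec_smul, smul_add]
    have : q.u γ = a • q.u γ + b • q.u γ := by rw [← add_smul, hab, one_smul]
    nth_rewrite 1 [this]
    abel
  have hx : ‖q.act γ x‖ ≤ c := hx
  have hy : ‖q.act γ y‖ ≤ c := hy
  show ‖q.act γ (a • x + b • y)‖ ≤ c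
  rw [e]
  refine (norm_add_le _ _).trans ?_
  rw [norm_smul, norm_smul, Real.norm_of_nonneg ha, Real.norm_of_nonneg hb]
  have h1 := mul_le_mul_of_nonneg_left hx ha
  have h2 := mul_le_mul_of_nonneg_left hy hb
  have h3 : a * c + b * c = c := by rw [← add_mul, hab, one_mul]
  linarith

lemma exists_section (hp : ∀ γ, (q.L γ)ᵀ * J * q.L γ = J) (hprop : ∀ R : ℝ, {γ | ‖q.L γ‖ ≤ R}.Finite)
    (R : ℝ) (hR : ∀ p, ∃ γ, ‖q.L γ * G p‖ ≤ R) :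
    ∃ C : ℝ → ℝ, ∃ S : C(ℝ × ℝ, V3), ∀ p γ r, ‖q.L γ * G p‖ ≤ r → ‖q.act γ (S p)‖ ≤ C r := by
  set K := ‖J‖ * (3 * (R + 1)) * ‖J‖ with hK
  have hC : ∀ r : ℝ, ∃ c : ℝ, ∀ ε, ‖q.L ε‖ ≤ r * K → ‖q.u ε‖ ≤ c := by
    intro r
    obtain ⟨c, hc⟩ := ((hprop (r * K)).image (fun ε => ‖q.u ε‖)).bddAbove
    exact ⟨c, fun ε hε => hc ⟨ε, hε, rfl⟩⟩
  choose C hC using hC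
  obtain ⟨S, hS⟩ := exists_continuous_forall_mem_convex_of_local_const
    (t := fun p : ℝ × ℝ => {z : V3 | ∀ γ r, ‖q.L γ * G p‖ ≤ r → ‖q.act γ z‖ ≤ C r}) (by
      intro p
      have : {z : V3 | ∀ γ r, ‖q.L γ * G p‖ ≤ r → ‖q.act γ z‖ ≤ C r} =
        ⋂ γ, ⋂ r, ⋂ (_ : ‖q.L γ * G p‖ ≤ r), {z | ‖q.act γ z‖ ≤ C r} := by
          ext z; simp
      rw [this]
      exact convex_iInter fun γ => convex_iInter fun r => convex_iInter fun _ => q.act_conv γ (C r)) (by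
      intro p
      obtain ⟨δ, hδ⟩ := hR p
      refine ⟨q.u δ⁻¹, ?_⟩
      have hcont : Continuous (fun y => ‖q.L δ * G y‖) :=
        (continuous_const.matrix_mul cont_G).norm
      filter_upwards [(hcont.tendsto p).eventually (gt_mem_nhds (lt_of_le_of_lt hδ (lt_add_one R)))] with y hy
      intro γ r hr
      have e : q.act γ (q.u δ⁻¹) = q.u (γ * δ⁻¹) := by
        rw [q.hu, act_def, add_comm]
      rw [e]
      apply hC
      have e2 : q.L (γ * δ⁻¹) = (q.L γ * G y) * (J * (q.L δ * G y)ᵀ * J) := by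
        have h1 := (OJ_inv _ (q.OJ_LG hp δ y)).2
        calc q.L (γ * δ⁻¹) = q.L (γ * δ⁻¹) * ((q.L δ * G y) * (J * (q.L δ * G y)ᵀ * J)) := by
              rw [h1, mul_one]
          _ = (q.L (γ * δ⁻¹) * q.L δ * G y) * (J * (q.L δ * G y)ᵀ * J) := by
              simp only [mul_assoc]
          _ = _ := by rw [← map_mul, inv_mul_cancel_right]
      rw [e2]
      refine (norm_mul_le _ _).trans ?_
      have h3 := OJ_inv_norm _ (q.OJ_LG hp δ y)
      have h4 : ‖J * (q.L δ * G y)ᵀ * J‖ ≤ K := by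
        refine h3.trans ?_
        rw [hK]
        gcongr
      exact mul_le_mul hr h4 (norm_nonneg _) ((norm_nonneg _).trans hr))
  exact ⟨C, S, fun p => hS p⟩

lemma diff_bound (hp : ∀ γ, (q.L γ)ᵀ * J * q.L γ = J) (R : ℝ) (hR : ∀ p, ∃ γ, ‖q.L γ * G p‖ ≤ R)
    (C : ℝ → ℝ) (S : C(ℝ × ℝ, V3)) (hS : ∀ p γ r, ‖q.L γ * G p‖ ≤ r → ‖q.act γ (S p)‖ ≤ C r)
    (h : M3) : ∃ c : ℝ, ∀ p p', G p' = G p * h → ‖Gi p *ᵥ (S p' - S p)‖ ≤ c := by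
  refine ⟨(‖J‖ * (3 * R) * ‖J‖) * (C (R * ‖h‖) + C R), ?_⟩
  intro p p' hpp
  obtain ⟨γ, hγ⟩ := hR p
  have h1 := hS p γ R hγ
  have h2 := hS p' γ (R * ‖h‖) (by
    rw [hpp, ← mul_assoc]
    exact (norm_mul_le _ _).trans (by gcongr))
  have e : Gi p *ᵥ (S p' - S p) = (J * (q.L γ * G p)ᵀ * J) *ᵥ (q.act γ (S p') - q.act γ (S p)) := by
    have h3 := (OJ_inv _ (q.OJ_LG hp γ p)).1
    have h4 : J * (q.L γ * G p)ᵀ * J * q.L γ = Gi p := by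
      calc J * (q.L γ * G p)ᵀ * J * q.L γ = J * (q.L γ * G p)ᵀ * J * q.L γ * (G p * Gi p) := by
            rw [G_Gi, mul_one]
        _ = (J * (q.L γ * G p)ᵀ * J * (q.L γ * G p)) * Gi p := by simp only [mul_assoc]
        _ = Gi p := by rw [h3, one_mul]
    rw [act_def, act_def, add_sub_add_right_eq_sub, ← Matrix.mulVec_sub, Matrix.mulVec_mulVec, h4]
  rw [e]
  refine (Matrix.linfty_opNorm_mulVec _ _).trans ?_
  have h5 : ‖J * (q.L γ * G p)ᵀ * J‖ ≤ ‖J‖ * (3 * R) * ‖J‖ := by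
    refine (OJ_inv_norm _ (q.OJ_LG hp γ p)).trans ?_
    gcongr
  refine mul_le_mul h5 ((norm_sub_le _ _).trans (add_le_add h2 h1)) (norm_nonneg _) ((norm_nonneg _).trans h5)

end PA
end Mess

open scoped commutatorElement

namespace Mess

open Filter Topology

/-- averages over Folner sets -/
noncomputable def avg (f : ℕ → ℕ → ℝ) (N : ℕ) : ℝ :=
  (∑ j ∈ Finset.range (4 ^ N), ∑ k ∈ Finset.range N, f j k) / (N * 4 ^ N)

/-- averages vanish in the limit -/
def Zf (f : ℕ → ℕ → ℝ) : Prop := Tendsto (avg f) atTop (𝓝 0)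

lemma Zf.add {f g : ℕ → ℕ → ℝ} (hf : Zf f) (hg : Zf g) : Zf (fun j k => f j k + g j k) := by
  have := Tendsto.add hf hg
  rw [add_zero] at this
  refine this.congr fun N => ?_
  simp only [avg, Finset.sum_add_distrib, add_div]

lemma Zf.mul {f : ℕ → ℕ → ℝ} (hf : Zf f) (c : ℝ) : Zf (fun j k => c * f j k) := by
  have := Tendsto.const_mul c hf
  rw [mul_zero] at this
  refine this.congr fun N => ?_
  simp only [avg, ← Finset.mul_sum, mul_div_assoc]

lemma Zf.zero : Zf (fun _ _ => 0) := by
  refine tendsto_const_nhds.congr fun N => ?_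
  simp [avg]

lemma Zf.sa (f : ℕ → ℕ → ℝ) (b : ℝ) (hb : ∀ j k, |f j k| ≤ b) : Zf (fun j k => f j (k + 1) - f j k) := by
  refine squeeze_zero_norm' (a := fun N : ℕ => (2 * b) / (N : ℝ)) ?_ ?_
  · filter_upwards [eventually_gt_atTop 0] with N hN
    have hN' : (0 : ℝ) < N := by exact_mod_cast hN
    simp only [avg]
    rw [norm_div, Real.norm_eq_abs, Real.norm_of_nonneg (by positivity : (0:ℝ) ≤ N * 4 ^ N)]
    have h1 : |∑ j ∈ Finset.range (4 ^ N), ∑ k ∈ Finset.range N, (f j (k + 1) - f j k)| ≤ 4 ^ N * (2 * b) := by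
      refine (Finset.abs_sum_le_sum_abs _ _).trans ?_
      refine (Finset.sum_le_card_nsmul _ _ (2 * b) ?_).trans (by simp)
      intro j _
      rw [Finset.sum_range_sub]
      have h1 := hb j N
      have h2 := hb j 0
      exact (abs_sub _ _).trans (by linarith)
    rw [div_le_div_iff₀ (by positivity) hN']
    nlinarith
  · exact tendsto_const_nhds.div_atTop tendsto_natCast_atTop_atTop

lemma shift_sum (g : ℕ → ℝ) (b : ℝ) (hb : ∀ j, |g j| ≤ b) (M m : ℕ) :
    |∑ j ∈ Finset.range M, (g (j + m) - g j)| ≤ m * (2 * b) := by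
  induction m with
  | zero => simp
  | succ m ih =>
    have e : ∑ j ∈ Finset.range M, (g (j + (m + 1)) - g j) =
      (g (M + m) - g (0 + m)) + ∑ j ∈ Finset.range M, (g (j + m) - g j) := by
      rw [← Finset.sum_range_sub (fun j => g (j + m)), ← Finset.sum_add_distrib]
      refine Finset.sum_congr rfl fun j _ => ?_
      rw [show j + (m + 1) = j + 1 + m by ring]
      ring
    rw [e]
    have h1 := hb (M + m)
    have h2 := hb (0 + m)
    refine (abs_add_le _ _).trans ?_
    have := abs_sub (g (M + m)) (g (0 + m))
    push_cast
    linarith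

lemma Zf.sn (f : ℕ → ℕ → ℝ) (b : ℝ) (hb : ∀ j k, |f j k| ≤ b) : Zf (fun j k => f (j + 2 ^ k) k - f j k) := by
  have hb0 : 0 ≤ b := (abs_nonneg _).trans (hb 0 0)
  refine squeeze_zero_norm' (a := fun N : ℕ => (2 * b) / (2 : ℝ) ^ N) ?_ ?_
  · filter_upwards [eventually_gt_atTop 0] with N hN
    have hN' : (0 : ℝ) < N := by exact_mod_cast hN
    simp only [avg]
    rw [norm_div, Real.norm_eq_abs, Real.norm_of_nonneg (by positivity : (0:ℝ) ≤ N * 4 ^ N)]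
    have h1 : |∑ j ∈ Finset.range (4 ^ N), ∑ k ∈ Finset.range N, (f (j + 2 ^ k) k - f j k)| ≤
        N * (2 ^ N * (2 * b)) := by
      rw [Finset.sum_comm]
      refine (Finset.abs_sum_le_sum_abs _ _).trans ?_
      refine (Finset.sum_le_card_nsmul _ _ (2 ^ N * (2 * b)) ?_).trans (by simp)
      intro k hk
      refine (shift_sum (fun j => f j k) b (fun j => hb j k) _ _).trans ?_
      push_cast
      gcongr
      · norm_num
      · exact (Finset.mem_range.mp hk).le
    rw [div_le_div_iff₀ (by positivity) (by positivity)]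
    have e : (4 : ℝ) ^ N = 2 ^ N * 2 ^ N := by rw [← mul_pow]; norm_num
    rw [e]
    calc _ ≤ N * (2 ^ N * (2 * b)) * (2 : ℝ) ^ N := by gcongr
      _ = _ := by ring
  · exact tendsto_const_nhds.div_atTop (tendsto_pow_atTop_atTop_of_one_lt (by norm_num))

lemma Zf.not_gt (f : ℕ → ℕ → ℝ) (hf : Zf f) : ∃ j k, f j k ≤ 1 := by
  by_contra h
  push Not at h
  have : (1 : ℝ) ≤ 0 := by
    refine ge_of_tendsto hf ?_
    filter_upwards [eventually_gt_atTop 0] with N hN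
    have hN' : (0 : ℝ) < N := by exact_mod_cast hN
    rw [avg, le_div_iff₀ (by positivity), one_mul]
    have h1 : ∑ j ∈ Finset.range (4 ^ N), ∑ k ∈ Finset.range N, (1 : ℝ) ≤
        ∑ j ∈ Finset.range (4 ^ N), ∑ k ∈ Finset.range N, f j k :=
      Finset.sum_le_sum fun j _ => Finset.sum_le_sum fun k _ => (h j k).le
    refine le_trans (le_of_eq ?_) h1
    simp
    ring
  norm_num at this

lemma Zf.shift (f : ℕ → ℕ → ℝ) (b : ℝ) (hb : ∀ j k, |f j k| ≤ b) (hf : Zf f) (i : ℕ) :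
    Zf (fun j k => f j (k + i)) := by
  induction i with
  | zero => exact hf
  | succ i ih =>
    have := ih.add (Zf.sa (fun j k => f j (k + i)) b (fun j k => hb _ _))
    convert this using 3 with j k
    rw [show k + (i + 1) = k + 1 + i by ring]
    ring

lemma Zf.sum (f : ℕ → ℕ → ℝ) (b : ℝ) (hb : ∀ j k, |f j k| ≤ b) (hf : Zf f) (n : ℕ) :
    Zf (fun j k => ∑ i ∈ Finset.range n, f j (k + i)) := by
  induction n with
  | zero => simpa using Zf.zero
  | succ n ih =>
    simp only [Finset.sum_range_succ]
    exact ih.add (Zf.shift f b hb hf n)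

/-- key algebraic consequence of the relation `a n = n ^ 2 a` -/
lemma Zf.key (F H : ℕ → ℕ → Fin 3 → ℝ) (b : ℝ) (hF : ∀ j k i, |F j k i| ≤ b) (hH : ∀ j k i, |H j k i| ≤ b)
    (r2 : ∀ j k, H j k 2 + H (j + 2 ^ k) k 2 + F (j + 2 ^ k + 2 ^ k) k 2 - F j k 2 - 1 / 2 * H j (k + 1) 2 = 0)
    (r1 : ∀ j k, H j k 1 + (H (j + 2 ^ k) k 1 + H (j + 2 ^ k) k 2) +
      (F (j + 2 ^ k + 2 ^ k) k 1 + 2 * F (j + 2 ^ k + 2 ^ k) k 2) - F j k 1 - H j (k + 1) 1 = 0)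
    (r0 : ∀ j k, H j k 0 + (H (j + 2 ^ k) k 0 + H (j + 2 ^ k) k 1 + 1 / 2 * H (j + 2 ^ k) k 2) +
      (F (j + 2 ^ k + 2 ^ k) k 0 + 2 * F (j + 2 ^ k + 2 ^ k) k 1 + 2 * F (j + 2 ^ k + 2 ^ k) k 2)
        - F j k 0 - 2 * H j (k + 1) 0 = 0) :
    Zf (fun j k => F j k 1) := by
  have A : ∀ (f : ℕ → ℕ → Fin 3 → ℝ) (_ : ∀ j k i, |f j k i| ≤ b) i, Zf (fun j k => f j (k + 1) i - f j k i) :=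
    fun f hf i => Zf.sa (fun j k => f j k i) b (fun j k => hf j k i)
  have N : ∀ (f : ℕ → ℕ → Fin 3 → ℝ) (_ : ∀ j k i, |f j k i| ≤ b) i, Zf (fun j k => f (j + 2 ^ k) k i - f j k i) :=
    fun f hf i => Zf.sn (fun j k => f j k i) b (fun j k => hf j k i)
  have N2 : ∀ (f : ℕ → ℕ → Fin 3 → ℝ) (_ : ∀ j k i, |f j k i| ≤ b) i,
      Zf (fun j k => f (j + 2 ^ k + 2 ^ k) k i - f j k i) := by
    intro f hf i
    have := (N f hf i).add (Zf.sn (fun j k => f (j + 2 ^ k) k i) b (fun j k => hf _ k i))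
    convert this using 3 with j k
    ring
  -- H 2
  have hH2 : Zf (fun j k => H j k 2) := by
    have := (((N H hH 2).add (N2 F hF 2)).add ((A H hH 2).mul (-1/2))).mul (-2/3)
    convert this using 3 with j k
    linear_combination (2/3) * r2 j k
  have h1 := ((((N H hH 1).add (N H hH 2)).add (N2 F hF 1)).add ((N2 F hF 2).mul 2)).add ((A H hH 1).mul (-1))
  have h0 := (((((N H hH 0).add (N H hH 1)).add ((N H hH 2).mul (1/2))).add (N2 F hF 0)).add
    (((N2 F hF 1).add (N2 F hF 2)).mul 2)).add ((A H hH 0).mul (-2))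
  have := ((h1.mul (1/2)).add (h0.mul (-1/2))).add (hH2.mul (1/4))
  convert this using 3 with j k
  linear_combination (1/2) * r0 j k - (1/2) * r1 j k

end Mess

open scoped commutatorElement

namespace Mess

open scoped Matrix Matrix.Norms.Operator
open Filter Topology

/-- right multiplication by the diagonal element, in coordinates -/
noncomputable def sh (n : ℕ) (p : ℝ × ℝ) : ℝ × ℝ := (p.1, p.2 + n * Real.log 2)
/-- right multiplication by the unipotent element, in coordinates -/
noncomputable def nsh (p : ℝ × ℝ) : ℝ × ℝ := (p.1 + Real.exp p.2, p.2)
/-- lattice points -/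
noncomputable def P (j k : ℕ) : ℝ × ℝ := (j, k * Real.log 2)
/-- diagonal -/
noncomputable def aT (n : ℕ) : M3 := !![2 ^ n, 0, 0; 0, 1, 0; 0, 0, (2 ^ n)⁻¹]
/-- unipotent -/
noncomputable def nM : M3 := !![1, 1, 1 / 2; 0, 1, 1; 0, 0, 1]

lemma exp_nlog (n : ℕ) : Real.exp (n * Real.log 2) = 2 ^ n := by
  rw [mul_comm, Real.exp_mul, Real.exp_log (by norm_num)]; simp

lemma sh_zero (p : ℝ × ℝ) : sh 0 p = p := by simp [sh]
lemma sh_succ (n : ℕ) (p : ℝ × ℝ) : sh (n + 1) p = sh 1 (sh n p) := by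
  simp only [sh]; push_cast; congr 1; ring
lemma sh_P (n j k : ℕ) : sh n (P j k) = P j (k + n) := by
  simp only [sh, P]; push_cast; congr 1; ring
lemma nsh_P (j k : ℕ) : nsh (P j k) = P (j + 2 ^ k) k := by
  simp only [nsh, P, exp_nlog]; push_cast; rfl
lemma nsh_sh (p : ℝ × ℝ) : nsh (sh 1 p) = sh 1 (nsh (nsh p)) := by
  simp only [nsh, sh, Real.exp_add, exp_nlog]
  congr 1; ring
lemma cont_sh (n : ℕ) : Continuous (sh n) := by unfold sh; fun_prop

lemma G_sh (n : ℕ) (p : ℝ × ℝ) : G (sh n p) = G p * aT n := by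
  have h2 : (2 : ℝ) ^ n ≠ 0 := by positivity
  ext i j
  rw [mul_fin_three]
  fin_cases i <;> fin_cases j <;>
    simp [G, sh, aT, Real.exp_add, Real.exp_neg, exp_nlog] <;> (try field_simp)

lemma G_nsh (p : ℝ × ℝ) : G (nsh p) = G p * nM := by
  have h := exp_mul_neg p.2
  generalize hE : Real.exp p.2 = e at *
  generalize hF : Real.exp (-p.2) = f at *
  ext i j
  rw [mul_fin_three]
  fin_cases i <;> fin_cases j <;> simp [G, nsh, nM, hE, hF]
  all_goals first | ring1 | linear_combination h | linear_combination (p.1 + e / 2) * h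

lemma Gi_mul (p p' : ℝ × ℝ) (h : M3) (hh : G p' = G p * h) : Gi p = h * Gi p' := by
  calc Gi p = Gi p * (G p' * Gi p') := by rw [G_Gi, mul_one]
    _ = (Gi p * G p) * h * Gi p' := by rw [hh]; simp only [mul_assoc]
    _ = h * Gi p' := by rw [Gi_G, one_mul]

lemma cont_Gi : Continuous Gi := by
  refine continuous_matrix fun i j => ?_
  fin_cases i <;> fin_cases j <;> simp [Gi] <;> fun_prop

section
variable (S : ℝ × ℝ → V3)

/-- diagonal differences -/
noncomputable def Dv (n : ℕ) (p : ℝ × ℝ) : V3 := Gi p *ᵥ (S (sh n p) - S p)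
/-- unipotent differences -/
noncomputable def Hv (p : ℝ × ℝ) : V3 := Gi p *ᵥ (S (nsh p) - S p)

lemma Dv_zero (p : ℝ × ℝ) : Dv S 0 p = 0 := by simp [Dv, sh_zero]

lemma Dv_succ (n : ℕ) (p : ℝ × ℝ) : Dv S (n + 1) p = Dv S n p + aT n *ᵥ Dv S 1 (sh n p) := by
  unfold Dv
  rw [Matrix.mulVec_mulVec, ← Gi_mul p (sh n p) _ (G_sh n p), ← Matrix.mulVec_add, ← sh_succ]
  congr 1; abel

lemma rel (p : ℝ × ℝ) : Hv S p + nM *ᵥ Hv S (nsh p) + nM *ᵥ (nM *ᵥ Dv S 1 (nsh (nsh p)))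
    - Dv S 1 p - aT 1 *ᵥ Hv S (sh 1 p) = 0 := by
  unfold Hv Dv
  rw [Matrix.mulVec_mulVec _ nM (Gi (nsh (nsh p))), ← Gi_mul (nsh p) _ _ (G_nsh _),
    Matrix.mulVec_mulVec, Matrix.mulVec_mulVec, ← Gi_mul p _ _ (G_nsh p),
    Matrix.mulVec_mulVec, ← Gi_mul p _ _ (G_sh 1 p), ← Matrix.mulVec_add, ← Matrix.mulVec_add,
    ← Matrix.mulVec_sub, ← Matrix.mulVec_sub, nsh_sh]
  rw [show ∀ a b c d e : V3, b - a + (c - b) + (d - c) - (e - a) - (d - e) = 0 by intros; abel]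
  simp

lemma Dv_coords (b : ℝ) (hb : ∀ p i, |Dv S 1 p i| ≤ b) (n : ℕ) (p : ℝ × ℝ) :
    |Dv S n p 0| ≤ b * 2 ^ n ∧ Dv S n p 1 = ∑ i ∈ Finset.range n, Dv S 1 (sh i p) 1 ∧
    |Dv S n p 2| ≤ 2 * b * (1 - (2 ^ n)⁻¹) := by
  induction n with
  | zero =>
    have : 0 ≤ b := (abs_nonneg _).trans (hb p 0)
    simp [Dv_zero, this]
  | succ n ih =>
    obtain ⟨h0, h1, h2⟩ := ih
    have hp : (0 : ℝ) < 2 ^ n := by positivity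
    rw [Dv_succ]
    simp only [Pi.add_apply, mulVec_fin_three]
    refine ⟨?_, ?_, ?_⟩
    · simp [aT]
      have h3 := hb (sh n p) 0
      have h4 := abs_add_le (Dv S n p 0) (2 ^ n * Dv S 1 (sh n p) 0)
      rw [abs_mul, abs_of_pos hp] at h4
      have := mul_le_mul_of_nonneg_left h3 hp.le
      rw [pow_succ]
      linarith
    · simp [aT, Finset.sum_range_succ, h1]
    · simp [aT]
      have h3 := hb (sh n p) 2
      have h4 := abs_add_le (Dv S n p 2) ((2 ^ n)⁻¹ * Dv S 1 (sh n p) 2)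
      have hp' : (0 : ℝ) < (2 ^ n)⁻¹ := by positivity
      rw [abs_mul, abs_of_pos hp'] at h4
      have := mul_le_mul_of_nonneg_left h3 hp'.le
      rw [pow_succ, mul_inv]
      linarith

lemma Dv_small (b : ℝ) (hb : ∀ p i, |Dv S 1 p i| ≤ b) (hb' : ∀ p i, |Hv S p i| ≤ b) (hS : Continuous S)
    (n : ℕ) : ∃ p, |Dv S n p 1| ≤ 1 := by
  have hZ : Zf (fun j k => Dv S 1 (P j k) 1) := by
    refine Zf.key (fun j k => Dv S 1 (P j k)) (fun j k => Hv S (P j k)) b (fun j k i => hb _ i)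
      (fun j k i => hb' _ i) ?_ ?_ ?_ <;> intro j k
    · have := congrFun (rel S (P j k)) 2
      simp only [nsh_P, sh_P, Pi.add_apply, Pi.sub_apply, mulVec_fin_three, Pi.zero_apply] at this
      simp [nM, aT] at this
      linear_combination this
    · have := congrFun (rel S (P j k)) 1
      simp only [nsh_P, sh_P, Pi.add_apply, Pi.sub_apply, mulVec_fin_three, Pi.zero_apply] at this
      simp [nM, aT] at this
      linear_combination this
    · have := congrFun (rel S (P j k)) 0
      simp only [nsh_P, sh_P, Pi.add_apply, Pi.sub_apply, mulVec_fin_three, Pi.zero_apply] at this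
      simp [nM, aT] at this
      linear_combination this
  have hZn : Zf (fun j k => Dv S n (P j k) 1) := by
    have := Zf.sum _ b (fun j k => hb _ _) hZ n
    convert this using 3 with j k
    rw [(Dv_coords S b hb n (P j k)).2.1]
    simp only [sh_P]
  obtain ⟨j1, k1, h1⟩ := Zf.not_gt _ hZn
  obtain ⟨j2, k2, h2⟩ := Zf.not_gt _ (hZn.mul (-1))
  have hc : Continuous (fun p => Dv S n p 1) := by
    have : Continuous (fun p => Dv S n p) :=
      Continuous.matrix_mulVec cont_Gi ((hS.comp (cont_sh n)).sub hS)
    exact (continuous_apply 1).comp this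
  by_contra hcon
  push Not at hcon
  have h3 := hcon (P j1 k1)
  have h4 := hcon (P j2 k2)
  rw [lt_abs] at h3 h4
  obtain ⟨p, hp⟩ := mem_range_of_exists_le_of_exists_ge (c := 0) hc
    ⟨P j1 k1, by rcases h3 with h | h <;> linarith⟩ ⟨P j2 k2, by rcases h4 with h | h <;> linarith⟩
  have := hcon p
  simp only at hp
  rw [hp] at this
  norm_num at this

end

namespace PA
variable {Γ : Type} [Group Γ] (q : PA Γ)

lemma stepC (hp : ∀ γ, (q.L γ)ᵀ * J * q.L γ = J) (hprop : ∀ R : ℝ, {γ | ‖q.L γ‖ ≤ R}.Finite)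
    (R : ℝ) (hR : ∀ p, ∃ γ, ‖q.L γ * G p‖ ≤ R) : False := by
  obtain ⟨C, S, hS⟩ := q.exists_section hp hprop R hR
  obtain ⟨b1, hb1⟩ := q.diff_bound hp R hR C S hS (aT 1)
  obtain ⟨b2, hb2⟩ := q.diff_bound hp R hR C S hS nM
  set b := max b1 b2 with hb
  have hF : ∀ p i, |Dv S 1 p i| ≤ b := fun p i =>
    (norm_le_pi_norm (Dv S 1 p) i).trans ((hb1 _ _ (G_sh 1 p)).trans (le_max_left _ _))
  have hH : ∀ p i, |Hv S p i| ≤ b := fun p i =>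
    (norm_le_pi_norm (Hv S p) i).trans ((hb2 _ _ (G_nsh p)).trans (le_max_right _ _))
  have hb0 : 0 ≤ b := (abs_nonneg _).trans (hF 0 0)
  have hR0 : 0 ≤ R := by
    obtain ⟨γ, h⟩ := hR 0
    exact (norm_nonneg _).trans h
  set K := C R + R * (1 + 2 * b) with hK
  obtain ⟨W, hW⟩ := ((q.proper K).image (fun ε => ‖q.L ε⁻¹‖)).bddAbove
  set W' := (‖J‖ * (3 * R) * ‖J‖) * W * R with hW'
  obtain ⟨n, hn⟩ := pow_unbounded_of_one_lt W' (by norm_num : (1:ℝ) < 2)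
  obtain ⟨p, hψ⟩ := Dv_small S b hF hH S.continuous n
  obtain ⟨h0, -, h2⟩ := Dv_coords S b hF n p
  set d := Dv S n p with hd
  have hp2 : (0 : ℝ) < 2 ^ n := by positivity
  have hd2 : |d 2| ≤ 2 * b := by
    have : (0 : ℝ) < (2 ^ n)⁻¹ := by positivity
    nlinarith
  have hSd : S (sh n p) = S p + G p *ᵥ d := by
    rw [hd, Dv, Matrix.mulVec_mulVec, G_Gi, Matrix.one_mulVec]; abel
  set d' : V3 := ![0, d 1, d 2] with hd'
  set d'' : V3 := ![- (d 0 * (2 ^ n)⁻¹), 0, 0] with hd''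
  have hdd : G p *ᵥ d' = G p *ᵥ d + G (sh n p) *ᵥ d'' := by
    rw [G_sh, ← Matrix.mulVec_mulVec, ← Matrix.mulVec_add]
    congr 1
    ext i
    simp only [Pi.add_apply, mulVec_fin_three]
    fin_cases i <;> simp [aT, hd', hd'']
    field_simp
    ring
  have nd' : ‖d'‖ ≤ 1 + 2 * b := by
    apply norm_le_three _ _ (by positivity)
    · simp [hd']; positivity
    · simp [hd']; linarith
    · simp [hd']; linarith
  have nd'' : ‖d''‖ ≤ 1 + 2 * b := by
    apply norm_le_three _ _ (by positivity)
    · simp [hd'', abs_mul]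
      have : |d 0| * (2 ^ n)⁻¹ ≤ b := by
        rw [← div_eq_mul_inv, div_le_iff₀ hp2]; exact h0
      linarith
    · simp [hd'']; positivity
    · simp [hd'']; positivity
  obtain ⟨γ1, hγ1⟩ := hR p
  obtain ⟨γ2, hγ2⟩ := hR (sh n p)
  set z := S p + G p *ᵥ d' with hz
  have hz2 : z = S (sh n p) + G (sh n p) *ᵥ d'' := by
    rw [hz, hdd, hSd]; abel
  have b1' : ‖q.act γ1 z‖ ≤ K := by
    rw [hz, act_add, Matrix.mulVec_mulVec]
    refine (norm_add_le _ _).trans (add_le_add (hS _ _ _ hγ1) ?_)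
    refine (Matrix.linfty_opNorm_mulVec _ _).trans ?_
    gcongr
  have b2' : ‖q.act γ2 z‖ ≤ K := by
    rw [hz2, act_add, Matrix.mulVec_mulVec]
    refine (norm_add_le _ _).trans (add_le_add (hS _ _ _ hγ2) ?_)
    refine (Matrix.linfty_opNorm_mulVec _ _).trans ?_
    gcongr
  have hmem : ‖q.L (γ2 * γ1⁻¹)⁻¹‖ ≤ W := by
    apply hW
    refine ⟨γ2 * γ1⁻¹, ⟨q.act γ1 z, b1', ?_⟩, rfl⟩
    rw [← act_def, ← act_mul, inv_mul_cancel_right]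
    exact b2'
  have e : aT n = (J * (q.L γ1 * G p)ᵀ * J) * q.L (γ2 * γ1⁻¹)⁻¹ * (q.L γ2 * G (sh n p)) := by
    have h3 := (OJ_inv _ (q.OJ_LG hp γ1 p)).1
    have h4 : q.L (γ2 * γ1⁻¹)⁻¹ * (q.L γ2 * G (sh n p)) = q.L γ1 * G p * aT n := by
      rw [← mul_assoc, ← map_mul, G_sh, mul_inv_rev, inv_inv, inv_mul_cancel_right, mul_assoc]
    rw [mul_assoc, h4, ← mul_assoc, h3, one_mul]
  have h5 : ‖J * (q.L γ1 * G p)ᵀ * J‖ ≤ ‖J‖ * (3 * R) * ‖J‖ := by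
    refine (OJ_inv_norm _ (q.OJ_LG hp γ1 p)).trans ?_
    gcongr
  have h6 : ‖aT n‖ ≤ W' := by
    rw [e, hW']
    refine (norm_mul_le _ _).trans ?_
    have h7 : ‖J * (q.L γ1 * G p)ᵀ * J * q.L (γ2 * γ1⁻¹)⁻¹‖ ≤ (‖J‖ * (3 * R) * ‖J‖) * W :=
      (norm_mul_le _ _).trans (mul_le_mul h5 hmem (norm_nonneg _) ((norm_nonneg _).trans h5))
    exact mul_le_mul h7 hγ2 (norm_nonneg _) ((norm_nonneg _).trans h7)
  have h8 := entry_le_norm (aT n) 0 0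
  have h9 : aT n 0 0 = 2 ^ n := by simp [aT]
  rw [h9, abs_of_pos hp2] at h8
  linarith

end PA
end Mess

open scoped commutatorElement

namespace Mess

open scoped Matrix Matrix.Norms.Operator
open Filter Topology

/-- the proper affine action attached to a properly discontinuous affine action -/
noncomputable def ofAction {Γ : Type} [Group Γ] (ρ : Γ →* ((Fin 3 → ℝ) ≃ᵃ[ℝ] (Fin 3 → ℝ)))
    (h : ∀ K : Set (Fin 3 → ℝ), IsCompact K → {γ : Γ | ((ρ γ) '' K ∩ K).Nonempty}.Finite) : PA Γ where
  L :=
    { toFun := fun γ => LinearMap.toMatrix' ((ρ γ).linear : V3 →ₗ[ℝ] V3)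
      map_one' := by
        rw [map_one]
        exact LinearMap.toMatrix'_id
      map_mul' := fun γ δ => by
        rw [map_mul, ← LinearMap.toMatrix'_mul]
        rfl }
  u γ := ρ γ 0
  hu γ δ := by
    simp only [MonoidHom.coe_mk, OneHom.coe_mk, LinearMap.toMatrix'_mulVec]
    rw [map_mul]
    have := (ρ γ).map_vadd 0 (ρ δ 0)
    simp only [vadd_eq_add, add_zero] at this
    rw [AffineEquiv.mul_def, AffineEquiv.trans_apply, this, add_comm]
    rfl
  proper R := by
    refine (h (Metric.closedBall 0 R) (isCompact_closedBall 0 R)).subset ?_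
    rintro γ ⟨x, hx, hx'⟩
    refine ⟨ρ γ x, ⟨x, by simpa using hx, rfl⟩, ?_⟩
    rw [mem_closedBall_zero_iff]
    have e : ρ γ x = LinearMap.toMatrix' ((ρ γ).linear : V3 →ₗ[ℝ] V3) *ᵥ x + ρ γ 0 := by
      rw [LinearMap.toMatrix'_mulVec]
      have := (ρ γ).map_vadd 0 x
      simp only [vadd_eq_add, add_zero] at this
      exact this
    rw [e]
    exact hx'

end Mess

theorem mess_no_proper_affine_action_of_surface_group (g : ℕ) (hg : 2 ≤ g)
    (ρ : SurfaceGroup g →* ((Fin 3 → ℝ) ≃ᵃ[ℝ] (Fin 3 → ℝ))) :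
    ¬ (∀ K : Set (Fin 3 → ℝ), IsCompact K →
        {γ : SurfaceGroup g | ((ρ γ) '' K ∩ K).Nonempty}.Finite) := by
  intro h
  obtain ⟨a, δ₀, hδ⟩ := Mess.h_one g hg
  obtain ⟨S0, hS0⟩ := Mess.h_four g
  obtain ⟨q, hp, -, hprop⟩ := (Mess.ofAction ρ h).reduce (Mess.h_two g hg) (fun m hm => Mess.h_three g hg m hm) a δ₀ hδ S0 hS0
  rcases q.stepE hp (Set.range Mess.G) (by rintro _ ⟨p, rfl⟩; exact Mess.G_form p) with ⟨R, hR⟩ | ⟨v, hv, hv1, hlow⟩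
  · exact q.stepC hp hprop R (fun p => hR _ ⟨p, rfl⟩)
  · exact q.F3 hp hprop (Mess.h_two g hg) (fun f hf => Mess.h_five g f hf) v hv hv1 hlow
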